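/- arXiv:2312.00156 — 2 statements merged into one kernel-verified Lean document; each statement's English description precedes it below -/
import Mathlib

section
/- Let X and Y be normal color Hopf subalgebras of a cocommutative color Hopf algebra A. Then for all homogeneous x ∈ X, y ∈ Y one has x y − φ(|x|,|y|) y x = ([x₁,y₁] − ε([x₁,y₁])) φ(|x₂|,|y|) y₂ x₂, which lies in [X,Y]⁺A, where [x,y] := φ(|x₂|,|y₁|) x₁ y₁ S(x₂) S(y₂) and [X,Y]⁺ denotes the augmentation ideal of [X,Y]. -/
open TensorProduct

namespace ColorHopfPaper

variable (k : Type*) [Field k] (G : Type*) [CommGroup G]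

/-- The "middle interchange" map `(A⊗A)⊗(B⊗B) → (A⊗B)⊗(A⊗B)` built from a braiding
`c : A⊗B → B⊗A` applied to the two middle factors. -/
noncomputable def midMap {A B : Type*} [AddCommGroup A] [Module k A]
    [AddCommGroup B] [Module k B] (c : A ⊗[k] B →ₗ[k] B ⊗[k] A) :
    (A ⊗[k] A) ⊗[k] (B ⊗[k] B) →ₗ[k] (A ⊗[k] B) ⊗[k] (A ⊗[k] B) :=
  (TensorProduct.assoc k A B (A ⊗[k] B)).symm.toLinearMap ∘ₗ
    (TensorProduct.map LinearMap.id
      ((TensorProduct.assoc k B A B).toLinearMap ∘ₗ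
        (TensorProduct.map c LinearMap.id) ∘ₗ
        (TensorProduct.assoc k A B B).symm.toLinearMap)) ∘ₗ
    (TensorProduct.assoc k A A (B ⊗[k] B)).toLinearMap


/-- Generic Hopf kernel `{x : x₁ ⊗ f(x₂) = x ⊗ 1}` of `f`, for a comultiplication `Δ`. -/
noncomputable def hkerGen {X B : Type*} [AddCommGroup X] [Module k X]
    [AddCommGroup B] [Module k B]
    (Δ : X →ₗ[k] X ⊗[k] X) (f : X →ₗ[k] B) (oneB : B) : Submodule k X :=
  LinearMap.ker (((TensorProduct.map LinearMap.id f) ∘ₗ Δ) -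
    (TensorProduct.mk k X B).flip oneB)

/-- A (cocommutative) color Hopf algebra: a cocommutative Hopf monoid in the symmetric
monoidal category of `G`-graded `k`-vector spaces, with braiding given by a
skew-symmetric bicharacter `φ`. -/
structure ColorHopfAlg (H : Type*) [AddCommGroup H] [Module k H] where
  φ : G → G → k
  φ_ne : ∀ g h : G, φ g h ≠ 0
  φ_mul_left : ∀ g h l : G, φ (g * h) l = φ g l * φ h l
  φ_mul_right : ∀ g h l : G, φ g (h * l) = φ g h * φ g l
  φ_skew : ∀ g h : G, φ g h * φ h g = 1
  grade : G → Submodule k H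
  grade_top : ⨆ g : G, grade g = ⊤
  mul : H ⊗[k] H →ₗ[k] H
  one : H
  comul : H →ₗ[k] H ⊗[k] H
  counit : H →ₗ[k] k
  antipode : H →ₗ[k] H
  braid : H ⊗[k] H →ₗ[k] H ⊗[k] H
  braid_apply : ∀ (g h : G) (x y : H), x ∈ grade g → y ∈ grade h →
    braid (x ⊗ₜ[k] y) = φ g h • (y ⊗ₜ[k] x)
  one_mem : one ∈ grade 1
  mul_mem : ∀ (g h : G) (x y : H), x ∈ grade g → y ∈ grade h →
    mul (x ⊗ₜ[k] y) ∈ grade (g * h)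
  antipode_mem : ∀ (g : G) (x : H), x ∈ grade g → antipode x ∈ grade g
  mul_assoc' : ∀ x y z : H,
    mul (mul (x ⊗ₜ[k] y) ⊗ₜ[k] z) = mul (x ⊗ₜ[k] mul (y ⊗ₜ[k] z))
  one_mul' : ∀ x : H, mul (one ⊗ₜ[k] x) = x
  mul_one' : ∀ x : H, mul (x ⊗ₜ[k] one) = x
  coassoc : (TensorProduct.assoc k H H H).toLinearMap ∘ₗ
      (TensorProduct.map comul LinearMap.id) ∘ₗ comul
      = (TensorProduct.map LinearMap.id comul) ∘ₗ comul
  counit_left : ∀ x : H,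
    (TensorProduct.lid k H) ((TensorProduct.map counit LinearMap.id) (comul x)) = x
  counit_right : ∀ x : H,
    (TensorProduct.rid k H) ((TensorProduct.map LinearMap.id counit) (comul x)) = x
  comul_one : comul one = one ⊗ₜ[k] one
  counit_one : counit one = 1
  counit_mul : ∀ x y : H, counit (mul (x ⊗ₜ[k] y)) = counit x * counit y
  comul_mul : comul ∘ₗ mul =
    (TensorProduct.map mul mul) ∘ₗ midMap k braid ∘ₗ (TensorProduct.map comul comul)
  cocomm : braid ∘ₗ comul = comul
  antipode_left : ∀ x : H,
    mul ((TensorProduct.map antipode LinearMap.id) (comul x)) = counit x • one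
  antipode_right : ∀ x : H,
    mul ((TensorProduct.map LinearMap.id antipode) (comul x)) = counit x • one

namespace ColorHopfAlg

variable {k G}
variable {H : Type*} [AddCommGroup H] [Module k H] (C : ColorHopfAlg k G H)

/-- An element is homogeneous if it lies in one of the graded components. -/
def homogeneous (x : H) : Prop := ∃ g : G, x ∈ C.grade g

/-- The (color) adjoint action `ξ(a ⊗ b) = φ(|a₂|,|b|) a₁ b S(a₂)`. -/
noncomputable def adj : H ⊗[k] H →ₗ[k] H :=
  C.mul ∘ₗ
    (TensorProduct.map LinearMap.id
      (C.mul ∘ₗ (TensorProduct.map LinearMap.id C.antipode) ∘ₗ C.braid)) ∘ₗ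
    (TensorProduct.assoc k H H H).toLinearMap ∘ₗ
    (TensorProduct.map C.comul LinearMap.id)

/-- The commutator `[x,y] = φ(|x₂|,|y₁|) x₁y₁S(x₂)S(y₂) = (x ▷ y₁) S(y₂)`. -/
noncomputable def commMap : H ⊗[k] H →ₗ[k] H :=
  C.mul ∘ₗ (TensorProduct.map C.adj C.antipode) ∘ₗ
    (TensorProduct.assoc k H H H).symm.toLinearMap ∘ₗ
    (TensorProduct.map LinearMap.id C.comul)

/-- The comultiplication of the tensor-product (product) coalgebra `H ⊗ H`:
`x ⊗ y ↦ φ(|x₂|,|y₁|) (x₁⊗y₁)⊗(x₂⊗y₂)`. -/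
noncomputable def comul2 : H ⊗[k] H →ₗ[k] (H ⊗[k] H) ⊗[k] (H ⊗[k] H) :=
  midMap k C.braid ∘ₗ TensorProduct.map C.comul C.comul

/-- The counit of the tensor-product coalgebra `H ⊗ H`. -/
noncomputable def counit2 : H ⊗[k] H →ₗ[k] k :=
  (TensorProduct.lid k k).toLinearMap ∘ₗ TensorProduct.map C.counit C.counit

/-- `V` is a (graded) color Hopf subalgebra of `H`. -/
structure IsCHSub (V : Submodule k H) : Prop where
  one_mem : C.one ∈ V
  mul_mem : ∀ x ∈ V, ∀ y ∈ V, C.mul (x ⊗ₜ[k] y) ∈ V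
  comul_mem : ∀ x ∈ V,
    C.comul x ∈ LinearMap.range (TensorProduct.map V.subtype V.subtype)
  antipode_mem : ∀ x ∈ V, C.antipode x ∈ V
  graded : ∀ x ∈ V, x ∈ Submodule.span k {y : H | y ∈ V ∧ ∃ g : G, y ∈ C.grade g}

/-- `V` is normal: closed under the adjoint action of all of `H`. -/
def IsNormal (V : Submodule k H) : Prop :=
  ∀ a : H, ∀ x ∈ V, C.adj (a ⊗ₜ[k] x) ∈ V

/-- The subalgebra (as a submodule) generated by a set. -/
def genFrom (Sgen : Set H) : Submodule k H :=
  sInf {V : Submodule k H |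
    Sgen ⊆ ↑V ∧ C.one ∈ V ∧ ∀ x ∈ V, ∀ y ∈ V, C.mul (x ⊗ₜ[k] y) ∈ V}

/-- The commutator subalgebra `[X,Y]`, generated by all `[x,y]` with `x ∈ V`, `y ∈ W`. -/
def commSub (V W : Submodule k H) : Submodule k H :=
  C.genFrom {z : H | ∃ x ∈ V, ∃ y ∈ W, z = C.commMap (x ⊗ₜ[k] y)}

/-- The graded subspace `VW` spanned by products `vw`. -/
def prodSpan (V W : Submodule k H) : Submodule k H :=
  Submodule.span k {z : H | ∃ x ∈ V, ∃ y ∈ W, z = C.mul (x ⊗ₜ[k] y)}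

/-- The Hopf kernel `Hker(f) = {x : x₁ ⊗ f(x₂) = x ⊗ 1}` of a map `f : H → B`. -/
noncomputable def hkerOf {B : Type*} [AddCommGroup B] [Module k B]
    (CB : ColorHopfAlg k G B) (f : H →ₗ[k] B) : Submodule k H :=
  LinearMap.ker
    (((TensorProduct.map LinearMap.id f) ∘ₗ C.comul) -
      (TensorProduct.mk k H B).flip CB.one)

end ColorHopfAlg

/-- A morphism of color Hopf algebras. -/
structure IsColorHom {A B : Type*} [AddCommGroup A] [Module k A]
    [AddCommGroup B] [Module k B]
    (CA : ColorHopfAlg k G A) (CB : ColorHopfAlg k G B) (f : A →ₗ[k] B) : Prop where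
  map_mul : ∀ x y : A, f (CA.mul (x ⊗ₜ[k] y)) = CB.mul (f x ⊗ₜ[k] f y)
  map_one : f CA.one = CB.one
  map_comul : CB.comul ∘ₗ f = (TensorProduct.map f f) ∘ₗ CA.comul
  map_counit : CB.counit ∘ₗ f = CA.counit
  map_grade : ∀ g : G, ∀ x ∈ CA.grade g, f x ∈ CB.grade g

/-- A color Hopf crossed module `(A, H, d)`. -/
structure ColorCrossedMod {A H : Type*} [AddCommGroup A] [Module k A]
    [AddCommGroup H] [Module k H]
    (CA : ColorHopfAlg k G A) (CH : ColorHopfAlg k G H) where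
  cAH : A ⊗[k] H →ₗ[k] H ⊗[k] A
  cHA : H ⊗[k] A →ₗ[k] A ⊗[k] H
  cAH_apply : ∀ (g h : G) (a : A) (x : H), a ∈ CA.grade g → x ∈ CH.grade h →
    cAH (a ⊗ₜ[k] x) = CA.φ g h • (x ⊗ₜ[k] a)
  cHA_apply : ∀ (g h : G) (x : H) (a : A), x ∈ CH.grade g → a ∈ CA.grade h →
    cHA (x ⊗ₜ[k] a) = CH.φ g h • (a ⊗ₜ[k] x)
  φ_eq : CH.φ = CA.φ
  act : A ⊗[k] H →ₗ[k] H
  act_one_left : ∀ x : H, act (CA.one ⊗ₜ[k] x) = x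
  act_act : ∀ (a b : A) (x : H),
    act (a ⊗ₜ[k] act (b ⊗ₜ[k] x)) = act (CA.mul (a ⊗ₜ[k] b) ⊗ₜ[k] x)
  act_one : ∀ a : A, act (a ⊗ₜ[k] CH.one) = CA.counit a • CH.one
  counit_act : ∀ (a : A) (x : H),
    CH.counit (act (a ⊗ₜ[k] x)) = CA.counit a * CH.counit x
  comul_act : CH.comul ∘ₗ act =
    (TensorProduct.map act act) ∘ₗ midMap k cAH ∘ₗ
      (TensorProduct.map CA.comul CH.comul)
  act_mul : act ∘ₗ (TensorProduct.map LinearMap.id CH.mul) =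
    CH.mul ∘ₗ (TensorProduct.map act act) ∘ₗ midMap k cAH ∘ₗ
      (TensorProduct.map CA.comul LinearMap.id)
  act_grade : ∀ (g h : G) (a : A) (x : H), a ∈ CA.grade g → x ∈ CH.grade h →
    act (a ⊗ₜ[k] x) ∈ CH.grade (g * h)
  d : H →ₗ[k] A
  d_hom : IsColorHom k G CH CA d
  peiffer₁ : d ∘ₗ act = CA.adj ∘ₗ (TensorProduct.map LinearMap.id d)
  peiffer₂ : act ∘ₗ (TensorProduct.map d LinearMap.id) = CH.adj

namespace ColorCrossedMod

variable {k G}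
variable {A H : Type*} [AddCommGroup A] [Module k A] [AddCommGroup H] [Module k H]
variable {CA : ColorHopfAlg k G A} {CH : ColorHopfAlg k G H}

/-- The multiplication of the semi-direct (smash) product `H ⋊ A`:
`(h⊗a)(h'⊗a') = φ(|a₂|,|h'|) h (a₁·h') ⊗ a₂a'`. -/
noncomputable def smashMul (M : ColorCrossedMod k G CA CH) : (H ⊗[k] A) ⊗[k] (H ⊗[k] A) →ₗ[k] H ⊗[k] A :=
  (TensorProduct.map CH.mul CA.mul) ∘ₗ
  (TensorProduct.assoc k (H ⊗[k] H) A A).toLinearMap ∘ₗ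
  (TensorProduct.map (TensorProduct.assoc k H H A).symm.toLinearMap LinearMap.id) ∘ₗ
  (TensorProduct.map
    (TensorProduct.map LinearMap.id (TensorProduct.map M.act LinearMap.id))
    LinearMap.id) ∘ₗ
  (TensorProduct.map
    ((TensorProduct.map LinearMap.id
        ((TensorProduct.assoc k A H A).symm.toLinearMap ∘ₗ
          (TensorProduct.map LinearMap.id M.cAH) ∘ₗ
          (TensorProduct.assoc k A A H).toLinearMap)) ∘ₗ
      (TensorProduct.assoc k H (A ⊗[k] A) H).toLinearMap)
    LinearMap.id) ∘ₗ
  (TensorProduct.assoc k (H ⊗[k] (A ⊗[k] A)) H A).symm.toLinearMap ∘ₗ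
  (TensorProduct.map (TensorProduct.map LinearMap.id CA.comul) LinearMap.id)

/-- The comultiplication of `H ⋊ A` (tensor-product coalgebra twisted by `φ`). -/
noncomputable def smashComul (M : ColorCrossedMod k G CA CH) : H ⊗[k] A →ₗ[k] (H ⊗[k] A) ⊗[k] (H ⊗[k] A) :=
  midMap k M.cHA ∘ₗ TensorProduct.map CH.comul CA.comul

/-- The counit of `H ⋊ A`. -/
noncomputable def smashCounit (_M : ColorCrossedMod k G CA CH) : H ⊗[k] A →ₗ[k] k :=
  (TensorProduct.lid k k).toLinearMap ∘ₗ TensorProduct.map CH.counit CA.counit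

end ColorCrossedMod


set_option linter.unusedSectionVars false

namespace CHelp

variable {k G K : Type*} [Field k] [CommGroup G] [Ring K] [Module k K]
  [IsScalarTower k K K] [SMulCommClass k K K]

/-- A colour Hopf algebra whose product is the product of an ambient ring. -/
structure RC (k G K : Type*) [Field k] [CommGroup G] [Ring K] [Module k K] extends
    ColorHopfAlg k G K where
  mul_eq : ∀ x y : K, mul (x ⊗ₜ[k] y) = x * y
  one_eq : one = 1

structure Bil (k : Type*) {K M : Type*} [Field k] [AddCommGroup K] [Module k K]
    [AddCommGroup M] [Module k M] (f : K → K → M) : Prop where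
  al : ∀ a a' b, f (a + a') b = f a b + f a' b
  ar : ∀ a b b', f a (b + b') = f a b + f a b'
  sl : ∀ (r : k) a b, f (r • a) b = r • f a b
  sr : ∀ (r : k) a b, f a (r • b) = r • f a b

noncomputable def Bil.lift {k K M : Type*} [Field k] [AddCommGroup K] [Module k K]
    [AddCommGroup M] [Module k M] {f : K → K → M} (h : Bil k f) : K ⊗[k] K →ₗ[k] M :=
  TensorProduct.lift (LinearMap.mk₂ k f h.al h.sl h.ar h.sr)

theorem Bil.lift_tmul {k K M : Type*} [Field k] [AddCommGroup K] [Module k K]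
    [AddCommGroup M] [Module k M] {f : K → K → M} (h : Bil k f) (a b : K) :
    h.lift (a ⊗ₜ b) = f a b := by
  simp [Bil.lift]

namespace RC

variable (C : RC k G K)

theorem span_hom : Submodule.span k {x : K | C.homogeneous x} = ⊤ := by
  rw [eq_top_iff, ← C.grade_top, iSup_le_iff]
  intro g x hx
  exact Submodule.subset_span ⟨g, hx⟩

/-- Induction for linear statements. -/
theorem hom_ind {p : K → Prop} (h0 : p 0) (hadd : ∀ x y, p x → p y → p (x + y))
    (hh : ∀ g, ∀ x ∈ C.grade g, p x) (x : K) : p x := by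
  have hx : x ∈ Submodule.span k {x : K | C.homogeneous x} := by
    rw [span_hom]; trivial
  induction hx using Submodule.span_induction with
  | mem x h => obtain ⟨g, hg⟩ := h; exact hh g x hg
  | zero => exact h0
  | add x y _ _ h1 h2 => exact hadd x y h1 h2
  | smul a x hx h =>
    clear h
    induction hx using Submodule.span_induction with
    | mem x h => obtain ⟨g, hg⟩ := h; exact hh g _ (Submodule.smul_mem _ _ hg)
    | zero => simpa using h0
    | add x y _ _ h1 h2 => rw [smul_add]; exact hadd _ _ h1 h2
    | smul b x hx h => 
      rw [smul_smul]
      clear h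
      have : ∀ c : k, p (c • x) := by
        induction hx using Submodule.span_induction with
        | mem x h => obtain ⟨g, hg⟩ := h; intro c; exact hh g _ (Submodule.smul_mem _ _ hg)
        | zero => intro c; simpa using h0
        | add x y _ _ h1 h2 => intro c; rw [smul_add]; exact hadd _ _ (h1 c) (h2 c)
        | smul b x hx h => intro c; rw [smul_smul]; exact h _
      exact this _

theorem lin_ext {M : Type*} [AddCommGroup M] [Module k M] {f f' : K →ₗ[k] M}
    (h : ∀ g, ∀ x ∈ C.grade g, f x = f' x) : f = f' := by
  ext x
  refine C.hom_ind (p := fun x => f x = f' x) (by simp) ?_ h x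
  intro x y hx hy; simp [hx, hy]

theorem bil_ext {M : Type*} [AddCommGroup M] [Module k M] {f f' : K → K → M}
    (hf : Bil k f) (hf' : Bil k f')
    (h : ∀ g, ∀ x ∈ C.grade g, ∀ h, ∀ y ∈ C.grade h, f x y = f' x y) (x y : K) :
    f x y = f' x y := by
  have h0 : ∀ {f : K → K → M}, Bil k f → ∀ y, f 0 y = 0 := by
    intro f hf y; have := hf.sl 0 0 y; simpa using this
  have h0' : ∀ {f : K → K → M}, Bil k f → ∀ y, f y 0 = 0 := by
    intro f hf y; have := hf.sr 0 y 0; simpa using this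
  refine C.hom_ind (p := fun x => ∀ y, f x y = f' x y) ?_ ?_ ?_ x y
  · intro y; rw [h0 hf, h0 hf']
  · intro x x' hx hx' y; rw [hf.al, hf'.al, hx, hx']
  · intro g x hx y
    refine C.hom_ind (p := fun y => f x y = f' x y) ?_ ?_ ?_ y
    · rw [h0' hf, h0' hf']
    · intro y y' hy hy'; rw [hf.ar, hf'.ar, hy, hy']
    · intro h' y hy; exact h g x hx h' y hy

theorem exists_rep (t : K ⊗[k] K) : ∃ l : List (K × K),
    (∀ p ∈ l, C.homogeneous p.1 ∧ C.homogeneous p.2) ∧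
      (l.map (fun p => p.1 ⊗ₜ[k] p.2)).sum = t := by
  induction t using TensorProduct.induction_on with
  | zero => exact ⟨[], by simp, by simp⟩
  | add x y hx hy =>
    obtain ⟨l, h1, h2⟩ := hx
    obtain ⟨l', h1', h2'⟩ := hy
    refine ⟨l ++ l', ?_, by simp [h2, h2']⟩
    intro p hp
    rcases List.mem_append.1 hp with h | h
    · exact h1 p h
    · exact h1' p h
  | tmul x y =>
    revert y
    refine C.hom_ind (p := fun x => ∀ y, ∃ l : List (K × K),
      (∀ p ∈ l, C.homogeneous p.1 ∧ C.homogeneous p.2) ∧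
      (l.map (fun p => p.1 ⊗ₜ[k] p.2)).sum = x ⊗ₜ y) ?_ ?_ ?_ x
    · intro y; exact ⟨[], by simp, by simp⟩
    · intro x x' hx hx' y
      obtain ⟨l, h1, h2⟩ := hx y
      obtain ⟨l', h1', h2'⟩ := hx' y
      refine ⟨l ++ l', ?_, by simp [h2, h2', TensorProduct.add_tmul]⟩
      intro p hp
      rcases List.mem_append.1 hp with h | h
      · exact h1 p h
      · exact h1' p h
    · intro g x hxg y
      refine C.hom_ind (p := fun y => ∃ l : List (K × K),
        (∀ p ∈ l, C.homogeneous p.1 ∧ C.homogeneous p.2) ∧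
        (l.map (fun p => p.1 ⊗ₜ[k] p.2)).sum = x ⊗ₜ y) ?_ ?_ ?_ y
      · exact ⟨[], by simp, by simp⟩
      · intro x1 x' hx hx'
        obtain ⟨l, h1, h2⟩ := hx
        obtain ⟨l', h1', h2'⟩ := hx'
        refine ⟨l ++ l', ?_, by simp [h2, h2', TensorProduct.tmul_add]⟩
        intro p hp
        rcases List.mem_append.1 hp with h | h
        · exact h1 p h
        · exact h1' p h
      · intro h y hy
        exact ⟨[(x, y)], by simpa using ⟨⟨g, hxg⟩, ⟨h, hy⟩⟩, by simp⟩

noncomputable def rep (t : K ⊗[k] K) : List (K × K) := (C.exists_rep t).choose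

theorem rep_hom (t : K ⊗[k] K) : ∀ p ∈ C.rep t, C.homogeneous p.1 ∧ C.homogeneous p.2 :=
  (C.exists_rep t).choose_spec.1

theorem rep_sum (t : K ⊗[k] K) : ((C.rep t).map (fun p => p.1 ⊗ₜ[k] p.2)).sum = t :=
  (C.exists_rep t).choose_spec.2

/-- Sweedler sums. -/
noncomputable def sw {M : Type*} [AddCommMonoid M] (t : K ⊗[k] K) (f : K → K → M) : M :=
  ∑ i : Fin (C.rep t).length, f (C.rep t)[i].1 (C.rep t)[i].2

section sw

variable {M N : Type*} [AddCommGroup M] [Module k M] [AddCommGroup N] [Module k N]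

theorem sw_congr {t : K ⊗[k] K} {f f' : K → K → M}
    (h : ∀ g, ∀ a ∈ C.grade g, ∀ h, ∀ b ∈ C.grade h, f a b = f' a b) :
    C.sw t f = C.sw t f' := by
  unfold sw
  refine Finset.sum_congr rfl fun i _ => ?_
  obtain ⟨⟨g, hg⟩, ⟨h', hh⟩⟩ := C.rep_hom t ((C.rep t)[i]) (List.getElem_mem _)
  exact h g _ hg h' _ hh

theorem sw_congr' {t : K ⊗[k] K} {f f' : K → K → M}
    (h : ∀ a b, f a b = f' a b) : C.sw t f = C.sw t f' :=
  C.sw_congr fun _ _ _ _ _ _ => h _ _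

theorem sw_tensor (t : K ⊗[k] K) : C.sw t (fun a b => a ⊗ₜ[k] b) = t := by
  conv_rhs => rw [← C.rep_sum t]
  unfold sw
  exact Fin.sum_univ_fun_getElem (C.rep t) (fun p => p.1 ⊗ₜ[k] p.2)

theorem map_sw (L : M →ₗ[k] N) (t : K ⊗[k] K) (f : K → K → M) :
    L (C.sw t f) = C.sw t (fun a b => L (f a b)) := by
  unfold sw; rw [map_sum]

theorem sw_comm (t u : K ⊗[k] K) (f : K → K → K → K → M) :
    C.sw t (fun a b => C.sw u (fun c d => f a b c d)) =
      C.sw u (fun c d => C.sw t (fun a b => f a b c d)) := by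
  unfold sw; rw [Finset.sum_comm]

theorem sw_eq {f : K → K → M} (hf : Bil k f) (t : K ⊗[k] K) : C.sw t f = hf.lift t := by
  conv_rhs => rw [← C.sw_tensor t, C.map_sw]
  exact C.sw_congr' fun a b => (hf.lift_tmul a b).symm

theorem sw_tmul {f : K → K → M} (hf : Bil k f) (a b : K) : C.sw (a ⊗ₜ b) f = f a b := by
  rw [C.sw_eq hf, hf.lift_tmul]

theorem sw_smul_tmul {f : K → K → M} (hf : Bil k f) (r : k) (a b : K) :
    C.sw (r • (a ⊗ₜ b)) f = r • f a b := by
  rw [C.sw_eq hf, map_smul, hf.lift_tmul]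

theorem sw_map {f : K → K → M} (hf : Bil k f) (L L' : K →ₗ[k] K) (t : K ⊗[k] K) :
    C.sw (TensorProduct.map L L' t) f = C.sw t (fun a b => f (L a) (L' b)) := by
  rw [C.sw_eq hf]
  conv_lhs => rw [← C.sw_tensor t, C.map_sw, C.map_sw]
  exact C.sw_congr' fun a b => by rw [TensorProduct.map_tmul, hf.lift_tmul]

/-- sum of a Sweedler family of tensors -/
theorem sw_sw {f : K → K → M} (hf : Bil k f) (t : K ⊗[k] K) (T : K → K → K ⊗[k] K) :
    C.sw (C.sw t T) f = C.sw t (fun a b => C.sw (T a b) f) := by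
  simp only [C.sw_eq hf]
  rw [C.map_sw]

theorem mul_sw {E : Type*} [Ring E] (e : E) (t : K ⊗[k] K) (f : K → K → E) :
    e * C.sw t f = C.sw t (fun a b => e * f a b) := by
  unfold sw; rw [Finset.mul_sum]

theorem sw_mul {E : Type*} [Ring E] (e : E) (t : K ⊗[k] K) (f : K → K → E) :
    C.sw t f * e = C.sw t (fun a b => f a b * e) := by
  unfold sw; rw [Finset.sum_mul]

theorem smul_sw (r : k) (t : K ⊗[k] K) (f : K → K → M) :
    r • C.sw t f = C.sw t (fun a b => r • f a b) := by
  unfold sw; rw [Finset.smul_sum]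

structure _root_.ColorHopfPaper.CHelp.Tri (k : Type*) {K M : Type*} [Field k] [AddCommGroup K]
    [Module k K] [AddCommGroup M] [Module k M] (f : K → K → K → M) : Prop where
  a1 : ∀ a a' b c, f (a + a') b c = f a b c + f a' b c
  a2 : ∀ a b b' c, f a (b + b') c = f a b c + f a b' c
  a3 : ∀ a b c c', f a b (c + c') = f a b c + f a b c'
  s1 : ∀ (r : k) a b c, f (r • a) b c = r • f a b c
  s2 : ∀ (r : k) a b c, f a (r • b) c = r • f a b c
  s3 : ∀ (r : k) a b c, f a b (r • c) = r • f a b c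

noncomputable def _root_.ColorHopfPaper.CHelp.Tri.lift {f : K → K → K → M} (h : Tri k f) :
    K ⊗[k] (K ⊗[k] K) →ₗ[k] M :=
  TensorProduct.lift (LinearMap.mk₂ k
    (fun a t => (Bil.lift (f := f a) ⟨h.a2 a, h.a3 a, fun r => h.s2 r a, fun r => h.s3 r a⟩) t)
    (by
      intro a a' t
      rw [← LinearMap.add_apply]; congr 1
      apply TensorProduct.ext'; intro x y
      simp [Bil.lift_tmul, h.a1])
    (by
      intro r a t
      rw [← LinearMap.smul_apply]; congr 1
      apply TensorProduct.ext'; intro x y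
      simp [Bil.lift_tmul, h.s1])
    (by intros; simp) (by intros; simp))

theorem _root_.ColorHopfPaper.CHelp.Tri.lift_tmul {f : K → K → K → M} (h : Tri k f) (a b c : K) :
    h.lift (a ⊗ₜ (b ⊗ₜ c)) = f a b c := by
  simp [Tri.lift, Bil.lift_tmul]

theorem coassoc' {f : K → K → K → M} (h : Tri k f) (x : K) :
    C.sw (C.comul x) (fun r c => C.sw (C.comul r) (fun a b => f a b c)) =
      C.sw (C.comul x) (fun a r => C.sw (C.comul r) (fun b c => f a b c)) := by
  have e := congrArg h.lift (LinearMap.congr_fun C.coassoc x)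
  simp only [LinearMap.comp_apply, LinearEquiv.coe_coe] at e
  rw [← C.sw_tensor (C.comul x)] at e
  simp only [C.map_sw, TensorProduct.map_tmul, LinearMap.id_apply] at e
  have e1 : ∀ r c : K, h.lift (TensorProduct.assoc k K K K (C.comul r ⊗ₜ c)) =
      C.sw (C.comul r) (fun a b => f a b c) := by
    intro r c
    have := C.map_sw (h.lift ∘ₗ (TensorProduct.assoc k K K K).toLinearMap ∘ₗ
      (TensorProduct.mk k (K ⊗[k] K) K).flip c) (C.comul r) (fun a b => a ⊗ₜ[k] b)
    rw [C.sw_tensor] at this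
    simpa [h.lift_tmul] using this
  have e2 : ∀ r c : K, h.lift (r ⊗ₜ C.comul c) =
      C.sw (C.comul c) (fun a b => f r a b) := by
    intro r c
    have := C.map_sw (h.lift ∘ₗ (TensorProduct.mk k K (K ⊗[k] K)) r) (C.comul c) (fun a b => a ⊗ₜ[k] b)
    rw [C.sw_tensor] at this
    simpa [h.lift_tmul] using this
  have e3 := C.map_sw (h.lift ∘ₗ (TensorProduct.assoc k K K K).toLinearMap)
    (C.comul x) (fun a b => C.comul a ⊗ₜ[k] b)
  have e4 := C.map_sw h.lift (C.comul x) (fun a b => a ⊗ₜ[k] C.comul b)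
  simp only [LinearMap.comp_apply, LinearEquiv.coe_coe, e1, e2] at e3 e4
  simp only [e2] at e
  rw [← e3, ← e]
  congr 1
  have e5 := C.map_sw (M := K ⊗[k] K) (N := (K ⊗[k] K) ⊗[k] K) (TensorProduct.map C.comul (LinearMap.id : K →ₗ[k] K))
    (C.comul x) (fun a b => a ⊗ₜ[k] b)
  rw [e5]
  simp

theorem counit_l {f : K →ₗ[k] M} (x : K) :
    C.sw (C.comul x) (fun a b => C.counit a • f b) = f x := by
  conv_rhs => rw [← C.counit_left x, ← C.sw_tensor (C.comul x)]
  rw [C.map_sw, ← LinearEquiv.coe_coe, C.map_sw, C.map_sw]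
  exact C.sw_congr' fun a b => by simp

theorem counit_r {f : K →ₗ[k] M} (x : K) :
    C.sw (C.comul x) (fun a b => C.counit b • f a) = f x := by
  conv_rhs => rw [← C.counit_right x, ← C.sw_tensor (C.comul x)]
  rw [C.map_sw, ← LinearEquiv.coe_coe, C.map_sw, C.map_sw]
  exact C.sw_congr' fun a b => by simp

theorem anti_l (x : K) : C.sw (C.comul x) (fun a b => C.antipode a * b) = C.counit x • 1 := by
  rw [← C.one_eq, ← C.antipode_left x]
  conv_rhs => rw [← C.sw_tensor (C.comul x)]
  rw [C.map_sw, C.map_sw]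
  exact C.sw_congr' fun a b => by simp [C.mul_eq]

theorem anti_r (x : K) : C.sw (C.comul x) (fun a b => a * C.antipode b) = C.counit x • 1 := by
  rw [← C.one_eq, ← C.antipode_right x]
  conv_rhs => rw [← C.sw_tensor (C.comul x)]
  rw [C.map_sw, C.map_sw]
  exact C.sw_congr' fun a b => by simp [C.mul_eq]

end sw

end RC

end CHelp


namespace CHelp

variable {k G K : Type*} [Field k] [CommGroup G] [Ring K] [Module k K]
  [IsScalarTower k K K] [SMulCommClass k K K]

namespace RC

variable (C : RC k G K)

section

variable {M N : Type*} [AddCommGroup M] [Module k M] [AddCommGroup N] [Module k N]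

theorem cl {f : K → M} (hf : IsLinearMap k f) (x : K) :
    C.sw (C.comul x) (fun a b => C.counit a • f b) = f x :=
  C.counit_l (f := hf.mk' f) x

theorem cr {f : K → M} (hf : IsLinearMap k f) (x : K) :
    C.sw (C.comul x) (fun a b => C.counit b • f a) = f x :=
  C.counit_r (f := hf.mk' f) x

theorem lin2 (L : (K ⊗[k] K) ⊗[k] (K ⊗[k] K) →ₗ[k] M) (t u : K ⊗[k] K) :
    L (t ⊗ₜ u) = C.sw t fun a b => C.sw u fun c d => L ((a ⊗ₜ b) ⊗ₜ (c ⊗ₜ d)) := by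
  have h1 := C.map_sw (M := K ⊗[k] K) (L ∘ₗ (TensorProduct.mk k (K ⊗[k] K) (K ⊗[k] K)).flip u) t
    (fun a b => a ⊗ₜ[k] b)
  rw [C.sw_tensor] at h1
  simp only [LinearMap.comp_apply, LinearMap.flip_apply, TensorProduct.mk_apply] at h1
  rw [h1]
  refine C.sw_congr' fun a b => ?_
  have h2 := C.map_sw (M := K ⊗[k] K) (L ∘ₗ (TensorProduct.mk k (K ⊗[k] K) (K ⊗[k] K)) (a ⊗ₜ b)) u
    (fun a b => a ⊗ₜ[k] b)
  rw [C.sw_tensor] at h2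
  simpa only [LinearMap.comp_apply, LinearMap.flip_apply, TensorProduct.mk_apply] using h2

theorem lin_mid (L : (K ⊗[k] K) ⊗[k] (K ⊗[k] K) →ₗ[k] M) (a b c d : K) :
    L (midMap k C.braid ((a ⊗ₜ b) ⊗ₜ (c ⊗ₜ d))) =
      C.sw (C.braid (b ⊗ₜ c)) fun c' b' => L ((a ⊗ₜ c') ⊗ₜ (b' ⊗ₜ d)) := by
  have h1 := C.map_sw (M := K ⊗[k] K) (L ∘ₗ
    (TensorProduct.assoc k K K (K ⊗[k] K)).symm.toLinearMap ∘ₗ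
    (TensorProduct.mk k K (K ⊗[k] (K ⊗[k] K)) a) ∘ₗ (TensorProduct.assoc k K K K).toLinearMap ∘ₗ
     (TensorProduct.mk k (K ⊗[k] K) K).flip d) (C.braid (b ⊗ₜ c))
    (fun a b => a ⊗ₜ[k] b)
  rw [C.sw_tensor] at h1
  simpa [midMap] using h1

/-- The Sweedler form of the multiplicativity of `Δ`. -/
theorem comul_mul' {F : K → K → M} (hF : Bil k F) (x y : K) :
    C.sw (C.comul (x * y)) F = C.sw (C.comul x) fun a b => C.sw (C.comul y) fun c d =>
      C.sw (C.braid (b ⊗ₜ c)) fun c' b' => F (a * c') (b' * d) := by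
  rw [C.sw_eq hF, ← C.mul_eq, ← LinearMap.comp_apply C.comul, C.comul_mul]
  simp only [LinearMap.comp_apply, TensorProduct.map_tmul]
  have h := C.lin2 (hF.lift ∘ₗ TensorProduct.map C.mul C.mul ∘ₗ midMap k C.braid) (C.comul x) (C.comul y)
  simp only [LinearMap.comp_apply] at h
  rw [h]
  refine C.sw_congr' fun a b => C.sw_congr' fun c d => ?_
  have h2 := C.lin_mid (hF.lift ∘ₗ TensorProduct.map C.mul C.mul) a b c d
  simp only [LinearMap.comp_apply] at h2
  rw [h2]
  refine C.sw_congr' fun a b => ?_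
  simp [C.mul_eq, hF.lift_tmul]

end

/-- support of the grading -/
def supp (g : G) : Prop := ∃ x ∈ C.grade g, x ≠ 0

theorem exists_fun {M : Type*} [AddCommGroup M] [Module k M] {x : M} (hx : x ≠ 0) :
    ∃ f : M →ₗ[k] k, f x = 1 := by
  obtain ⟨f, hf⟩ := Module.Projective.exists_dual_ne_zero k hx
  exact ⟨(f x)⁻¹ • f, by simp [hf]⟩

theorem exists_tau {g : G} (hg : C.supp g) :
    ∃ T : K →ₗ[k] K, ∀ h, ∀ y ∈ C.grade h, T y = C.φ h g • y := by
  obtain ⟨x, hx, h0⟩ := hg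
  obtain ⟨f, hf⟩ := exists_fun (k := k) h0
  refine ⟨(TensorProduct.lid k K).toLinearMap ∘ₗ TensorProduct.map f LinearMap.id ∘ₗ C.braid ∘ₗ
    (TensorProduct.mk k K K).flip x, fun h y hy => ?_⟩
  simp [C.braid_apply h g y x hy hx, hf]

theorem exists_chi {g : G} (hg : C.supp g) :
    ∃ T : K →ₗ[k] K, ∀ h, ∀ y ∈ C.grade h, T y = C.φ g h • y := by
  obtain ⟨x, hx, h0⟩ := hg
  obtain ⟨f, hf⟩ := exists_fun (k := k) h0
  refine ⟨(TensorProduct.rid k K).toLinearMap ∘ₗ TensorProduct.map LinearMap.id f ∘ₗ C.braid ∘ₗ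
    (TensorProduct.mk k K K) x, fun h y hy => ?_⟩
  simp [C.braid_apply g h x y hx hy, hf]

open Classical in
noncomputable def tau (g : G) : K →ₗ[k] K :=
  if h : C.supp g then (C.exists_tau h).choose else LinearMap.id

open Classical in
noncomputable def chi (g : G) : K →ₗ[k] K :=
  if h : C.supp g then (C.exists_chi h).choose else LinearMap.id

theorem tau_apply {g h : G} (hg : C.supp g) {y : K} (hy : y ∈ C.grade h) :
    C.tau g y = C.φ h g • y := by
  rw [tau, dif_pos hg]; exact (C.exists_tau hg).choose_spec h y hy

theorem chi_apply {g h : G} (hg : C.supp g) {y : K} (hy : y ∈ C.grade h) :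
    C.chi g y = C.φ g h • y := by
  rw [chi, dif_pos hg]; exact (C.exists_chi hg).choose_spec h y hy

theorem tau_neg {g : G} (hg : ¬ C.supp g) : C.tau g = LinearMap.id := by
  rw [tau, dif_neg hg]

theorem chi_neg {g : G} (hg : ¬ C.supp g) : C.chi g = LinearMap.id := by
  rw [chi, dif_neg hg]

theorem supp_or {g : G} {x : K} (hx : x ∈ C.grade g) : x = 0 ∨ C.supp g := by
  by_cases h : x = 0
  · exact Or.inl h
  · exact Or.inr ⟨x, hx, h⟩

theorem braid_l {g : G} {x : K} (hx : x ∈ C.grade g) (y : K) :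
    C.braid (x ⊗ₜ y) = C.chi g y ⊗ₜ x := by
  rcases C.supp_or hx with rfl | hg
  · simp
  · refine LinearMap.congr_fun (f := C.braid ∘ₗ TensorProduct.mk k K K x)
      (g := (TensorProduct.mk k K K).flip x ∘ₗ C.chi g) (C.lin_ext ?_) y
    intro h y hy
    simp [C.braid_apply g h x y hx hy, C.chi_apply hg hy, TensorProduct.smul_tmul']

theorem braid_r {g : G} {x : K} (hx : x ∈ C.grade g) (y : K) :
    C.braid (y ⊗ₜ x) = x ⊗ₜ C.tau g y := by
  rcases C.supp_or hx with rfl | hg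
  · simp
  · refine LinearMap.congr_fun (f := C.braid ∘ₗ (TensorProduct.mk k K K).flip x)
      (g := (TensorProduct.mk k K K) x ∘ₗ C.tau g) (C.lin_ext ?_) y
    intro h y hy
    simp [C.braid_apply h g y x hy hx, C.tau_apply hg hy]

section
variable {M N : Type*} [AddCommGroup M] [Module k M] [AddCommGroup N] [Module k N]

theorem swb_l {F : K → K → M} (hF : Bil k F) {g : G} {x : K} (hx : x ∈ C.grade g) (y : K) :
    C.sw (C.braid (x ⊗ₜ y)) F = F (C.chi g y) x := by
  rw [C.braid_l hx, C.sw_tmul hF]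

theorem swb_r {F : K → K → M} (hF : Bil k F) {g : G} {x : K} (hx : x ∈ C.grade g) (y : K) :
    C.sw (C.braid (y ⊗ₜ x)) F = F x (C.tau g y) := by
  rw [C.braid_r hx, C.sw_tmul hF]

theorem bil_swb {F : K → K → M} (hF : Bil k F) :
    Bil k (fun x y => C.sw (C.braid (x ⊗ₜ y)) F) := by
  constructor <;> intros <;>
    simp [C.sw_eq hF, TensorProduct.add_tmul, TensorProduct.tmul_add, ← TensorProduct.smul_tmul']

end

theorem tau_mem {g h : G} {y : K} (hy : y ∈ C.grade h) : C.tau g y ∈ C.grade h := by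
  by_cases hg : C.supp g
  · rw [C.tau_apply hg hy]; exact Submodule.smul_mem _ _ hy
  · rw [C.tau_neg hg]; exact hy

theorem chi_mem {g h : G} {y : K} (hy : y ∈ C.grade h) : C.chi g y ∈ C.grade h := by
  by_cases hg : C.supp g
  · rw [C.chi_apply hg hy]; exact Submodule.smul_mem _ _ hy
  · rw [C.chi_neg hg]; exact hy

theorem chi_tau (g : G) (y : K) : C.chi g (C.tau g y) = y := by
  by_cases hg : C.supp g
  · refine LinearMap.congr_fun (f := C.chi g ∘ₗ C.tau g) (g := LinearMap.id) (C.lin_ext ?_) y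
    intro h y hy
    simp [C.tau_apply hg hy, C.chi_apply hg hy, smul_smul, C.φ_skew]
  · simp [C.chi_neg hg, C.tau_neg hg]

theorem tau_chi (g : G) (y : K) : C.tau g (C.chi g y) = y := by
  by_cases hg : C.supp g
  · refine LinearMap.congr_fun (f := C.tau g ∘ₗ C.chi g) (g := LinearMap.id) (C.lin_ext ?_) y
    intro h y hy
    simp [C.tau_apply hg hy, C.chi_apply hg hy, smul_smul, C.φ_skew]
  · simp [C.chi_neg hg, C.tau_neg hg]

theorem mmem {g h : G} {x y : K} (hx : x ∈ C.grade g) (hy : y ∈ C.grade h) :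
    x * y ∈ C.grade (g * h) := by
  rw [← C.mul_eq]; exact C.mul_mem _ _ _ _ hx hy

theorem omem : (1 : K) ∈ C.grade 1 := by
  rw [← C.one_eq]; exact C.one_mem

theorem tau_mul (g : G) (x y : K) : C.tau g (x * y) = C.tau g x * C.tau g y := by
  by_cases hg : C.supp g
  · refine C.bil_ext (f := fun x y => C.tau g (x * y)) (f' := fun x y => C.tau g x * C.tau g y)
      ?_ ?_ ?_ x y
    · constructor <;> intros <;> simp [mul_add, add_mul, smul_mul_assoc, mul_smul_comm]
    · constructor <;> intros <;> simp [mul_add, add_mul, smul_mul_assoc, mul_smul_comm]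
    · intro a x hx b y hy
      simp only [C.tau_apply hg (C.mmem hx hy), C.tau_apply hg hx, C.tau_apply hg hy]
      simp [C.φ_mul_left, smul_smul, smul_mul_assoc, mul_smul_comm, mul_comm]
  · simp [C.tau_neg hg]

theorem φ_one_right (g : G) : C.φ g 1 = 1 := by
  have := C.φ_mul_right g 1 1
  rw [mul_one] at this
  exact (mul_eq_left₀ (C.φ_ne g 1)).1 this.symm

theorem φ_one_left (g : G) : C.φ 1 g = 1 := by
  have := C.φ_mul_left 1 1 g
  rw [mul_one] at this
  exact (mul_eq_left₀ (C.φ_ne 1 g)).1 this.symm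

theorem tau_one (g : G) : C.tau g 1 = 1 := by
  by_cases hg : C.supp g
  · rw [C.tau_apply hg C.omem, C.φ_one_left, one_smul]
  · simp [C.tau_neg hg]

theorem chi_mul (g : G) (x y : K) : C.chi g (x * y) = C.chi g x * C.chi g y := by
  conv_lhs => rw [← C.chi_tau g x, ← C.chi_tau g y]
  have := C.tau_mul g (C.chi g x) (C.chi g y)
  rw [C.tau_chi, C.tau_chi] at this
  rw [C.chi_tau, C.chi_tau, ← this, C.chi_tau]

theorem chi_one (g : G) : C.chi g 1 = 1 := by
  conv_lhs => rw [← C.tau_one g]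
  exact C.chi_tau g 1

theorem tau_S (g : G) (x : K) : C.tau g (C.antipode x) = C.antipode (C.tau g x) := by
  by_cases hg : C.supp g
  · refine LinearMap.congr_fun (f := C.tau g ∘ₗ C.antipode) (g := C.antipode ∘ₗ C.tau g)
      (C.lin_ext ?_) x
    intro h y hy
    simp [C.tau_apply hg hy, C.tau_apply hg (C.antipode_mem _ _ hy)]
  · simp [C.tau_neg hg]

theorem chi_S (g : G) (x : K) : C.chi g (C.antipode x) = C.antipode (C.chi g x) := by
  have := C.tau_S g (C.chi g x)
  rw [C.tau_chi] at this
  rw [← this, C.chi_tau]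

theorem chi_comp {g h : G} (hg : C.supp g) (hh : C.supp h) (hgh : C.supp (g * h)) (x : K) :
    C.chi (g * h) x = C.chi g (C.chi h x) := by
  refine LinearMap.congr_fun (f := C.chi (g * h)) (g := C.chi g ∘ₗ C.chi h) (C.lin_ext ?_) x
  intro l y hy
  simp [C.chi_apply hg hy, C.chi_apply hh hy, C.chi_apply hgh hy, smul_smul, C.φ_mul_left, mul_comm]

theorem chi_chi (g h : G) (x : K) : C.chi g (C.chi h x) = C.chi h (C.chi g x) := by
  by_cases hg : C.supp g
  · by_cases hh : C.supp h
    · refine LinearMap.congr_fun (f := C.chi g ∘ₗ C.chi h) (g := C.chi h ∘ₗ C.chi g) (C.lin_ext ?_) x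
      intro l y hy
      simp [C.chi_apply hg hy, C.chi_apply hh hy, smul_smul, mul_comm]
    · simp [C.chi_neg hh]
  · simp [C.chi_neg hg]

/-! ### Step 1 -/

theorem eps_tau (g : G) (x : K) : C.counit (C.tau g x) = C.counit x := by
  by_cases hg : C.supp g
  swap
  · simp [C.tau_neg hg]
  obtain ⟨y, hy, h0⟩ := hg
  have key : ∀ x : K, x * y = C.sw (C.comul x) fun a b => C.counit (C.tau g b) • (a * y) := by
    intro x
    have hB : Bil k (fun a b : K => C.counit b • a) := by
      constructor <;> intros <;> simp [add_smul, smul_smul, mul_comm]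
    have h1 := C.comul_mul' hB x y
    rw [C.cr (f := fun a => a) (LinearMap.id.isLinear)] at h1
    rw [h1]
    refine C.sw_congr' fun a b => ?_
    have hB2 : Bil k (fun c' b' : K => C.counit b' • (a * c')) := by
      constructor <;> intros <;> simp [add_smul, smul_smul, mul_comm, mul_add, mul_smul_comm]
    have h2 : ∀ c d : K, (C.sw (C.braid (b ⊗ₜ c)) fun c' b' => C.counit (b' * d) • (a * c')) =
        C.counit d • C.sw (C.braid (b ⊗ₜ c)) (fun c' b' => C.counit b' • (a * c')) := by
      intro c d
      rw [C.smul_sw]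
      refine C.sw_congr' fun c' b' => ?_
      rw [← C.mul_eq, C.counit_mul, mul_comm, mul_smul]
    simp only [h2]
    have hB3 := C.bil_swb hB2
    rw [C.cr (f := fun c => C.sw (C.braid (b ⊗ₜ c)) (fun c' b' => C.counit b' • (a * c')))
      ⟨fun c c' => hB3.ar b c c', fun r c => hB3.sr r b c⟩]
    rw [C.swb_r hB2 hy]
  have k2 : C.counit x • y = C.sw (C.comul x) fun a b => C.antipode a * (b * y) := by
    have := C.anti_l x
    have := congrArg (· * y) this
    simp only [C.sw_mul, smul_mul_assoc, one_mul, mul_assoc] at this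
    exact this.symm
  have k3 : C.counit x • y = C.counit (C.tau g x) • y := by
    rw [k2]
    conv_lhs => 
      enter [3, a, b]
      rw [key b, C.mul_sw]
    rw [← C.coassoc' (f := fun a b c => C.antipode a * (C.counit (C.tau g c) • (b * y)))]
    · have : ∀ r c : K, (C.sw (C.comul r) fun a b => C.antipode a * (C.counit (C.tau g c) • (b * y)))
          = C.counit r • (C.counit (C.tau g c) • y) := by
        intro r c
        have := congrArg (fun z => C.counit (C.tau g c) • (z * y)) (C.anti_l r)
        simp only [C.sw_mul, smul_mul_assoc, one_mul, mul_assoc, C.smul_sw] at this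
        rw [smul_comm, ← this]
        exact C.sw_congr' fun a b => by rw [mul_smul_comm]
      simp only [this]
      exact C.cl (f := fun c => C.counit (C.tau g c) • y)
        ⟨by intros; simp [add_smul], by intros; simp [mul_smul]⟩ x
    · constructor <;> intros <;> simp [add_mul, mul_add, add_smul, smul_smul, smul_mul_assoc, mul_smul_comm, mul_comm]
  exact (smul_left_injective k h0 k3).symm

theorem eps_chi (g : G) (x : K) : C.counit (C.chi g x) = C.counit x := by
  rw [← C.eps_tau g, C.tau_chi]

end RC
end CHelp


namespace CHelp

variable {k G K : Type*} [Field k] [CommGroup G] [Ring K] [Module k K]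
  [IsScalarTower k K K] [SMulCommClass k K K]

namespace RC

variable (C : RC k G K)

theorem isLin_sw {M : Type*} [AddCommGroup M] [Module k M] {t : K ⊗[k] K} {f : K → K → K → M}
    (h : ∀ a b, IsLinearMap k (f a b)) : IsLinearMap k (fun y => C.sw t fun a b => f a b y) := by
  constructor
  · intro x y; simp only [(h _ _).map_add, sw, Finset.sum_add_distrib]
  · intro r x; simp only [(h _ _).map_smul, sw, Finset.smul_sum]

theorem anti_mul_aux (x y : K) : (C.sw (C.comul x) fun a b => C.sw (C.braid (b ⊗ₜ y)) fun y' b' =>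
    C.antipode (a * y') * b') = C.counit x • C.antipode y := by
  have hB : ∀ a : K, Bil k (fun y' b' : K => C.antipode (a * y') * b') := by
    intro a
    constructor <;> intros <;> simp [mul_add, add_mul, smul_mul_assoc, mul_smul_comm]
  have hT : IsLinearMap k (fun y => C.sw (C.comul x) fun a b => C.sw (C.braid (b ⊗ₜ y))
      fun y' b' => C.antipode (a * y') * b') := by
    apply isLin_sw
    intro a b
    exact ⟨(C.bil_swb (hB a)).ar b, fun r => (C.bil_swb (hB a)).sr r b⟩
  set T : K → K := (fun y => C.sw (C.comul x) fun a b => C.sw (C.braid (b ⊗ₜ y))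
      fun y' b' => C.antipode (a * y') * b') with hTd
  change T y = _
  rw [← C.cr hT]
  have h1 : ∀ c d : K, C.counit d • T c = C.sw (C.comul d) fun p q => T c * p * C.antipode q := by
    intro c d
    have := congrArg (fun z => T c * z) (C.anti_r d)
    simp only [C.mul_sw, mul_smul_comm, mul_one] at this
    rw [← this]
    exact C.sw_congr' fun p q => by rw [mul_assoc]
  simp only [h1]
  rw [← C.coassoc' (f := fun c p q => T c * p * C.antipode q)]
  · have h2 : ∀ r q : K, (C.sw (C.comul r) fun c p => T c * p * C.antipode q) =
        C.counit r • (C.counit x • C.antipode q) := by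
      intro r q
      have hB2 : Bil k (fun a b : K => C.antipode a * b) := by
        constructor <;> intros <;> simp [mul_add, add_mul, smul_mul_assoc, mul_smul_comm]
      have := C.comul_mul' hB2 x r
      rw [C.anti_l, ← C.mul_eq, C.counit_mul, C.sw_comm] at this
      have := congrArg (fun z => z * C.antipode q) this
      simp only [smul_mul_assoc, one_mul, C.sw_mul] at this
      rw [smul_smul, mul_comm, this]
      simp only [hTd, C.sw_mul]
      refine C.sw_congr' fun c p => C.sw_congr' fun a b => C.sw_congr' fun c' b' => ?_
      simp only [mul_assoc]
    simp only [h2]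
    exact C.cl (f := fun q => C.counit x • C.antipode q)
      ⟨by intros; simp, by intros; simp [smul_smul, mul_comm]⟩ y
  · constructor <;> intros <;> 
      simp [mul_add, add_mul, smul_mul_assoc, mul_smul_comm, hT.map_add, hT.map_smul]

theorem anti_mul {c : G} {y : K} (hy : y ∈ C.grade c) (x : K) :
    C.antipode (x * y) = C.antipode y * C.antipode (C.tau c x) := by
  have hB : ∀ a : K, Bil k (fun y' b' : K => C.antipode (a * y') * b') := by
    intro a
    constructor <;> intros <;> simp [mul_add, add_mul, smul_mul_assoc, mul_smul_comm]
  have h1 : ∀ x, (C.sw (C.comul x) fun a b => C.antipode (a * y) * C.tau c b) =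
      C.counit x • C.antipode y := by
    intro x
    rw [← C.anti_mul_aux x y]
    exact C.sw_congr' fun a b => by rw [C.swb_r (hB a) hy]
  rw [← C.cr (f := fun x => C.antipode (x * y))
    ⟨by intros; simp [add_mul], by intros; simp [smul_mul_assoc]⟩ x]
  have h2 : ∀ a b : K, C.counit b • C.antipode (a * y) =
      C.sw (C.comul b) fun p q => C.antipode (a * y) * C.tau c p * C.tau c (C.antipode q) := by
    intro a b
    have := congrArg (fun z => C.antipode (a * y) * C.tau c z) (C.anti_r b)
    simp only [C.map_sw, C.mul_sw, map_smul, C.tau_one, mul_smul_comm, mul_one, C.tau_mul,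
      ← mul_assoc] at this
    exact this.symm
  simp only [h2]
  rw [← C.coassoc' (f := fun a p q => C.antipode (a * y) * C.tau c p * C.tau c (C.antipode q))]
  · simp only [← C.sw_mul, h1]
    rw [← C.tau_S]
    simp only [smul_mul_assoc]
    exact C.cl (f := fun q => C.antipode y * C.tau c (C.antipode q))
      ⟨by intros; simp [mul_add], by intros; simp [mul_smul_comm]⟩ x
  · constructor <;> intros <;> simp [mul_add, add_mul, smul_mul_assoc, mul_smul_comm]

section E3

variable {E : Type*} [Ring E] [Module k E] [IsScalarTower k E E] [SMulCommClass k E E]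

theorem bil_mul (P Q : K →ₗ[k] E) : Bil k (fun a b => P a * Q b) := by
  constructor <;> intros <;> simp [mul_add, add_mul, smul_mul_assoc, mul_smul_comm]

/-- convolution of linear maps -/
noncomputable def conv (P Q : K →ₗ[k] E) : K →ₗ[k] E := (bil_mul P Q).lift ∘ₗ C.comul

theorem conv_apply (P Q : K →ₗ[k] E) (x : K) :
    C.conv P Q x = C.sw (C.comul x) fun a b => P a * Q b := by
  rw [C.sw_eq (bil_mul P Q)]; rfl

theorem lcan {P Q R : K →ₗ[k] E} (h : C.conv P Q = R) {f : K → E} (hf : IsLinearMap k f) (x : K) :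
    (C.sw (C.comul x) fun a r => P a * C.sw (C.comul r) fun b c => Q b * f c) =
      C.sw (C.comul x) fun a b => R a * f b := by
  simp only [C.mul_sw]
  rw [← C.coassoc' (f := fun a b c => P a * (Q b * f c))]
  · refine C.sw_congr' fun a b => ?_
    rw [← h, conv_apply, C.sw_mul]
    simp only [mul_assoc]
  · constructor <;> intros <;>
      simp [mul_add, add_mul, smul_mul_assoc, mul_smul_comm, hf.map_add, hf.map_smul]

theorem rcan {P Q R : K →ₗ[k] E} (h : C.conv Q P = R) {f : K → E} (hf : IsLinearMap k f) (x : K) :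
    (C.sw (C.comul x) fun r c => (C.sw (C.comul r) fun a b => f a * Q b) * P c) =
      C.sw (C.comul x) fun a b => f a * R b := by
  simp only [C.sw_mul]
  rw [C.coassoc' (f := fun a b c => f a * Q b * P c)]
  · refine C.sw_congr' fun a b => ?_
    rw [← h, conv_apply, C.mul_sw]
    simp only [mul_assoc]
  · constructor <;> intros <;>
      simp [mul_add, add_mul, smul_mul_assoc, mul_smul_comm, hf.map_add, hf.map_smul]

/-- the unit of convolution -/
noncomputable def cone : K →ₗ[k] E := LinearMap.toSpanSingleton k E 1 ∘ₗ C.counit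

theorem cone_l {f : K → E} (hf : IsLinearMap k f) (x : K) :
    (C.sw (C.comul x) fun a b => C.cone a * f b) = f x := by
  rw [← C.cl hf]
  exact C.sw_congr' fun a b => by simp [cone, smul_mul_assoc]

theorem cone_r {f : K → E} (hf : IsLinearMap k f) (x : K) :
    (C.sw (C.comul x) fun a b => f a * C.cone b) = f x := by
  rw [← C.cr hf]
  exact C.sw_congr' fun a b => by simp [cone, mul_smul_comm]

variable {P Q : K →ₗ[k] E}

theorem conv_S_l (hP : ∀ x y, P (x * y) = P x * P y) (h1 : P 1 = 1) :
    C.conv (P ∘ₗ C.antipode) P = C.cone := by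
  ext x
  have := congrArg P (C.anti_l x)
  rw [C.map_sw] at this
  simp only [hP, map_smul, h1] at this
  simp [conv_apply, this, cone]

theorem conv_S_r (hP : ∀ x y, P (x * y) = P x * P y) (h1 : P 1 = 1) :
    C.conv P (P ∘ₗ C.antipode) = C.cone := by
  ext x
  have := congrArg P (C.anti_r x)
  rw [C.map_sw] at this
  simp only [hP, map_smul, h1] at this
  simp [conv_apply, this, cone]

theorem conv_SD (hP : ∀ x y, P (x * y) = P x * P y) (h1 : P 1 = 1) :
    C.conv (P ∘ₗ C.antipode) (C.conv P Q) = Q := by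
  ext x
  rw [conv_apply]
  simp only [C.conv_apply P Q]
  rw [C.lcan (C.conv_S_l hP h1) Q.isLinear, C.cone_l Q.isLinear]

theorem conv_DS (hQ : ∀ x y, Q (x * y) = Q x * Q y) (h1 : Q 1 = 1) :
    C.conv (C.conv P Q) (Q ∘ₗ C.antipode) = P := by
  ext x
  rw [conv_apply]
  simp only [C.conv_apply P Q]
  rw [C.rcan (C.conv_S_r hQ h1) P.isLinear, C.cone_r P.isLinear]

/-- braided commutation -/
def BC (P Q : K →ₗ[k] E) : Prop :=
  ∀ g, ∀ a ∈ C.grade g, ∀ h, ∀ b ∈ C.grade h, Q a * P b = C.φ g h • (P b * Q a)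

theorem BC.sw_eq {C : RC k G K} (h : C.BC P Q) (b c : K) :
    (C.sw (C.braid (b ⊗ₜ c)) fun c' b' => P c' * Q b') = Q b * P c := by
  refine C.bil_ext (C.bil_swb (bil_mul P Q)) (f' := fun b c => Q b * P c) (bil_mul Q P) ?_ b c
  intro g x hx l y hy
  rw [C.braid_apply _ _ _ _ hx hy, C.sw_smul_tmul (bil_mul P Q), h g x hx l y hy]

theorem BC.chi {C : RC k G K} (h : C.BC P Q) {g : G} {b : K} (hb : b ∈ C.grade g) (c : K) :
    Q b * P c = P (C.chi g c) * Q b := by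
  rw [← h.sw_eq, C.swb_l (bil_mul P Q) hb]

theorem BC.tau {C : RC k G K} (h : C.BC P Q) {g : G} {c : K} (hc : c ∈ C.grade g) (b : K) :
    Q b * P c = P c * Q (C.tau g b) := by
  rw [← h.sw_eq, C.swb_r (bil_mul P Q) hc]

theorem conv_mul (hP : ∀ x y, P (x * y) = P x * P y) (hQ : ∀ x y, Q (x * y) = Q x * Q y)
    (h : C.BC P Q) (x y : K) : C.conv P Q (x * y) = C.conv P Q x * C.conv P Q y := by
  rw [conv_apply, C.comul_mul' (bil_mul P Q), C.conv_apply P Q x, C.sw_mul]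
  refine C.sw_congr' fun a b => ?_
  rw [conv_apply, C.mul_sw]
  refine C.sw_congr' fun c d => ?_
  have := congrArg (fun z => P a * z * Q d) (h.sw_eq b c)
  simp only [C.mul_sw, C.sw_mul] at this
  rw [show P a * Q b * (P c * Q d) = P a * (Q b * P c) * Q d by simp only [mul_assoc], ← this]
  refine C.sw_congr' fun c' b' => ?_
  simp only [hP, hQ, mul_assoc]

/-- three commuting-up-to-braiding copies of `K` -/
structure Iota (C : RC k G K) (E : Type*) [Ring E] [Module k E] where
  i1 : K →ₗ[k] E
  i2 : K →ₗ[k] E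
  i3 : K →ₗ[k] E
  m1 : ∀ x y, i1 (x * y) = i1 x * i1 y
  m2 : ∀ x y, i2 (x * y) = i2 x * i2 y
  m3 : ∀ x y, i3 (x * y) = i3 x * i3 y
  u1 : i1 1 = 1
  u2 : i2 1 = 1
  u3 : i3 1 = 1
  c12 : C.BC i1 i2
  c13 : C.BC i1 i3
  c23 : C.BC i2 i3

variable {C}
variable (I : Iota C E)

theorem conv_assoc (P Q R : K →ₗ[k] E) : C.conv (C.conv P Q) R = C.conv P (C.conv Q R) := by
  ext x
  simp only [conv_apply, C.sw_mul, C.mul_sw]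
  rw [C.coassoc' (f := fun a b c => P a * Q b * R c)]
  · simp only [mul_assoc]
  · constructor <;> intros <;>
      simp [mul_add, add_mul, smul_mul_assoc, mul_smul_comm]

noncomputable def Iota.D12 : K →ₗ[k] E := C.conv I.i1 I.i2
noncomputable def Iota.D23 : K →ₗ[k] E := C.conv I.i2 I.i3
noncomputable def Iota.Gf (u v : K) : E := C.sw (C.braid (u ⊗ₜ v)) fun v' u' => I.D12 v' * I.i3 u'
noncomputable def Iota.Kf (u v : K) : E := C.sw (C.braid (u ⊗ₜ v)) fun v' u' => I.i1 v' * I.D23 u'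

theorem Iota.bG : Bil k I.Gf := C.bil_swb (bil_mul I.D12 I.i3)
theorem Iota.bK : Bil k I.Kf := C.bil_swb (bil_mul I.i1 I.D23)

theorem bil_mulr {f : K → K → E} (hf : Bil k f) (e : E) : Bil k (fun a b => f a b * e) := by
  constructor <;> intros <;> simp [hf.al, hf.ar, hf.sl, hf.sr, add_mul, smul_mul_assoc]

theorem bil_mull {f : K → K → E} (hf : Bil k f) (e : E) : Bil k (fun a b => e * f a b) := by
  constructor <;> intros <;> simp [hf.al, hf.ar, hf.sl, hf.sr, mul_add, mul_smul_comm]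

theorem Bil.linl {M : Type*} [AddCommGroup M] [Module k M] {f : K → K → M} (hf : Bil k f) (b : K) :
  IsLinearMap k (fun a => f a b) := ⟨fun a a' => hf.al a a' b, fun r a => hf.sl r a b⟩

theorem Bil.linr {M : Type*} [AddCommGroup M] [Module k M] {f : K → K → M} (hf : Bil k f) (b : K) :
  IsLinearMap k (fun a => f b a) := ⟨fun a a' => hf.ar b a a', fun r a => hf.sr r b a⟩

theorem Iota.star (x y : K) :
    (C.sw (C.comul x) fun a b => I.D12 a * C.sw (C.comul y) fun c d => I.Gf b c * I.i3 d) =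
    C.sw (C.comul x) fun a b => I.i1 a * C.sw (C.comul y) fun c d => I.Kf b c * I.D23 d := by
  have h := LinearMap.congr_fun (conv_assoc (C := C) I.i1 I.i2 I.i3) (x * y)
  change C.conv I.D12 I.i3 _ = C.conv I.i1 I.D23 _ at h
  rw [conv_apply, conv_apply, C.comul_mul' (bil_mul _ _), C.comul_mul' (bil_mul _ _)] at h
  convert h using 1
  · refine C.sw_congr' fun a b => ?_
    rw [C.mul_sw]
    refine C.sw_congr' fun c d => ?_
    rw [Iota.Gf, C.sw_mul, C.mul_sw]
    refine C.sw_congr' fun c' b' => ?_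
    rw [I.m3, D12, C.conv_mul I.m1 I.m2 I.c12]
    simp only [mul_assoc]
  · refine C.sw_congr' fun a b => ?_
    rw [C.mul_sw]
    refine C.sw_congr' fun c d => ?_
    rw [Iota.Kf, C.sw_mul, C.mul_sw]
    refine C.sw_congr' fun c' b' => ?_
    rw [I.m1, D23, C.conv_mul I.m2 I.m3 I.c23]
    simp only [mul_assoc]

theorem Iota.star2 (x y : K) :
    (C.sw (C.comul x) fun a b => I.i2 a * C.sw (C.comul y) fun c d => I.Gf b c * I.i3 d) =
    C.sw (C.comul y) fun c d => I.Kf x c * I.D23 d := by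
  rw [← C.lcan (C.conv_SD (Q := I.i2) I.m1 I.u1)
    (f := fun b => C.sw (C.comul y) fun c d => I.Gf b c * I.i3 d)]
  · have := I.star
    simp only [D12] at this
    simp only [this]
    have hl : IsLinearMap k fun c => C.sw (C.comul y) fun c_1 d => I.Kf c c_1 * I.D23 d := by
      apply isLin_sw
      intro a b
      exact Bil.linl (bil_mulr I.bK _) _
    rw [C.lcan (C.conv_S_l I.m1 I.u1) hl, C.cone_l hl]
  · apply isLin_sw
    intro a b
    exact Bil.linl (bil_mulr I.bG _) _

theorem Iota.star3 (x y : K) :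
    (C.sw (C.comul x) fun a b => I.i2 a * I.Gf b y) =
    C.sw (C.comul y) fun c d => I.Kf x c * I.i2 d := by
  have h2 : ∀ y, (C.sw (C.comul y) fun c d => (C.sw (C.comul x) fun a b => I.i2 a * I.Gf b c) * I.i3 d) =
      C.sw (C.comul y) fun c d => I.Kf x c * I.D23 d := by
    intro y
    rw [← I.star2]
    simp only [C.mul_sw, C.sw_mul]
    rw [C.sw_comm]
    simp only [mul_assoc]
  rw [← C.rcan (C.conv_DS (P := I.i2) I.m3 I.u3) (f := fun c => I.Kf x c) (Bil.linr I.bK _)]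
  simp only [D23] at h2
  simp only [← h2]
  have hl : IsLinearMap k fun c => (C.sw (C.comul x) fun a b => I.i2 a * I.Gf b c) := by
    apply isLin_sw
    intro a b
    exact Bil.linr (bil_mull I.bG _) _
  rw [C.rcan (C.conv_S_r I.m3 I.u3) hl, C.cone_r hl]

theorem Iota.star4 (x y : K) :
    (C.sw (C.comul y) fun c d => I.Gf x c * I.i2 (C.antipode d)) =
    C.sw (C.comul x) fun a b => I.i2 (C.antipode a) * I.Kf b y := by
  have h1 : ∀ y, I.Gf x y = C.sw (C.comul y) fun c d =>
      (C.sw (C.comul x) fun a b => I.i2 (C.antipode a) * I.Kf b c) * I.i2 d := by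
    intro y
    have hl : IsLinearMap k fun b => I.Gf b y := Bil.linl I.bG _
    rw [← C.cone_l hl x, ← C.lcan (C.conv_S_l I.m2 I.u2) hl]
    simp only [I.star3, C.mul_sw, C.sw_mul]
    rw [C.sw_comm]
    simp only [mul_assoc, LinearMap.comp_apply]
  simp only [h1]
  have hl : IsLinearMap k fun c => (C.sw (C.comul x) fun a b => I.i2 (C.antipode a) * I.Kf b c) := by
    apply isLin_sw
    intro a b
    exact Bil.linr (bil_mull I.bK _) _
  have := C.rcan (C.conv_S_r I.m2 I.u2) hl y
  simp only [LinearMap.comp_apply] at this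
  rw [this, C.cone_r hl]

theorem Iota.star5 {g c : G} {x y : K} (hx : x ∈ C.grade g) (hy : y ∈ C.grade c) :
    (C.sw (C.comul y) fun a d => I.D12 (C.chi g a) * I.i2 (C.chi g (C.antipode d)) * I.i3 x) =
    C.sw (C.comul x) fun a b => I.i1 y * I.i2 (C.tau c (C.antipode a)) * I.D23 (C.tau c b) := by
  have h := I.star4 x y
  convert h using 1
  · refine C.sw_congr' fun a d => ?_
    rw [Iota.Gf, C.swb_l (bil_mul _ _) hx, mul_assoc, mul_assoc, I.c23.chi hx]
  · refine C.sw_congr' fun a d => ?_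
    rw [Iota.Kf, C.swb_r (bil_mul _ _) hy, ← mul_assoc, I.c12.tau hy]

end E3

end RC
end CHelp


namespace CHelp

variable {k G K : Type*} [Field k] [CommGroup G] [Ring K] [Module k K]
  [IsScalarTower k K K] [SMulCommClass k K K]

namespace RC

variable (C : RC k G K)

section construct

variable {M : Type*} [AddCommGroup M] [Module k M]

noncomputable def jj (k K M : Type*) [Field k] [Ring K] [Module k K]
    [IsScalarTower k K K] [SMulCommClass k K K] [AddCommGroup M] [Module k M] :
    K →ₗ[k] Module.End k (K ⊗[k] M) :=
  LinearMap.rTensorHom M ∘ₗ LinearMap.mul k K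

theorem jj_apply (a v : K) (m : M) : jj k K M a (v ⊗ₜ m) = (a * v) ⊗ₜ m := by
  simp [jj]

noncomputable def ext (ρ : K →ₗ[k] Module.End k M) : K →ₗ[k] Module.End k (K ⊗[k] M) :=
  TensorProduct.curry (LinearMap.lTensor K (TensorProduct.lift ρ) ∘ₗ
    (TensorProduct.assoc k K K M).toLinearMap ∘ₗ LinearMap.rTensor M C.braid ∘ₗ
    (TensorProduct.assoc k K K M).symm.toLinearMap)

theorem ext_apply (ρ : K →ₗ[k] Module.End k M) {g h : G} {b v : K} (hb : b ∈ C.grade g)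
    (hv : v ∈ C.grade h) (m : M) : C.ext ρ b (v ⊗ₜ m) = C.φ g h • (v ⊗ₜ ρ b m) := by
  simp [ext, C.braid_apply g h b v hb hv, ← TensorProduct.smul_tmul']

theorem end_ext {f f' : Module.End k (K ⊗[k] M)}
    (h : ∀ g, ∀ v ∈ C.grade g, ∀ m, f (v ⊗ₜ m) = f' (v ⊗ₜ m)) : f = f' := by
  apply TensorProduct.ext
  refine C.lin_ext (M := M →ₗ[k] K ⊗[k] M) ?_
  intro g v hv
  ext m
  exact h g v hv m

theorem ext_mul {ρ : K →ₗ[k] Module.End k M} (hρ : ∀ x y, ρ (x * y) = ρ x * ρ y) (x y : K) :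
    C.ext ρ (x * y) = C.ext ρ x * C.ext ρ y := by
  refine C.bil_ext (f := fun x y => C.ext ρ (x * y)) (f' := fun x y => C.ext ρ x * C.ext ρ y)
    ?_ ?_ ?_ x y
  · constructor <;> intros <;> simp [mul_add, add_mul, smul_mul_assoc, mul_smul_comm]
  · constructor <;> intros <;> simp [mul_add, add_mul, smul_mul_assoc, mul_smul_comm]
  · intro g x hx h y hy
    apply C.end_ext
    intro l v hv m
    simp [C.ext_apply ρ (C.mmem hx hy) hv, C.ext_apply ρ hx hv, C.ext_apply ρ hy hv, hρ,
      smul_smul, C.φ_mul_left, mul_comm]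

theorem ext_one {ρ : K →ₗ[k] Module.End k M} (hρ : ρ 1 = 1) : C.ext ρ 1 = 1 := by
  apply C.end_ext
  intro l v hv m
  simp [C.ext_apply ρ C.omem hv, hρ, C.φ_one_left]

theorem BC_jj (ρ : K →ₗ[k] Module.End k M) : C.BC (E := Module.End k (K ⊗[k] M)) (jj k K M) (C.ext ρ) := by
  intro g a ha h b hb
  apply C.end_ext
  intro l v hv m
  simp [jj_apply, C.ext_apply ρ ha hv, C.ext_apply ρ ha (C.mmem hb hv), C.φ_mul_right, smul_smul]

theorem BC_ext {ρ σ : K →ₗ[k] Module.End k M} (h : C.BC (E := Module.End k M) ρ σ) :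
    C.BC (E := Module.End k (K ⊗[k] M)) (C.ext ρ) (C.ext σ) := by
  intro g a ha h' b hb
  apply C.end_ext
  intro l v hv m
  have := LinearMap.congr_fun (h g a ha h' b hb) m
  simp at this
  simp [C.ext_apply ρ hb hv, C.ext_apply σ ha hv, smul_smul, this, mul_comm, mul_assoc]

theorem jj_mul (x y : K) : jj k K M (x * y) = jj k K M x * jj k K M y := by
  apply TensorProduct.ext'
  intro v m
  simp [jj_apply, mul_assoc]

theorem jj_one : jj k K M 1 = 1 := by
  apply TensorProduct.ext'
  intro v m
  simp [jj_apply]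

end construct

noncomputable def iota : Iota C (Module.End k (K ⊗[k] (K ⊗[k] K))) where
  i1 := jj k K (K ⊗[k] K)
  i2 := C.ext (jj k K K)
  i3 := C.ext (C.ext (LinearMap.mul k K))
  m1 := jj_mul
  m2 := C.ext_mul jj_mul
  m3 := C.ext_mul (C.ext_mul fun x y => by ext; simp [mul_assoc])
  u1 := jj_one
  u2 := C.ext_one jj_one
  u3 := C.ext_one (C.ext_one (by ext; simp))
  c12 := C.BC_jj _
  c13 := C.BC_jj _
  c23 := C.BC_ext (C.BC_jj _)

/-- `1 ⊗ 1 ⊗ 1` -/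
noncomputable def o3 (k K : Type*) [Field k] [Ring K] [Module k K] : K ⊗[k] (K ⊗[k] K) :=
  1 ⊗ₜ (1 ⊗ₜ 1)

theorem ext_one_apply {M : Type*} [AddCommGroup M] [Module k M] (ρ : K →ₗ[k] Module.End k M)
    (b : K) (m : M) : C.ext ρ b (1 ⊗ₜ m) = 1 ⊗ₜ (ρ b m) := by
  refine LinearMap.congr_fun (f := LinearMap.applyₗ (1 ⊗ₜ m) ∘ₗ C.ext ρ)
    (g := TensorProduct.mk k K M 1 ∘ₗ LinearMap.applyₗ m ∘ₗ ρ) (C.lin_ext ?_) b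
  intro g x hx
  simp [C.ext_apply ρ hx C.omem, C.φ_one_right]

theorem iota_apply (a b c : K) :
    (C.iota.i1 a * C.iota.i2 b * C.iota.i3 c) (o3 k K) = a ⊗ₜ (b ⊗ₜ c) := by
  simp [iota, o3, ext_one_apply, jj_apply]

noncomputable def LM (u : K) : K ⊗[k] K →ₗ[k] K ⊗[k] K :=
  TensorProduct.map (LinearMap.mulLeft k u) LinearMap.id
noncomputable def RM (u : K) : K ⊗[k] K →ₗ[k] K ⊗[k] K :=
  TensorProduct.map LinearMap.id (LinearMap.mulRight k u)

theorem LM_tmul (u a b : K) : LM u (a ⊗ₜ[k] b) = (u * a) ⊗ₜ b := by simp [LM]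
theorem RM_tmul (u a b : K) : RM u (a ⊗ₜ[k] b) = a ⊗ₜ (b * u) := by simp [RM]

theorem LM_mul (u v : K) (t : K ⊗[k] K) : LM (u * v) t = LM u (LM v t) := by
  refine LinearMap.congr_fun (f := LM (u * v)) (g := LM u ∘ₗ LM v) (TensorProduct.ext' ?_) t
  intro a b; simp [LM_tmul, mul_assoc]
theorem RM_mul (u v : K) (t : K ⊗[k] K) : RM (u * v) t = RM v (RM u t) := by
  refine LinearMap.congr_fun (f := RM (u * v)) (g := RM v ∘ₗ RM u) (TensorProduct.ext' ?_) t
  intro a b; simp [RM_tmul, mul_assoc]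
theorem LM_add (u v : K) (t : K ⊗[k] K) : LM (u + v) t = LM u t + LM v t := by
  refine LinearMap.congr_fun (f := LM (u + v)) (g := LM u + LM v) (TensorProduct.ext' ?_) t
  intro a b; simp [LM_tmul, add_mul, TensorProduct.add_tmul]
theorem RM_add (u v : K) (t : K ⊗[k] K) : RM (u + v) t = RM u t + RM v t := by
  refine LinearMap.congr_fun (f := RM (u + v)) (g := RM u + RM v) (TensorProduct.ext' ?_) t
  intro a b; simp [RM_tmul, mul_add, TensorProduct.tmul_add]
theorem LM_smul (r : k) (u : K) (t : K ⊗[k] K) : LM (r • u) t = r • LM u t := by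
  refine LinearMap.congr_fun (f := LM (r • u)) (g := r • LM u) (TensorProduct.ext' ?_) t
  intro a b; simp [LM_tmul, smul_mul_assoc, TensorProduct.smul_tmul']
theorem RM_smul (r : k) (u : K) (t : K ⊗[k] K) : RM (r • u) t = r • RM u t := by
  refine LinearMap.congr_fun (f := RM (r • u)) (g := r • RM u) (TensorProduct.ext' ?_) t
  intro a b; simp [RM_tmul, mul_smul_comm]
theorem LM_one (t : K ⊗[k] K) : LM 1 t = t := by
  refine LinearMap.congr_fun (f := LM (1 : K)) (g := LinearMap.id) (TensorProduct.ext' ?_) t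
  intro a b; simp [LM_tmul]
theorem RM_one (t : K ⊗[k] K) : RM 1 t = t := by
  refine LinearMap.congr_fun (f := RM (1 : K)) (g := LinearMap.id) (TensorProduct.ext' ?_) t
  intro a b; simp [RM_tmul]

noncomputable def W (c : G) (x : K) : K ⊗[k] K :=
  C.sw (C.comul x) fun a b => LM (C.tau c (C.antipode a)) (C.comul (C.tau c b))

noncomputable def Wt (g : G) (y : K) : K ⊗[k] K :=
  C.sw (C.comul y) fun a d => RM (C.chi g (C.antipode d)) (C.comul (C.chi g a))

theorem app_sw {V : Type*} [AddCommGroup V] [Module k V] (v : V) (t : K ⊗[k] K)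
    (f : K → K → Module.End k V) : (C.sw t f) v = C.sw t fun a b => f a b v := by
  unfold sw
  exact LinearMap.sum_apply _ _ _

theorem E3 {g c : G} {x y : K} (hx : x ∈ C.grade g) (hy : y ∈ C.grade c) :
    TensorProduct.assoc k K K K (C.Wt g y ⊗ₜ x) = y ⊗ₜ C.W c x := by
  have h := LinearMap.congr_fun (C.iota.star5 hx hy) (o3 k K)
  rw [C.app_sw, C.app_sw] at h
  have h1 := C.map_sw (M := K ⊗[k] K) (N := K ⊗[k] (K ⊗[k] K))
    ((TensorProduct.assoc k K K K).toLinearMap ∘ₗ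
    (TensorProduct.mk k (K ⊗[k] K) K).flip x) (C.comul y)
    fun a d => RM (C.chi g (C.antipode d)) (C.comul (C.chi g a))
  have h2 := C.map_sw (M := K ⊗[k] K) (N := K ⊗[k] (K ⊗[k] K))
    (TensorProduct.mk k K (K ⊗[k] K) y) (C.comul x)
    fun a b => LM (C.tau c (C.antipode a)) (C.comul (C.tau c b))
  refine Eq.trans h1 (Eq.trans ?_ (Eq.trans h (Eq.trans ?_ h2.symm)))
  · refine C.sw_congr' fun a d => ?_
    rw [Iota.D12, conv_apply]
    simp only [C.sw_mul]
    have h3 := C.map_sw (M := K ⊗[k] K) (N := K ⊗[k] (K ⊗[k] K))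
      ((TensorProduct.assoc k K K K).toLinearMap ∘ₗ
      (TensorProduct.mk k (K ⊗[k] K) K).flip x ∘ₗ RM (C.chi g (C.antipode d)))
      (C.comul (C.chi g a)) fun a d => a ⊗ₜ d
    rw [C.sw_tensor] at h3
    refine h3.trans ?_
    have h4 := C.app_sw (o3 k K) (C.comul (C.chi g a))
      fun p q => C.iota.i1 p * C.iota.i2 q * C.iota.i2 (C.chi g (C.antipode d)) * C.iota.i3 x
    refine Eq.trans ?_ h4.symm
    refine C.sw_congr' fun p q => ?_
    rw [mul_assoc (C.iota.i1 p), ← C.iota.m2, iota_apply]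
    simp [RM_tmul]
  · refine C.sw_congr' fun a b => ?_
    rw [Iota.D23, conv_apply]
    simp only [C.mul_sw]
    have h3 := C.map_sw (M := K ⊗[k] K) (N := K ⊗[k] (K ⊗[k] K))
      (TensorProduct.mk k K (K ⊗[k] K) y ∘ₗ LM (C.tau c (C.antipode a)))
      (C.comul (C.tau c b)) fun a d => a ⊗ₜ d
    rw [C.sw_tensor] at h3
    refine Eq.trans ?_ h3.symm
    have h4 := C.app_sw (o3 k K) (C.comul (C.tau c b))
      fun p q => C.iota.i1 y * C.iota.i2 (C.tau c (C.antipode a)) * (C.iota.i2 p * C.iota.i3 q)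
    refine h4.trans ?_
    refine C.sw_congr' fun p q => ?_
    rw [← mul_assoc, mul_assoc (C.iota.i1 y), ← C.iota.m2, iota_apply]
    simp [LM_tmul]

theorem exists_w {c g : G} (hc : C.supp c) (hg : C.supp g) :
    ∃ w : K, (∀ x ∈ C.grade g, C.W c x = w ⊗ₜ x) ∧ (∀ y ∈ C.grade c, C.Wt g y = y ⊗ₜ w) := by
  obtain ⟨y0, hy0, hy⟩ := hc
  obtain ⟨x0, hx0, hx⟩ := hg
  obtain ⟨f, hf⟩ := exists_fun (k := k) hy
  obtain ⟨f', hf'⟩ := exists_fun (k := k) hx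
  have h1 : ∀ x ∈ C.grade g, C.W c x =
      ((TensorProduct.lid k K) (TensorProduct.map f LinearMap.id (C.Wt g y0))) ⊗ₜ x := by
    intro x hx
    have := congrArg (fun z => TensorProduct.lid k (K ⊗[k] K)
      (TensorProduct.map f LinearMap.id z)) (C.E3 hx hy0)
    simp only [TensorProduct.map_tmul, TensorProduct.lid_tmul, hf, one_smul, LinearMap.id_apply] at this
    rw [← this]
    refine LinearMap.congr_fun (f := ((TensorProduct.lid k (K ⊗[k] K)).toLinearMap ∘ₗ
      TensorProduct.map f LinearMap.id) ∘ₗ (TensorProduct.assoc k K K K).toLinearMap ∘ₗ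
      (TensorProduct.mk k (K ⊗[k] K) K).flip x) (g := (TensorProduct.mk k K K).flip x ∘ₗ
      (TensorProduct.lid k K).toLinearMap ∘ₗ TensorProduct.map f LinearMap.id)
      (TensorProduct.ext' ?_) (C.Wt g y0)
    intro a b
    simp [TensorProduct.smul_tmul']
  refine ⟨_, h1, ?_⟩
  intro y hy
  have h2 := C.E3 hx0 hy
  rw [h1 x0 hx0] at h2
  have h3 := (TensorProduct.assoc k K K K).injective
    (h2.trans (TensorProduct.assoc_tmul y _ x0).symm)
  have := congrArg (fun z => TensorProduct.rid k (K ⊗[k] K)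
      (TensorProduct.map LinearMap.id f' z)) h3
  simpa [hf'] using this

open Classical in
noncomputable def w (c g : G) : K :=
  if h : C.supp c ∧ C.supp g then (C.exists_w h.1 h.2).choose else 0

theorem W_eq {c g : G} (hc : C.supp c) {x : K} (hx : x ∈ C.grade g) :
    C.W c x = C.w c g ⊗ₜ x := by
  rcases C.supp_or hx with rfl | hg
  · have : C.W c 0 = 0 := by
      unfold W
      have hB : Bil k (fun a b => LM (k := k) (C.tau c (C.antipode a)) (C.comul (C.tau c b))) := by
        constructor <;> intros <;> simp [LM_add, LM_smul]
      rw [C.sw_eq hB]; simp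
    simp [this]
  rw [w, dif_pos ⟨hc, hg⟩]
  exact (C.exists_w hc hg).choose_spec.1 x hx

theorem Wt_eq {c g : G} (hg : C.supp g) {y : K} (hc : C.supp c) (hy : y ∈ C.grade c) :
    C.Wt g y = y ⊗ₜ C.w c g := by
  rw [w, dif_pos ⟨hc, hg⟩]
  exact (C.exists_w hc hg).choose_spec.2 y hy

end RC
end CHelp


namespace CHelp

variable {k G K : Type*} [Field k] [CommGroup G] [Ring K] [Module k K]
  [IsScalarTower k K K] [SMulCommClass k K K]

namespace RC

variable (C : RC k G K)

theorem factA {c g : G} (hc : C.supp c) {x : K} (hx : x ∈ C.grade g) :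
    C.w c g * C.antipode x = C.φ g c • C.antipode x := by
  rw [← C.tau_apply hc (C.antipode_mem _ _ hx)]
  have hB : Bil k (fun a b : K => a * C.antipode b) := by
    constructor <;> intros <;> simp [mul_add, add_mul, smul_mul_assoc, mul_smul_comm]
  have h1 := C.sw_tmul hB (C.w c g) x
  rw [← C.W_eq hc hx, W, C.sw_sw hB] at h1
  rw [← h1, ← C.cr (f := fun a => C.tau c (C.antipode a)) ⟨by intros; simp, by intros; simp⟩ x]
  refine C.sw_congr' fun a b => ?_
  rw [LM, C.sw_map hB]
  simp only [LinearMap.mulLeft_apply, LinearMap.id_apply, mul_assoc]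
  rw [← C.mul_sw, C.anti_r, C.eps_tau, mul_smul_comm, mul_one]

theorem lin_Wt (g : G) : IsLinearMap k (C.Wt g) := by
  have hB : Bil k (fun a d => RM (k := k) (C.chi g (C.antipode d)) (C.comul (C.chi g a))) := by
    constructor <;> intros <;> simp [RM_add, RM_smul]
  constructor
  · intro x y; unfold Wt; simp only [C.sw_eq hB]; simp
  · intro x y; unfold Wt; simp only [C.sw_eq hB]; simp

theorem bPsi (g : G) : Bil k (fun u v => RM (C.chi g v) (C.Wt g u)) := by
  have := C.lin_Wt g
  constructor <;> intros <;> simp [RM_add, RM_smul, this.map_add, this.map_smul]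

noncomputable def Psi (g : G) : K ⊗[k] K →ₗ[k] K ⊗[k] K := (C.bPsi g).lift

theorem Psi_tmul (g : G) (u v : K) : C.Psi g (u ⊗ₜ v) = RM (C.chi g v) (C.Wt g u) :=
  (C.bPsi g).lift_tmul u v

theorem Psi_RM (g : G) (s : K) (t : K ⊗[k] K) : C.Psi g (RM s t) = RM (C.chi g s) (C.Psi g t) := by
  refine LinearMap.congr_fun (f := C.Psi g ∘ₗ RM s) (g := RM (C.chi g s) ∘ₗ C.Psi g)
    (TensorProduct.ext' ?_) t
  intro a b
  simp [RM_tmul, Psi_tmul, C.chi_mul, RM_mul]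

theorem Psi_comul (g : G) (z : K) : C.Psi g (C.comul z) = C.comul (C.chi g z) := by
  rw [Psi, ← C.sw_eq (C.bPsi g)]
  simp only [Wt]
  have h1 : ∀ u v : K, RM (C.chi g v) (C.sw (C.comul u) fun a d =>
      RM (C.chi g (C.antipode d)) (C.comul (C.chi g a))) = C.sw (C.comul u) fun a d =>
      RM (C.chi g (C.antipode d * v)) (C.comul (C.chi g a)) := by
    intro u v
    rw [C.map_sw (M := K ⊗[k] K) (N := K ⊗[k] K)]
    simp only [C.chi_mul, RM_mul]
  simp only [h1]
  rw [C.coassoc' (f := fun a d v => RM (k := k) (C.chi g (C.antipode d * v)) (C.comul (C.chi g a)))]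
  · rw [← C.cr (f := fun a => C.comul (C.chi g a)) ⟨by intros; simp, by intros; simp⟩ z]
    refine C.sw_congr' fun a b => ?_
    have h2 : IsLinearMap k fun s => RM (k := k) (C.chi g s) (C.comul (C.chi g a)) :=
      ⟨by intros; simp [RM_add], by intros; simp [RM_smul]⟩
    have h3 := C.map_sw (h2.mk' _) (C.comul b) fun d v => C.antipode d * v
    simp only [IsLinearMap.mk'_apply] at h3
    rw [← h3, C.anti_l]
    simp [RM_smul, C.chi_one, RM_one]
  · constructor <;> intros <;> simp [mul_add, add_mul, smul_mul_assoc, mul_smul_comm, RM_add, RM_smul]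

theorem w_mul {c g h : G} (hc : C.supp c) (hg : C.supp g) (hh : C.supp h) (hgh : C.supp (g * h)) :
    C.w c (g * h) = C.w c g * C.chi g (C.w c h) := by
  obtain ⟨y, hy, h0⟩ := id hc
  obtain ⟨f, hf⟩ := exists_fun (k := k) h0
  have h1 : C.Wt (g * h) y = C.Psi g (C.Wt h y) := by
    unfold Wt
    rw [C.map_sw (M := K ⊗[k] K) (N := K ⊗[k] K)]
    refine C.sw_congr' fun a d => ?_
    rw [C.Psi_RM, C.Psi_comul, C.chi_comp hg hh hgh, C.chi_comp hg hh hgh]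
  rw [C.Wt_eq hgh hc hy, C.Wt_eq hh hc hy, C.Psi_tmul, C.Wt_eq hg hc hy, RM_tmul] at h1
  have := congrArg (fun z => TensorProduct.lid k K (TensorProduct.map f LinearMap.id z)) h1
  simpa [hf] using this

theorem factA2 {c g h : G} (hc : C.supp c) {x a : K} (hx : x ∈ C.grade g) (ha : a ∈ C.grade h) :
    C.w c g * (C.antipode a * C.antipode x) = C.φ g c • (C.antipode a * C.antipode x) := by
  rcases C.supp_or hx with rfl | hg
  · simp
  rcases C.supp_or ha with rfl | hh
  · simp
  have h1 : C.antipode (x * a) = C.φ g h • (C.antipode a * C.antipode x) := by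
    rw [C.anti_mul ha, C.tau_apply hh hx, map_smul, mul_smul_comm]
  rcases C.supp_or (C.mmem hx ha) with h0 | hgh
  · rw [h0, map_zero] at h1
    have := (smul_eq_zero.1 h1.symm).resolve_left (C.φ_ne g h)
    simp [this]
  have h2 := C.factA hc (C.mmem hx ha)
  rw [h1, C.w_mul hc hg hh hgh, mul_smul_comm, smul_comm (C.φ (g * h) c)] at h2
  have h3 := smul_right_injective K (C.φ_ne g h) h2
  have h4 : C.chi g (C.w c h) * C.antipode a = C.φ h c • C.antipode a := by
    have := congrArg (C.chi g) (C.factA hc ha)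
    rw [C.chi_mul, map_smul, C.chi_apply hg (C.antipode_mem _ _ ha), mul_smul_comm,
      smul_comm (C.φ h c)] at this
    exact smul_right_injective K (C.φ_ne g h) this
  rw [mul_assoc, ← mul_assoc (C.chi g _), h4, smul_mul_assoc, mul_smul_comm, C.φ_mul_left,
    mul_comm (C.φ g c), mul_smul] at h3
  exact smul_right_injective K (C.φ_ne h c) h3

theorem comul_tau (c : G) (x : K) :
    C.comul (C.tau c x) = C.sw (C.comul x) fun a b => LM (C.tau c a) (C.W c b) := by
  simp only [W]
  have h1 : ∀ u v : K, LM (C.tau c v) (C.sw (C.comul u) fun a b =>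
      LM (C.tau c (C.antipode a)) (C.comul (C.tau c b))) = C.sw (C.comul u) fun a b =>
      LM (C.tau c (v * C.antipode a)) (C.comul (C.tau c b)) := by
    intro u v
    rw [C.map_sw (M := K ⊗[k] K) (N := K ⊗[k] K)]
    simp only [C.tau_mul, LM_mul]
  simp only [h1]
  rw [← C.coassoc' (f := fun v a b => LM (k := k) (C.tau c (v * C.antipode a)) (C.comul (C.tau c b)))]
  · rw [← C.cl (f := fun a => C.comul (C.tau c a)) ⟨by intros; simp, by intros; simp⟩ x]
    refine C.sw_congr' fun a b => ?_
    have h2 : IsLinearMap k fun s => LM (k := k) (C.tau c s) (C.comul (C.tau c b)) :=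
      ⟨by intros; simp [LM_add], by intros; simp [LM_smul]⟩
    have h3 := C.map_sw (h2.mk' _) (C.comul a) fun d v => d * C.antipode v
    simp only [IsLinearMap.mk'_apply] at h3
    rw [← h3, C.anti_r]
    simp [LM_smul, C.tau_one, LM_one]
  · constructor <;> intros <;> simp [mul_add, add_mul, smul_mul_assoc, mul_smul_comm, LM_add, LM_smul]

/-- Claim C -/
theorem claimC {g h : G} (hg : C.supp g) {a : K} (ha : a ∈ C.grade h) (y : K) :
    (C.sw (C.comul (C.chi g y)) fun p q => C.chi h p * C.antipode a * C.antipode q) =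
    C.sw (C.comul y) fun p q => C.chi h (C.chi g p) * C.antipode a * C.chi g (C.antipode q) := by
  rcases C.supp_or ha with rfl | hh
  · simp [sw]
  obtain ⟨Z, rfl⟩ : ∃ Z, y = C.tau g Z := ⟨C.chi g y, (C.tau_chi g y).symm⟩
  rw [C.chi_tau]
  have hB : Bil k (fun p q => C.chi h (C.chi g p) * C.antipode a * C.chi g (C.antipode q)) := by
    constructor <;> intros <;> simp [mul_add, add_mul, smul_mul_assoc, mul_smul_comm]
  rw [C.comul_tau, C.sw_sw hB]
  refine C.sw_congr fun l' p hp l q hq => ?_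
  rw [C.W_eq hg hq, LM_tmul, C.sw_tmul hB]
  rw [C.chi_mul, C.chi_mul, C.chi_tau, C.chi_apply hg (C.antipode_mem _ _ hq)]
  have h1 := congrArg (fun z => C.chi h (C.chi g z)) (C.factA2 hg hq ha)
  have hm := C.mmem (C.antipode_mem _ _ ha) (C.antipode_mem _ _ hq)
  simp only [C.chi_mul g (C.w _ _), C.chi_mul h (C.chi g (C.w _ _)), map_smul,
    C.chi_apply hg hm, C.chi_apply hh hm, mul_smul_comm] at h1
  rw [smul_comm (C.φ l g), smul_comm (C.φ l g)] at h1
  have h2 := smul_right_injective K (C.φ_ne _ _) (smul_right_injective K (C.φ_ne _ _) h1)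
  rw [mul_smul_comm, mul_assoc, mul_assoc, mul_assoc, h2, mul_smul_comm, smul_smul, C.φ_skew, one_smul]

end RC
end CHelp


namespace CHelp

variable {k G K : Type*} [Field k] [CommGroup G] [Ring K] [Module k K]
  [IsScalarTower k K K] [SMulCommClass k K K]

namespace RC

variable (C : RC k G K)

theorem bMS : Bil k (fun a b : K => a * C.antipode b) := by
  constructor <;> intros <;> simp [mul_add, add_mul, smul_mul_assoc, mul_smul_comm]

theorem bM : Bil k (fun a b : K => a * b) := by
  constructor <;> intros <;> simp [mul_add, add_mul, smul_mul_assoc, mul_smul_comm]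

theorem mul_eq_sw (t : K ⊗[k] K) : C.mul t = C.sw t fun a b => a * b := by
  conv_lhs => rw [← C.sw_tensor t, C.map_sw]
  simp only [C.mul_eq]

theorem adj_eq (u z : K) : C.adj (u ⊗ₜ z) = C.sw (C.comul u) fun a b =>
    a * C.sw (C.braid (b ⊗ₜ z)) fun z' b' => z' * C.antipode b' := by
  have h := C.map_sw (M := K ⊗[k] K) (C.mul ∘ₗ
    (TensorProduct.map LinearMap.id
      (C.mul ∘ₗ (TensorProduct.map LinearMap.id C.antipode) ∘ₗ C.braid)) ∘ₗ
    (TensorProduct.assoc k K K K).toLinearMap ∘ₗ (TensorProduct.mk k (K ⊗[k] K) K).flip z)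
    (C.comul u) fun a b => a ⊗ₜ b
  rw [C.sw_tensor] at h
  refine h.trans (C.sw_congr' fun a b => ?_)
  simp only [LinearMap.comp_apply, LinearMap.flip_apply, TensorProduct.mk_apply,
    LinearEquiv.coe_coe, TensorProduct.assoc_tmul, TensorProduct.map_tmul, LinearMap.id_apply,
    C.mul_eq]
  rw [C.mul_eq_sw, C.sw_map bM]
  rfl

theorem comm_eq (u z : K) : C.commMap (u ⊗ₜ z) = C.sw (C.comul z) fun p q =>
    C.adj (u ⊗ₜ p) * C.antipode q := by
  have h := C.map_sw (M := K ⊗[k] K) (C.mul ∘ₗ (TensorProduct.map C.adj C.antipode) ∘ₗ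
    (TensorProduct.assoc k K K K).symm.toLinearMap ∘ₗ (TensorProduct.mk k K (K ⊗[k] K)) u)
    (C.comul z) fun a b => a ⊗ₜ b
  rw [C.sw_tensor] at h
  refine h.trans (C.sw_congr' fun a b => ?_)
  simp [C.mul_eq]

theorem comul2_eq {M : Type*} [AddCommGroup M] [Module k M]
    (L : (K ⊗[k] K) ⊗[k] (K ⊗[k] K) →ₗ[k] M) (x y : K) :
    L (C.comul2 (x ⊗ₜ y)) = C.sw (C.comul x) fun a b => C.sw (C.comul y) fun c d =>
      C.sw (C.braid (b ⊗ₜ c)) fun c' b' => L ((a ⊗ₜ c') ⊗ₜ (b' ⊗ₜ d)) := by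
  have h := C.lin2 (L ∘ₗ midMap k C.braid) (C.comul x) (C.comul y)
  simp only [LinearMap.comp_apply, C.lin_mid L] at h
  exact h

/-- the braided opposite multiplication -/
noncomputable def mop (x y : K) : K := C.mul (C.braid (x ⊗ₜ y))

theorem mop_l {g : G} {x : K} (hx : x ∈ C.grade g) (y : K) : C.mop x y = C.chi g y * x := by
  rw [mop, C.braid_l hx, C.mul_eq]

theorem bmop : Bil k C.mop := by
  constructor <;> intros <;>
    simp [mop, TensorProduct.add_tmul, TensorProduct.tmul_add, ← TensorProduct.smul_tmul']

theorem adj_l (u z : K) : C.adj (u ⊗ₜ z) = C.sw (C.comul u) fun a b =>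
    C.sw (C.braid (b ⊗ₜ z)) fun z' b' => a * z' * C.antipode b' := by
  rw [adj_eq]
  simp only [C.mul_sw, mul_assoc]

theorem bMS' (a : K) : Bil k (fun z' b' : K => a * z' * C.antipode b') := by
  constructor <;> intros <;> simp [mul_add, add_mul, smul_mul_assoc, mul_smul_comm]

theorem comm_key {g : G} (hg : C.supp g) (a y : K) :
    (C.sw (C.comul y) fun c d => C.commMap (a ⊗ₜ C.chi g c) * C.chi g d) =
      C.adj (a ⊗ₜ C.chi g y) := by
  have h1 : ∀ c : K, C.commMap (a ⊗ₜ C.chi g c) = C.sw (C.comul a) fun a1 a2 =>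
      C.sw (C.comul c) fun p q => C.sw (C.braid (a2 ⊗ₜ C.chi g p)) fun z' b' =>
        a1 * z' * C.antipode b' * C.chi g (C.antipode q) := by
    intro c
    rw [C.comm_eq]
    simp only [C.adj_l, C.sw_mul]
    rw [C.sw_comm]
    refine C.sw_congr fun l' a1 h1 l a2 h2 => ?_
    have hB : ∀ q : K, Bil k (fun z' b' : K => a1 * z' * C.antipode b' * q) :=
      fun q => bil_mulr (C.bMS' a1) q
    have e1 := congrArg (fun z => a1 * z) (C.claimC hg h2 c)
    simp only [C.mul_sw] at e1
    refine Eq.trans (C.sw_congr' fun p q => ?_) (e1.trans (C.sw_congr' fun p q => ?_))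
    · rw [C.swb_l (hB _) h2]; simp only [mul_assoc]
    · rw [C.swb_l (hB _) h2]; simp only [mul_assoc]
  simp only [h1, C.sw_mul]
  rw [C.sw_comm, C.adj_l]
  refine C.sw_congr fun l' a1 h1 l a2 h2 => ?_
  have hB : ∀ q : K, Bil k (fun z' b' : K => a1 * z' * C.antipode b' * q) :=
      fun q => bil_mulr (C.bMS' a1) q
  have hB' : ∀ q r : K, Bil k (fun z' b' : K => a1 * z' * C.antipode b' * q * r) :=
      fun q r => bil_mulr (hB q) r
  rw [C.swb_l (C.bMS' a1) h2]
  simp only [C.swb_l (hB' _ _) h2]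
  rw [C.coassoc' (f := fun p q d => a1 * C.chi l (C.chi g p) * C.antipode a2 *
    C.chi g (C.antipode q) * C.chi g d)]
  · have h3 : ∀ p r : K, (C.sw (C.comul r) fun q d => a1 * C.chi l (C.chi g p) * C.antipode a2 *
        C.chi g (C.antipode q) * C.chi g d) =
        C.counit r • (a1 * C.chi l (C.chi g p) * C.antipode a2) := by
      intro p r
      have := congrArg (fun z => a1 * C.chi l (C.chi g p) * C.antipode a2 * C.chi g z) (C.anti_l r)
      simp only [C.map_sw, C.mul_sw, map_smul, C.chi_one, mul_smul_comm, mul_one, C.chi_mul] at this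
      rw [← this]
      simp only [mul_assoc]
    simp only [h3]
    exact C.cr (f := fun p => a1 * C.chi l (C.chi g p) * C.antipode a2)
      ⟨by intros; simp [mul_add, add_mul], by intros; simp [mul_smul_comm, smul_mul_assoc]⟩ y
  · constructor <;> intros <;> simp [mul_add, add_mul, smul_mul_assoc, mul_smul_comm]

theorem main1 {h : G} (x : K) {y : K} (hy : y ∈ C.grade h) :
    (C.sw (C.comul x) fun a b => C.sw (C.comul y) fun c d =>
      C.sw (C.braid (b ⊗ₜ c)) fun c' b' => C.commMap (a ⊗ₜ c') * C.mop b' d) = x * y := by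
  have h1 : (C.sw (C.comul x) fun a b => C.sw (C.comul y) fun c d =>
      C.sw (C.braid (b ⊗ₜ c)) fun c' b' => C.commMap (a ⊗ₜ c') * C.mop b' d) =
      C.sw (C.comul x) fun a b => C.adj (a ⊗ₜ y) * C.tau h b := by
    refine C.sw_congr fun l a _ g b hb => ?_
    have hB : ∀ d : K, Bil k (fun c' b' => C.commMap (a ⊗ₜ c') * C.mop b' d) := by
      intro d
      have := C.bmop
      constructor <;> intros <;> simp [mul_add, add_mul, smul_mul_assoc, mul_smul_comm,
        this.al, this.sl, TensorProduct.tmul_add]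
    have hB2 : Bil k (fun y' b' => C.adj (a ⊗ₜ y') * b') := by
      constructor <;> intros <;> simp [mul_add, add_mul, smul_mul_assoc, mul_smul_comm,
        TensorProduct.tmul_add]
    rw [← C.swb_r hB2 hy, C.swb_l hB2 hb]
    simp only [C.swb_l (hB _) hb]
    rcases C.supp_or hb with rfl | hg
    · have := fun d => (Bil.linl C.bmop d).map_zero
      simp [sw, this]
    · rw [← C.comm_key hg, C.sw_mul]
      simp only [C.mop_l hb, mul_assoc]
  rw [h1]
  simp only [C.adj_l]
  have h2 : ∀ a b : K, (C.sw (C.comul a) fun p q => C.sw (C.braid (q ⊗ₜ y)) fun z' b' =>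
      p * z' * C.antipode b') * C.tau h b = C.sw (C.comul a) fun p q =>
      p * y * C.tau h (C.antipode q) * C.tau h b := by
    intro a b
    rw [C.sw_mul]
    refine C.sw_congr' fun p q => ?_
    rw [C.swb_r (C.bMS' p) hy, C.tau_S]
  simp only [h2]
  rw [C.coassoc' (f := fun p q b => p * y * C.tau h (C.antipode q) * C.tau h b)]
  · have h3 : ∀ p r : K, (C.sw (C.comul r) fun q b => p * y * C.tau h (C.antipode q) * C.tau h b) =
        C.counit r • (p * y) := by
      intro p r
      have := congrArg (fun z => p * y * C.tau h z) (C.anti_l r)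
      simp only [C.map_sw, C.mul_sw, map_smul, C.tau_one, mul_smul_comm, mul_one, C.tau_mul] at this
      rw [← this]
      simp only [mul_assoc]
    simp only [h3]
    exact C.cr (f := fun p => p * y)
      ⟨by intros; simp [mul_add, add_mul], by intros; simp [mul_smul_comm, smul_mul_assoc]⟩ x
  · constructor <;> intros <;> simp [mul_add, add_mul, smul_mul_assoc, mul_smul_comm]

theorem main2 (x y : K) :
    (C.sw (C.comul x) fun a b => C.sw (C.comul y) fun c d =>
      C.sw (C.braid (b ⊗ₜ c)) fun c' b' => (C.counit a * C.counit c') • C.mop b' d) =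
      C.mop x y := by
  have hm := C.bmop
  have h1 : (C.sw (C.comul x) fun a b => C.sw (C.comul y) fun c d =>
      C.sw (C.braid (b ⊗ₜ c)) fun c' b' => (C.counit a * C.counit c') • C.mop b' d) =
      C.sw (C.comul x) fun a b => C.counit a • C.mop b y := by
    refine C.sw_congr fun l a _ g b hb => ?_
    have hB : ∀ d : K, Bil k (fun c' b' => (C.counit a * C.counit c') • C.mop b' d) := by
      intro d
      constructor <;> intros <;> simp [mul_add, add_smul, smul_smul, mul_comm, mul_left_comm,
        hm.al, hm.sl]
    simp only [C.swb_l (hB _) hb]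
    simp only [C.eps_chi, mul_smul]
    rw [← C.smul_sw, C.cl (Bil.linr hm b)]
  rw [h1, C.cl (Bil.linl hm y)]

theorem eps_mul (x y : K) : C.counit (x * y) = C.counit x * C.counit y := by
  rw [← C.mul_eq, C.counit_mul]

theorem eps_S (x : K) : C.counit (C.antipode x) = C.counit x := by
  have := congrArg C.counit (C.anti_l x)
  rw [C.map_sw] at this
  simp only [eps_mul, map_smul, smul_eq_mul] at this
  rw [← C.one_eq, C.counit_one, mul_one] at this
  rw [← this, ← C.cr (f := fun a => C.counit (C.antipode a)) ⟨by intros; simp, by intros; simp⟩ x]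
  exact C.sw_congr' fun a b => by simp [mul_comm]

theorem eps_adj (u z : K) : C.counit (C.adj (u ⊗ₜ z)) = C.counit u * C.counit z := by
  rw [C.adj_l, C.map_sw, ← C.cl (f := fun u => C.counit u * C.counit z)
    ⟨by intros; simp [add_mul], by intros; simp [mul_assoc]⟩ u]
  refine C.sw_congr fun l a _ g b hb => ?_
  rw [C.swb_l (C.bMS' a) hb]
  simp [eps_mul, eps_S, eps_chi, mul_comm, mul_left_comm]

theorem eps_comm (u z : K) : C.counit (C.commMap (u ⊗ₜ z)) = C.counit u * C.counit z := by
  rw [C.comm_eq, C.map_sw, ← C.cr (f := fun z => C.counit u * C.counit z)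
    ⟨by intros; simp [mul_add], by intros; simp [mul_left_comm]⟩ z]
  refine C.sw_congr' fun a b => ?_
  simp [eps_mul, eps_S, eps_adj, mul_comm]

/-- the linear map of the statement, before `comul2` -/
noncomputable def LL : (K ⊗[k] K) ⊗[k] (K ⊗[k] K) →ₗ[k] K :=
  C.mul ∘ₗ (TensorProduct.map
    (C.commMap - (LinearMap.toSpanSingleton k K C.one ∘ₗ C.counit2)) (C.mul ∘ₗ C.braid))

theorem LL_apply (a b c d : K) : C.LL ((a ⊗ₜ b) ⊗ₜ (c ⊗ₜ d)) =
    (C.commMap (a ⊗ₜ b) - (C.counit a * C.counit b) • 1) * C.mop c d := by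
  simp [LL, C.mul_eq, C.one_eq, ColorHopfAlg.counit2, mop]

theorem main_id {g h : G} {x y : K} (hx : x ∈ C.grade g) (hy : y ∈ C.grade h) :
    C.mul (x ⊗ₜ y) - C.φ g h • C.mul (y ⊗ₜ x) = C.LL (C.comul2 (x ⊗ₜ y)) := by
  rw [C.comul2_eq]
  simp only [C.LL_apply, sub_mul, smul_mul_assoc, one_mul]
  have h1 := C.main1 x hy
  have h2 := C.main2 x y
  have h3 : C.mop x y = C.φ g h • C.mul (y ⊗ₜ x) := by
    rw [mop, C.braid_apply _ _ _ _ hx hy, map_smul]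
  rw [C.mul_eq x y, ← h3, ← h1, ← h2]
  simp only [sw, Finset.sum_sub_distrib]

theorem main_mem (V W : Submodule k K) (hV : C.IsCHSub V) (hW : C.IsCHSub W) {x y : K}
    (hx : x ∈ V) (hy : y ∈ W) : C.LL (C.comul2 (x ⊗ₜ y)) ∈
        Submodule.span k {z : K |
          ∃ q ∈ (C.commSub V W) ⊓ LinearMap.ker C.counit, ∃ a : K,
            z = C.mul (q ⊗ₜ[k] a)} := by
  set S := Submodule.span k {z : K |
          ∃ q ∈ (C.commSub V W) ⊓ LinearMap.ker C.counit, ∃ a : K,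
            z = C.mul (q ⊗ₜ[k] a)} with hS
  -- pure tensors
  have hp : ∀ v ∈ V, ∀ w ∈ W, ∀ c d : K, C.LL ((v ⊗ₜ w) ⊗ₜ (c ⊗ₜ d)) ∈ S := by
    intro v hv w hw c d
    rw [C.LL_apply]
    refine Submodule.subset_span ⟨_, ⟨?_, ?_⟩, _, (C.mul_eq _ _).symm⟩
    · have hgen : ∀ z ∈ {z : K | ∃ x ∈ V, ∃ y ∈ W, z = C.commMap (x ⊗ₜ[k] y)},
          z ∈ C.commSub V W := by
        intro z hz
        rw [ColorHopfAlg.commSub, ColorHopfAlg.genFrom, Submodule.mem_sInf]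
        intro U hU
        exact hU.1 hz
      have hone : (1 : K) ∈ C.commSub V W := by
        rw [ColorHopfAlg.commSub, ColorHopfAlg.genFrom, Submodule.mem_sInf]
        intro U hU
        rw [← C.one_eq]
        exact hU.2.1
      exact Submodule.sub_mem _ (hgen _ ⟨v, hv, w, hw, rfl⟩) (Submodule.smul_mem _ _ hone)
    · have h1 : C.counit 1 = 1 := by rw [← C.one_eq, C.counit_one]
      simp [eps_comm, h1]
  -- braided
  have hq : ∀ a ∈ V, ∀ b ∈ V, ∀ c ∈ W, ∀ d : K,
      C.LL (midMap k C.braid ((a ⊗ₜ b) ⊗ₜ (c ⊗ₜ d))) ∈ S := by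
    intro a ha b hb c hc d
    have e1 := hV.graded b hb
    have e2 := hW.graded c hc
    induction e1 using Submodule.span_induction with
    | zero => simp
    | add b b' _ _ h1 h2 =>
      simp only [TensorProduct.tmul_add, TensorProduct.add_tmul, map_add]
      refine Submodule.add_mem _ (h1 ?_) (h2 ?_)
      · refine Submodule.span_le.2 ?_ (by assumption : b ∈ Submodule.span k _)
        rintro z ⟨hz, -⟩; exact hz
      · refine Submodule.span_le.2 ?_ (by assumption : b' ∈ Submodule.span k _)
        rintro z ⟨hz, -⟩; exact hz
    | smul r b _ h1 =>
      rw [TensorProduct.tmul_smul, ← TensorProduct.smul_tmul', map_smul, map_smul]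
      refine Submodule.smul_mem _ _ (h1 ?_)
      refine Submodule.span_le.2 ?_ (by assumption : b ∈ Submodule.span k _)
      rintro z ⟨hz, -⟩; exact hz
    | mem b hb' =>
      obtain ⟨-, g, hbg⟩ := hb'
      induction e2 using Submodule.span_induction with
      | zero => simp
      | add c c' _ _ h1 h2 =>
        simp only [TensorProduct.tmul_add, TensorProduct.add_tmul, map_add]
        refine Submodule.add_mem _ (h1 ?_) (h2 ?_)
        · refine Submodule.span_le.2 ?_ (by assumption : c ∈ Submodule.span k _)
          rintro z ⟨hz, -⟩; exact hz
        · refine Submodule.span_le.2 ?_ (by assumption : c' ∈ Submodule.span k _)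
          rintro z ⟨hz, -⟩; exact hz
      | smul r c _ h1 =>
        rw [← TensorProduct.smul_tmul', TensorProduct.tmul_smul, map_smul, map_smul]
        refine Submodule.smul_mem _ _ (h1 ?_)
        refine Submodule.span_le.2 ?_ (by assumption : c ∈ Submodule.span k _)
        rintro z ⟨hz, -⟩; exact hz
      | mem c hc' =>
        obtain ⟨hcW, h, hch⟩ := hc'
        have : midMap k C.braid ((a ⊗ₜ b) ⊗ₜ (c ⊗ₜ d)) = C.φ g h • ((a ⊗ₜ c) ⊗ₜ (b ⊗ₜ d)) := by
          simp [midMap, C.braid_apply g h b c hbg hch, ← TensorProduct.smul_tmul']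
        rw [this, map_smul]
        exact Submodule.smul_mem _ _ (hp a ha c hcW b d)
  obtain ⟨t, ht⟩ := hV.comul_mem x hx
  obtain ⟨u, hu⟩ := hW.comul_mem y hy
  have e : C.comul2 (x ⊗ₜ y) = midMap k C.braid (C.comul x ⊗ₜ C.comul y) := rfl
  rw [e, ← ht, ← hu]
  clear ht hu e
  induction t using TensorProduct.induction_on with
  | zero => simp
  | add t t' h1 h2 =>
    simp only [map_add, TensorProduct.add_tmul]
    exact Submodule.add_mem _ h1 h2
  | tmul v v' =>
    induction u using TensorProduct.induction_on with
    | zero => simp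
    | add t t' h1 h2 =>
      simp only [map_add, TensorProduct.tmul_add]
      exact Submodule.add_mem _ h1 h2
    | tmul w w' =>
      exact hq v v.2 v' v'.2 w w.2 w'

end RC
end CHelp


section Statements

variable {H : Type*} [AddCommGroup H] [Module k H]

/-- for normal color Hopf subalgebras `X = V`, `Y = W` of `A` and
homogeneous `x ∈ X`, `y ∈ Y`,
`xy − φ(|x|,|y|) yx = ([x₁,y₁] − ε([x₁,y₁])) φ(|x₂|,|y|) y₂ x₂ ∈ [X,Y]⁺A`. -/
theorem commutator_realizes_huq (C : ColorHopfAlg k G H)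
    (V W : Submodule k H) (hV : C.IsCHSub V) (hW : C.IsCHSub W)
    (hVn : C.IsNormal V) (hWn : C.IsNormal W) :
    ∀ (g h : G) (x y : H), x ∈ V → x ∈ C.grade g → y ∈ W → y ∈ C.grade h →
      (C.mul (x ⊗ₜ[k] y) - C.φ g h • C.mul (y ⊗ₜ[k] x) =
        (C.mul ∘ₗ
          (TensorProduct.map
            (C.commMap - (LinearMap.toSpanSingleton k H C.one ∘ₗ C.counit2))
            (C.mul ∘ₗ C.braid)) ∘ₗ C.comul2) (x ⊗ₜ[k] y)) ∧
      (C.mul (x ⊗ₜ[k] y) - C.φ g h • C.mul (y ⊗ₜ[k] x) ∈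
        Submodule.span k {z : H |
          ∃ q ∈ (C.commSub V W) ⊓ LinearMap.ker C.counit, ∃ a : H,
            z = C.mul (q ⊗ₜ[k] a)}) := by
  letI : Ring H :=
    { (inferInstance : AddCommGroup H) with
      mul := fun x y => C.mul (x ⊗ₜ y)
      one := C.one
      mul_assoc := fun x y z => C.mul_assoc' x y z
      one_mul := fun x => C.one_mul' x
      mul_one := fun x => C.mul_one' x
      left_distrib := fun x y z => by
        change C.mul (x ⊗ₜ (y + z)) = C.mul (x ⊗ₜ y) + C.mul (x ⊗ₜ z)
        rw [TensorProduct.tmul_add, map_add]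
      right_distrib := fun x y z => by
        change C.mul ((x + y) ⊗ₜ z) = C.mul (x ⊗ₜ z) + C.mul (y ⊗ₜ z)
        rw [TensorProduct.add_tmul, map_add]
      zero_mul := fun x => by
        change C.mul (0 ⊗ₜ x) = 0
        rw [TensorProduct.zero_tmul, map_zero]
      mul_zero := fun x => by
        change C.mul (x ⊗ₜ 0) = 0
        rw [TensorProduct.tmul_zero, map_zero] }
  haveI : IsScalarTower k H H := ⟨fun r x y => by
    change C.mul ((r • x) ⊗ₜ y) = r • C.mul (x ⊗ₜ y)
    rw [← TensorProduct.smul_tmul', map_smul]⟩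
  haveI : SMulCommClass k H H := ⟨fun r x y => by
    change r • C.mul (x ⊗ₜ y) = C.mul (x ⊗ₜ (r • y))
    rw [TensorProduct.tmul_smul, map_smul]⟩
  let D : CHelp.RC k G H := { C with mul_eq := fun _ _ => rfl, one_eq := rfl }
  intro g h x y hxV hxg hyW hyh
  have e : C.mul (x ⊗ₜ[k] y) - C.φ g h • C.mul (y ⊗ₜ[k] x) = D.LL (D.comul2 (x ⊗ₜ y)) :=
    D.main_id hxg hyh
  refine ⟨e, ?_⟩
  rw [e]
  exact D.main_mem V W hV hW hxV hyW

end Statements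

end ColorHopfPaper
end

section
/- Let f: A → B be a morphism of cocommutative color Hopf algebras such that f(X) and f(Y) commute in B (i.e., φ(|u₂|,|v|) u₁ v S(u₂) = ε(u) v for u ∈ f(X), v ∈ f(Y)), where X, Y are color Hopf subalgebras of A. Then every generator [x,y] := φ(|x₂|,|y₁|) x₁ y₁ S(x₂) S(y₂) of the commutator subalgebra lies in the Hopf kernel of f, i.e., [x,y]₁ ⊗ f([x,y]₂) = [x,y] ⊗ 1_B. -/
open TensorProduct

namespace ColorHopfPaper

variable (k : Type*) [Field k] (G : Type*) [CommGroup G]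

namespace ColorHopfAlg

section Aux

variable {k G}
variable {H : Type*} [AddCommGroup H] [Module k H] (C : ColorHopfAlg k G H)

theorem phi_one_left (h : G) : C.φ 1 h = 1 := by
  have := C.φ_mul_left 1 1 h
  rw [mul_one] at this
  exact (mul_eq_left₀ (C.φ_ne 1 h)).1 this.symm

theorem phi_one_right (h : G) : C.φ h 1 = 1 := by
  have := C.φ_mul_right h 1 1
  rw [mul_one] at this
  exact (mul_eq_left₀ (C.φ_ne h 1)).1 this.symm

theorem hind1 {P : H → Prop} (hp : ∀ g, ∀ x ∈ C.grade g, P x)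
    (ha : ∀ x y, P x → P y → P (x + y)) (x : H) : P x := by
  have hx : x ∈ ⨆ g : G, C.grade g := by rw [C.grade_top]; trivial
  exact Submodule.iSup_induction _ (motive := P) hx hp (hp 1 0 (Submodule.zero_mem _)) ha

/-- induction on tensors with a homogeneous left leg -/
theorem hindL {M : Type*} [AddCommGroup M] [Module k M] {P : H ⊗[k] M → Prop}
    (hp : ∀ g, ∀ x ∈ C.grade g, ∀ m, P (x ⊗ₜ[k] m))
    (ha : ∀ x y, P x → P y → P (x + y)) (t : H ⊗[k] M) : P t := by
  induction t using TensorProduct.induction_on with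
  | zero => simpa using hp 1 0 (Submodule.zero_mem _) 0
  | tmul x m =>
    refine C.hind1 (P := fun x => P (x ⊗ₜ[k] m)) (fun g x hx => hp g x hx m) ?_ x
    intro x y hx hy
    rw [TensorProduct.add_tmul]; exact ha _ _ hx hy
  | add x y hx hy => exact ha _ _ hx hy

theorem hind2 {P : H ⊗[k] H → Prop}
    (hp : ∀ g, ∀ x ∈ C.grade g, ∀ h, ∀ y ∈ C.grade h, P (x ⊗ₜ[k] y))
    (ha : ∀ x y, P x → P y → P (x + y)) (t : H ⊗[k] H) : P t := by
  refine C.hindL (fun g x hx m => ?_) ha t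
  refine C.hind1 (P := fun m => P (x ⊗ₜ[k] m)) (fun h y hy => hp g x hx h y hy) ?_ m
  intro a b h1 h2
  rw [TensorProduct.tmul_add]; exact ha _ _ h1 h2

theorem hindV {V : Submodule k H} (hV : C.IsCHSub V) {P : H → Prop}
    (hp : ∀ g, ∀ x ∈ C.grade g, x ∈ V → P x)
    (ha : ∀ x y, P x → P y → P (x + y)) (x : H) (hx : x ∈ V) : P x := by
  have h1 : Submodule.span k {y : H | y ∈ V ∧ ∃ g : G, y ∈ C.grade g} ≤
      ⨆ g : G, (C.grade g ⊓ V) := by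
    rw [Submodule.span_le]
    rintro y ⟨hy, g, hg⟩
    exact Submodule.mem_iSup_of_mem g ⟨hg, hy⟩
  exact Submodule.iSup_induction _ (motive := P) (h1 (hV.graded x hx))
    (fun g y hy => hp g y hy.1 hy.2) (hp 1 0 (Submodule.zero_mem _) (Submodule.zero_mem _)) ha

/-- induction on the coproduct of an element of a Hopf subalgebra -/
theorem hindVV {V : Submodule k H} (hV : C.IsCHSub V) {P : H ⊗[k] H → Prop}
    (hp : ∀ g, ∀ x ∈ C.grade g, x ∈ V → ∀ h, ∀ y ∈ C.grade h, y ∈ V → P (x ⊗ₜ[k] y))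
    (ha : ∀ x y, P x → P y → P (x + y)) (x : H) (hx : x ∈ V) : P (C.comul x) := by
  obtain ⟨t, ht⟩ := hV.comul_mem x hx
  rw [← ht]
  clear ht
  induction t using TensorProduct.induction_on with
  | zero =>
    simpa using hp 1 0 (Submodule.zero_mem _) (Submodule.zero_mem _) 1 0
      (Submodule.zero_mem _) (Submodule.zero_mem _)
  | tmul a b =>
    rw [TensorProduct.map_tmul]
    refine C.hindV hV (P := fun a => P (a ⊗ₜ[k] _)) ?_ ?_ _ a.2
    · intro g y hy hyV
      refine C.hindV hV (P := fun b => P (_ ⊗ₜ[k] b)) ?_ ?_ _ b.2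
      · intro h z hz hzV
        exact hp g y hy hyV h z hz hzV
      · intro a b h1 h2
        rw [TensorProduct.tmul_add]; exact ha _ _ h1 h2
    · intro a b h1 h2
      rw [TensorProduct.add_tmul]; exact ha _ _ h1 h2
  | add x y hx hy => rw [map_add]; exact ha _ _ hx hy

/-- the braided multiplication on `H ⊗ H` -/
noncomputable def mu : (H ⊗[k] H) ⊗[k] (H ⊗[k] H) →ₗ[k] H ⊗[k] H :=
  (TensorProduct.map C.mul C.mul) ∘ₗ midMap k C.braid

theorem mid_hom {g h : G} {b c : H} (hb : b ∈ C.grade g) (hc : c ∈ C.grade h) (a d : H) :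
    midMap k C.braid ((a ⊗ₜ[k] b) ⊗ₜ[k] (c ⊗ₜ[k] d)) =
      C.φ g h • ((a ⊗ₜ[k] c) ⊗ₜ[k] (b ⊗ₜ[k] d)) := by
  simp [midMap, C.braid_apply g h b c hb hc, TensorProduct.smul_tmul', TensorProduct.tmul_smul]

theorem mu_hom {g h : G} {b c : H} (hb : b ∈ C.grade g) (hc : c ∈ C.grade h) (a d : H) :
    C.mu ((a ⊗ₜ[k] b) ⊗ₜ[k] (c ⊗ₜ[k] d)) =
      C.φ g h • (C.mul (a ⊗ₜ[k] c) ⊗ₜ[k] C.mul (b ⊗ₜ[k] d)) := by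
  simp [mu, C.mid_hom hb hc]

theorem comul_mul_apply (x y : H) :
    C.comul (C.mul (x ⊗ₜ[k] y)) = C.mu (C.comul x ⊗ₜ[k] C.comul y) := by
  have := LinearMap.congr_fun C.comul_mul (x ⊗ₜ[k] y)
  simpa [mu] using this

theorem mu_assoc (r s t : H ⊗[k] H) :
    C.mu (C.mu (r ⊗ₜ[k] s) ⊗ₜ[k] t) = C.mu (r ⊗ₜ[k] C.mu (s ⊗ₜ[k] t)) := by
  refine C.hind2 (P := fun r => C.mu (C.mu (r ⊗ₜ[k] s) ⊗ₜ[k] t) = C.mu (r ⊗ₜ[k] C.mu (s ⊗ₜ[k] t))) ?_ ?_ r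
  · intro g1 a ha g2 b hb
    refine C.hind2 (P := fun s => C.mu (C.mu ((a ⊗ₜ[k] b) ⊗ₜ[k] s) ⊗ₜ[k] t) = C.mu ((a ⊗ₜ[k] b) ⊗ₜ[k] C.mu (s ⊗ₜ[k] t))) ?_ ?_ s
    · intro g3 c hc g4 d hd
      refine C.hind2 (P := fun t => C.mu (C.mu ((a ⊗ₜ[k] b) ⊗ₜ[k] (c ⊗ₜ[k] d)) ⊗ₜ[k] t) = C.mu ((a ⊗ₜ[k] b) ⊗ₜ[k] C.mu ((c ⊗ₜ[k] d) ⊗ₜ[k] t))) ?_ ?_ t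
      · intro g5 e he g6 f hf
        rw [C.mu_hom hb hc, C.mu_hom hd he, TensorProduct.tmul_smul, ← TensorProduct.smul_tmul',
          map_smul, map_smul, C.mu_hom (C.mul_mem _ _ _ _ hb hd) he,
          C.mu_hom hb (C.mul_mem _ _ _ _ hc he), smul_smul, smul_smul, C.mul_assoc', C.mul_assoc',
          C.φ_mul_left, C.φ_mul_right]
        congr 1; ring
      · intro x y hx hy; simp only [TensorProduct.tmul_add, map_add, hx, hy]
    · intro x y hx hy; simp only [TensorProduct.tmul_add, TensorProduct.add_tmul, map_add, hx, hy]
  · intro x y hx hy; simp only [TensorProduct.tmul_add, TensorProduct.add_tmul, map_add, hx, hy]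

theorem mu_one (r : H ⊗[k] H) : C.mu (r ⊗ₜ[k] (C.one ⊗ₜ[k] C.one)) = r := by
  refine C.hind2 (P := fun r => C.mu (r ⊗ₜ[k] (C.one ⊗ₜ[k] C.one)) = r) ?_ ?_ r
  · intro g1 a ha g2 b hb
    rw [C.mu_hom hb C.one_mem, C.phi_one_right, one_smul, C.mul_one', C.mul_one']
  · intro x y hx hy; simp only [TensorProduct.add_tmul, map_add, hx, hy]

theorem one_mu (r : H ⊗[k] H) : C.mu ((C.one ⊗ₜ[k] C.one) ⊗ₜ[k] r) = r := by
  refine C.hind2 (P := fun r => C.mu ((C.one ⊗ₜ[k] C.one) ⊗ₜ[k] r) = r) ?_ ?_ r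
  · intro g1 a ha g2 b hb
    rw [C.mu_hom C.one_mem ha, C.phi_one_left, one_smul, C.one_mul', C.one_mul']
  · intro x y hx hy; simp only [TensorProduct.tmul_add, map_add, hx, hy]

theorem coassoc_apply (x : H) :
    TensorProduct.assoc k H H H (TensorProduct.map C.comul LinearMap.id (C.comul x)) =
      TensorProduct.map LinearMap.id C.comul (C.comul x) := by
  simpa using LinearMap.congr_fun C.coassoc x

theorem cocomm_apply (x : H) : C.braid (C.comul x) = C.comul x := by
  simpa using LinearMap.congr_fun C.cocomm x

/-- generic consequence of the counit axiom -/
theorem counitR_apply {N : Type*} [AddCommGroup N] [Module k N] (F : H →ₗ[k] N) (x : H)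
    (L : H ⊗[k] H →ₗ[k] N) (hL : ∀ a b, L (a ⊗ₜ[k] b) = C.counit b • F a) :
    L (C.comul x) = F x := by
  have h : L = F ∘ₗ (TensorProduct.rid k H).toLinearMap ∘ₗ
      (TensorProduct.map LinearMap.id C.counit) := by
    ext a b; simp [hL]
  rw [h]; simp [C.counit_right]

theorem counitL_apply {N : Type*} [AddCommGroup N] [Module k N] (F : H →ₗ[k] N) (x : H)
    (L : H ⊗[k] H →ₗ[k] N) (hL : ∀ a b, L (a ⊗ₜ[k] b) = C.counit a • F b) :
    L (C.comul x) = F x := by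
  have h : L = F ∘ₗ (TensorProduct.lid k H).toLinearMap ∘ₗ
      (TensorProduct.map C.counit LinearMap.id) := by
    ext a b; simp [hL]
  rw [h]; simp [C.counit_left]

theorem conv_unique {R : Type*} [AddCommGroup R] [Module k R] (μ : R ⊗[k] R →ₗ[k] R) (e : R)
    (hassoc : ∀ a b c, μ (μ (a ⊗ₜ[k] b) ⊗ₜ[k] c) = μ (a ⊗ₜ[k] μ (b ⊗ₜ[k] c)))
    (h1 : ∀ a, μ (e ⊗ₜ[k] a) = a) (h2 : ∀ a, μ (a ⊗ₜ[k] e) = a)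
    (f g h : H →ₗ[k] R)
    (hfg : ∀ x, μ (TensorProduct.map f g (C.comul x)) = C.counit x • e)
    (hgh : ∀ x, μ (TensorProduct.map g h (C.comul x)) = C.counit x • e) (x : H) : f x = h x := by
  have e1 := congrArg (μ ∘ₗ TensorProduct.map f (μ ∘ₗ TensorProduct.map g h)) (C.coassoc_apply x)
  have e2 : (μ ∘ₗ TensorProduct.map f (μ ∘ₗ TensorProduct.map g h))
      (TensorProduct.map LinearMap.id C.comul (C.comul x)) = f x := by
    refine C.counitR_apply f x ((μ ∘ₗ TensorProduct.map f (μ ∘ₗ TensorProduct.map g h)) ∘ₗ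
      TensorProduct.map LinearMap.id C.comul) ?_
    intro a b
    simp [hgh, h2]
  have e3 : (μ ∘ₗ TensorProduct.map f (μ ∘ₗ TensorProduct.map g h)) ∘ₗ
      (TensorProduct.assoc k H H H).toLinearMap =
      μ ∘ₗ TensorProduct.map (μ ∘ₗ TensorProduct.map f g) h := by
    ext a b c
    simp [hassoc]
  have e4 := C.counitL_apply h x ((μ ∘ₗ TensorProduct.map (μ ∘ₗ TensorProduct.map f g) h) ∘ₗ
      TensorProduct.map C.comul LinearMap.id) (by
    intro a b
    simp [hfg, h1, ← TensorProduct.smul_tmul'])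
  rw [← e2, ← e1, ← e4, ← e3]
  simp

/-- four-fold coproduct -/
noncomputable def X4 : H →ₗ[k] (H ⊗[k] H) ⊗[k] (H ⊗[k] H) :=
  TensorProduct.map C.comul C.comul ∘ₗ C.comul

theorem X4_assoc (x : H) : TensorProduct.assoc k H H (H ⊗[k] H) (C.X4 x) =
    TensorProduct.map LinearMap.id ((TensorProduct.assoc k H H H).toLinearMap ∘ₗ
      TensorProduct.map C.comul LinearMap.id ∘ₗ C.comul) (C.comul x) := by
  rw [C.coassoc]
  have h1 : ∀ t : H ⊗[k] H,
      TensorProduct.assoc k H H (H ⊗[k] H) (TensorProduct.map C.comul C.comul t) =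
      TensorProduct.map LinearMap.id (TensorProduct.map LinearMap.id C.comul)
        (TensorProduct.assoc k H H H (TensorProduct.map C.comul LinearMap.id t)) := by
    intro t
    induction t using TensorProduct.induction_on with
    | zero => simp
    | add x y hx hy => simp only [map_add, hx, hy]
    | tmul a b =>
      simp only [TensorProduct.map_tmul, LinearMap.id_apply]
      generalize C.comul a = s
      induction s using TensorProduct.induction_on with
      | zero => simp
      | add x y hx hy => simp only [map_add, TensorProduct.add_tmul, hx, hy]
      | tmul a b => simp
  rw [X4, LinearMap.comp_apply, h1, C.coassoc_apply]
  generalize C.comul x = t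
  induction t using TensorProduct.induction_on with
  | zero => simp
  | add x y hx hy => simp only [map_add, hx, hy]
  | tmul a b => simp

theorem mid_X4 (x : H) : midMap k C.braid (C.X4 x) = C.X4 x := by
  apply (TensorProduct.assoc k H H (H ⊗[k] H)).injective
  rw [midMap, LinearMap.comp_apply, LinearMap.comp_apply]
  simp only [LinearEquiv.coe_coe, LinearEquiv.apply_symm_apply]
  rw [X4_assoc]
  generalize C.comul x = t
  induction t using TensorProduct.induction_on with
  | zero => simp
  | add x y hx hy => simp only [map_add, hx, hy]
  | tmul a b =>
    simp only [TensorProduct.map_tmul, LinearMap.comp_apply, LinearEquiv.coe_coe,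
      LinearEquiv.symm_apply_apply, LinearMap.id_apply]
    congr 2
    generalize C.comul b = t
    induction t using TensorProduct.induction_on with
    | zero => simp
    | add x y hx hy => simp only [map_add, hx, hy]
    | tmul a b => simp [C.cocomm_apply]

theorem comul_antipode (x : H) :
    C.comul (C.antipode x) = TensorProduct.map C.antipode C.antipode (C.comul x) := by
  refine C.conv_unique C.mu (C.one ⊗ₜ[k] C.one) C.mu_assoc C.one_mu C.mu_one
    (C.comul ∘ₗ C.antipode) C.comul (TensorProduct.map C.antipode C.antipode ∘ₗ C.comul) ?_ ?_ x
  · intro x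
    have h := congrArg C.comul (C.antipode_left x)
    rw [map_smul, C.comul_one] at h
    rw [← h]
    generalize C.comul x = t
    induction t using TensorProduct.induction_on with
    | zero => simp
    | add x y hx hy => simp only [map_add, hx, hy]
    | tmul a b => simp [C.comul_mul_apply]
  · intro x
    have e1 : C.mu (TensorProduct.map C.comul (TensorProduct.map C.antipode C.antipode ∘ₗ C.comul)
        (C.comul x)) = C.mu (TensorProduct.map LinearMap.id
          (TensorProduct.map C.antipode C.antipode) (C.X4 x)) := by
      rw [X4, LinearMap.comp_apply]
      generalize C.comul x = t
      induction t using TensorProduct.induction_on with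
      | zero => simp
      | add x y hx hy => simp only [map_add, hx, hy]
      | tmul a b => simp
    have e2 : ∀ X : (H ⊗[k] H) ⊗[k] (H ⊗[k] H), C.mu (TensorProduct.map LinearMap.id
          (TensorProduct.map C.antipode C.antipode) X) =
        TensorProduct.map (C.mul ∘ₗ TensorProduct.map LinearMap.id C.antipode)
          (C.mul ∘ₗ TensorProduct.map LinearMap.id C.antipode) (midMap k C.braid X) := by
      intro X
      induction X using TensorProduct.induction_on with
      | zero => simp
      | add x y hx hy => simp only [map_add, hx, hy]
      | tmul s t =>
        refine C.hind2 (P := fun s => C.mu (TensorProduct.map LinearMap.id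
          (TensorProduct.map C.antipode C.antipode) (s ⊗ₜ[k] t)) =
          TensorProduct.map (C.mul ∘ₗ TensorProduct.map LinearMap.id C.antipode)
          (C.mul ∘ₗ TensorProduct.map LinearMap.id C.antipode) (midMap k C.braid (s ⊗ₜ[k] t))) ?_ ?_ s
        · intro g1 a ha g2 b hb
          refine C.hind2 (P := fun t => C.mu (TensorProduct.map LinearMap.id
            (TensorProduct.map C.antipode C.antipode) ((a ⊗ₜ[k] b) ⊗ₜ[k] t)) =
            TensorProduct.map (C.mul ∘ₗ TensorProduct.map LinearMap.id C.antipode)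
            (C.mul ∘ₗ TensorProduct.map LinearMap.id C.antipode)
              (midMap k C.braid ((a ⊗ₜ[k] b) ⊗ₜ[k] t))) ?_ ?_ t
          · intro g3 c hc g4 d hd
            rw [C.mid_hom hb hc]
            simp only [TensorProduct.map_tmul, LinearMap.id_apply, map_smul, LinearMap.comp_apply]
            rw [C.mu_hom hb (C.antipode_mem _ _ hc)]
          · intro x y hx hy; simp only [TensorProduct.tmul_add, map_add, hx, hy]
        · intro x y hx hy; simp only [TensorProduct.add_tmul, map_add, hx, hy]
    rw [e1, e2, mid_X4, X4, LinearMap.comp_apply]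
    refine Eq.trans ?_ (C.counitR_apply ((LinearMap.toSpanSingleton k (H ⊗[k] H)
      (C.one ⊗ₜ[k] C.one)) ∘ₗ C.counit) x ((TensorProduct.map
        (C.mul ∘ₗ TensorProduct.map LinearMap.id C.antipode)
          (C.mul ∘ₗ TensorProduct.map LinearMap.id C.antipode)) ∘ₗ
            TensorProduct.map C.comul C.comul) ?_)
    · rfl
    · intro a b
      simp [C.antipode_right, TensorProduct.smul_tmul', TensorProduct.tmul_smul]

end Aux

end ColorHopfAlg

namespace ColorHopfAlg

section Aux2

variable {k G}
variable {H : Type*} [AddCommGroup H] [Module k H] (C : ColorHopfAlg k G H)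

theorem coassoc_symm (x : H) : TensorProduct.map C.comul LinearMap.id (C.comul x) =
    (TensorProduct.assoc k H H H).symm (TensorProduct.map LinearMap.id C.comul (C.comul x)) := by
  rw [← C.coassoc_apply, LinearEquiv.symm_apply_apply]

/-- right multiplication on the second leg -/
noncomputable def rm : (H ⊗[k] H) ⊗[k] H →ₗ[k] H ⊗[k] H :=
  TensorProduct.map LinearMap.id C.mul ∘ₗ (TensorProduct.assoc k H H H).toLinearMap

theorem rm_tmul (a b c : H) : C.rm ((a ⊗ₜ[k] b) ⊗ₜ[k] c) = a ⊗ₜ[k] C.mul (b ⊗ₜ[k] c) := by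
  simp [rm]

theorem rm_mu (t s : H ⊗[k] H) (z : H) :
    C.rm (C.mu (t ⊗ₜ[k] s) ⊗ₜ[k] z) = C.mu (t ⊗ₜ[k] C.rm (s ⊗ₜ[k] z)) := by
  refine C.hind2 (P := fun t => C.rm (C.mu (t ⊗ₜ[k] s) ⊗ₜ[k] z) =
    C.mu (t ⊗ₜ[k] C.rm (s ⊗ₜ[k] z))) ?_ ?_ t
  · intro g1 a ha g2 b hb
    refine C.hind2 (P := fun s => C.rm (C.mu ((a ⊗ₜ[k] b) ⊗ₜ[k] s) ⊗ₜ[k] z) =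
      C.mu ((a ⊗ₜ[k] b) ⊗ₜ[k] C.rm (s ⊗ₜ[k] z))) ?_ ?_ s
    · intro g3 c hc g4 d hd
      rw [C.mu_hom hb hc, C.rm_tmul, C.mu_hom hb hc, ← TensorProduct.smul_tmul', map_smul, C.rm_tmul,
        C.mul_assoc']
    · intro x y hx hy; simp only [TensorProduct.tmul_add, TensorProduct.add_tmul, map_add, hx, hy]
  · intro x y hx hy; simp only [TensorProduct.tmul_add, TensorProduct.add_tmul, map_add, hx, hy]

/-- `(b₁ ⊗ b₂) ⊗ w ↦ b₁ S(b₂ w)` -/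
noncomputable def E0 : (H ⊗[k] H) ⊗[k] H →ₗ[k] H :=
  C.mul ∘ₗ TensorProduct.map LinearMap.id C.antipode ∘ₗ C.rm

theorem E0_tmul (a b c : H) : C.E0 ((a ⊗ₜ[k] b) ⊗ₜ[k] c) =
    C.mul (a ⊗ₜ[k] C.antipode (C.mul (b ⊗ₜ[k] c))) := by
  simp [E0, rm_tmul]

/-- `b ⊗ w ↦ b₁ S(b₂ w)` -/
noncomputable def E : H ⊗[k] H →ₗ[k] H := C.E0 ∘ₗ TensorProduct.map C.comul LinearMap.id

theorem E_tmul (b w : H) : C.E (b ⊗ₜ[k] w) = C.E0 (C.comul b ⊗ₜ[k] w) := by simp [E]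

/-- multiply the first leg by a third factor moved across the second leg -/
noncomputable def lam : (H ⊗[k] H) ⊗[k] H →ₗ[k] H ⊗[k] H :=
  TensorProduct.map C.mul LinearMap.id ∘ₗ (TensorProduct.assoc k H H H).symm.toLinearMap ∘ₗ
    TensorProduct.map LinearMap.id C.braid ∘ₗ (TensorProduct.assoc k H H H).toLinearMap

theorem lam_hom {g h : G} {b c : H} (hb : b ∈ C.grade g) (hc : c ∈ C.grade h) (a : H) :
    C.lam ((a ⊗ₜ[k] b) ⊗ₜ[k] c) = C.φ g h • (C.mul (a ⊗ₜ[k] c) ⊗ₜ[k] b) := by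
  simp [lam, C.braid_apply g h b c hb hc]

/-- the adjoint action, as a function of the coproduct -/
noncomputable def adj0 : (H ⊗[k] H) ⊗[k] H →ₗ[k] H :=
  C.mul ∘ₗ
    (TensorProduct.map LinearMap.id
      (C.mul ∘ₗ (TensorProduct.map LinearMap.id C.antipode) ∘ₗ C.braid)) ∘ₗ
    (TensorProduct.assoc k H H H).toLinearMap

theorem adj_tmul (x y : H) : C.adj (x ⊗ₜ[k] y) = C.adj0 (C.comul x ⊗ₜ[k] y) := by
  simp [adj, adj0]

theorem adj0_hom {g h : G} {b c : H} (hb : b ∈ C.grade g) (hc : c ∈ C.grade h) (a : H) :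
    C.adj0 ((a ⊗ₜ[k] b) ⊗ₜ[k] c) =
      C.φ g h • C.mul (a ⊗ₜ[k] C.mul (c ⊗ₜ[k] C.antipode b)) := by
  simp [adj0, C.braid_apply g h b c hb hc]

theorem adj0_eq_lam (t : H ⊗[k] H) (y : H) :
    C.adj0 (t ⊗ₜ[k] y) = C.mul (TensorProduct.map LinearMap.id C.antipode (C.lam (t ⊗ₜ[k] y))) := by
  refine C.hind2 (P := fun t => C.adj0 (t ⊗ₜ[k] y) =
    C.mul (TensorProduct.map LinearMap.id C.antipode (C.lam (t ⊗ₜ[k] y)))) ?_ ?_ t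
  · intro g1 a ha g2 b hb
    refine C.hind1 (P := fun y => C.adj0 ((a ⊗ₜ[k] b) ⊗ₜ[k] y) =
      C.mul (TensorProduct.map LinearMap.id C.antipode (C.lam ((a ⊗ₜ[k] b) ⊗ₜ[k] y)))) ?_ ?_ y
    · intro h y hy
      rw [C.lam_hom hb hy, C.adj0_hom hb hy]
      simp [C.mul_assoc']
    · intro x y hx hy; simp only [TensorProduct.tmul_add, TensorProduct.add_tmul, map_add, hx, hy]
  · intro x y hx hy; simp only [TensorProduct.tmul_add, TensorProduct.add_tmul, map_add, hx, hy]

theorem lam_eq_mu (t : H ⊗[k] H) (y : H) :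
    C.lam (t ⊗ₜ[k] y) = C.mu (t ⊗ₜ[k] (y ⊗ₜ[k] C.one)) := by
  refine C.hind2 (P := fun t => C.lam (t ⊗ₜ[k] y) = C.mu (t ⊗ₜ[k] (y ⊗ₜ[k] C.one))) ?_ ?_ t
  · intro g1 a ha g2 b hb
    refine C.hind1 (P := fun y => C.lam ((a ⊗ₜ[k] b) ⊗ₜ[k] y) =
      C.mu ((a ⊗ₜ[k] b) ⊗ₜ[k] (y ⊗ₜ[k] C.one))) ?_ ?_ y
    · intro h y hy
      rw [C.lam_hom hb hy, C.mu_hom hb hy, C.mul_one']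
    · intro x y hx hy; simp only [TensorProduct.tmul_add, TensorProduct.add_tmul, map_add, hx, hy]
  · intro x y hx hy; simp only [TensorProduct.tmul_add, TensorProduct.add_tmul, map_add, hx, hy]

/-- `x ⊗ (y₁ ⊗ y₂) ↦ x y₁ ⊗ S(y₂)` -/
noncomputable def mS (x : H) : H ⊗[k] H →ₗ[k] H ⊗[k] H :=
  TensorProduct.map (C.mul ∘ₗ TensorProduct.mk k H H x) C.antipode

theorem mS_tmul (x a b : H) :
    C.mS x (a ⊗ₜ[k] b) = C.mul (x ⊗ₜ[k] a) ⊗ₜ[k] C.antipode b := by simp [mS]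

theorem lam_comul (x y : H) : C.rm (TensorProduct.map C.comul LinearMap.id (C.mS x (C.comul y))) =
    C.lam (C.comul x ⊗ₜ[k] y) := by
  have h1 : C.rm (TensorProduct.map C.comul LinearMap.id (C.mS x (C.comul y))) =
      (C.rm ∘ₗ TensorProduct.map (C.mu ∘ₗ TensorProduct.mk k _ _ (C.comul x)) C.antipode)
        (TensorProduct.map C.comul LinearMap.id (C.comul y)) := by
    generalize C.comul y = t
    induction t using TensorProduct.induction_on with
    | zero => simp
    | add x y hx hy => simp only [map_add, hx, hy]
    | tmul a b => simp [mS_tmul, C.comul_mul_apply]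
  rw [h1, C.coassoc_symm]
  refine C.counitR_apply (C.lam ∘ₗ TensorProduct.mk k _ _ (C.comul x)) y
    ((C.rm ∘ₗ TensorProduct.map (C.mu ∘ₗ TensorProduct.mk k _ _ (C.comul x)) C.antipode) ∘ₗ
      (TensorProduct.assoc k H H H).symm.toLinearMap ∘ₗ
        TensorProduct.map LinearMap.id C.comul) ?_
  intro a b
  have h2 : ∀ s : H ⊗[k] H, (C.rm ∘ₗ TensorProduct.map (C.mu ∘ₗ TensorProduct.mk k _ _ (C.comul x))
      C.antipode) ((TensorProduct.assoc k H H H).symm (a ⊗ₜ[k] s)) =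
      C.mu (C.comul x ⊗ₜ[k] (a ⊗ₜ[k] C.mul (TensorProduct.map LinearMap.id C.antipode s))) := by
    intro s
    induction s using TensorProduct.induction_on with
    | zero => simp
    | add x y hx hy => simp only [map_add, TensorProduct.tmul_add, hx, hy]
    | tmul c d => simp [rm_mu, rm_tmul]
  have h3 := h2 (C.comul b)
  rw [C.antipode_right] at h3
  simp only [LinearMap.comp_apply, TensorProduct.map_tmul, LinearMap.id_apply,
    LinearEquiv.coe_coe] at h3 ⊢
  rw [h3]
  simp [lam_eq_mu]

theorem adj_eq_E (x y : H) : C.adj (x ⊗ₜ[k] y) = C.E (C.mS x (C.comul y)) := by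
  rw [adj_tmul, adj0_eq_lam, ← lam_comul]
  simp [E, E0]

theorem braid_S (t : H ⊗[k] H) : C.braid (TensorProduct.map LinearMap.id C.antipode t) =
    TensorProduct.map C.antipode LinearMap.id (C.braid t) := by
  refine C.hind2 (P := fun t => C.braid (TensorProduct.map LinearMap.id C.antipode t) =
    TensorProduct.map C.antipode LinearMap.id (C.braid t)) ?_ ?_ t
  · intro g a ha h b hb
    rw [C.braid_apply g h a b ha hb]
    simp [C.braid_apply g h _ _ ha (C.antipode_mem _ _ hb)]
  · intro x y hx hy; simp only [map_add, hx, hy]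

/-- the generic twisted map -/
noncomputable def GE {M N : Type*} [AddCommGroup M] [Module k M] [AddCommGroup N] [Module k N]
    (e1 : M ⊗[k] H →ₗ[k] H) (e2 : N ⊗[k] H →ₗ[k] H) :
    (M ⊗[k] N) ⊗[k] (H ⊗[k] H) →ₗ[k] H ⊗[k] H :=
  TensorProduct.map e1 LinearMap.id ∘ₗ (TensorProduct.assoc k M H H).symm.toLinearMap ∘ₗ
    TensorProduct.map LinearMap.id (C.braid ∘ₗ TensorProduct.map e2 LinearMap.id ∘ₗ
      (TensorProduct.assoc k N H H).symm.toLinearMap) ∘ₗ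
    (TensorProduct.assoc k M N (H ⊗[k] H)).toLinearMap

theorem GE_tmul {M N : Type*} [AddCommGroup M] [Module k M] [AddCommGroup N] [Module k N]
    (e1 : M ⊗[k] H →ₗ[k] H) (e2 : N ⊗[k] H →ₗ[k] H) (m : M) (n : N) (u v : H) :
    C.GE e1 e2 ((m ⊗ₜ[k] n) ⊗ₜ[k] (u ⊗ₜ[k] v)) = TensorProduct.map e1 LinearMap.id
      ((TensorProduct.assoc k M H H).symm (m ⊗ₜ[k] C.braid (e2 (n ⊗ₜ[k] u) ⊗ₜ[k] v))) := by
  simp [GE]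

theorem GE_E (s t : H ⊗[k] H) : C.GE C.E0 C.E0 (TensorProduct.map C.comul C.comul s ⊗ₜ[k] t) =
    C.GE C.E C.E (s ⊗ₜ[k] t) := by
  induction s using TensorProduct.induction_on with
  | zero => simp
  | add x y hx hy => simp only [map_add, TensorProduct.add_tmul, hx, hy]
  | tmul a b =>
    induction t using TensorProduct.induction_on with
    | zero => simp
    | add x y hx hy => simp only [map_add, TensorProduct.tmul_add, hx, hy]
    | tmul u v =>
      rw [TensorProduct.map_tmul, GE_tmul, GE_tmul, E_tmul]
      generalize C.braid _ = z
      induction z using TensorProduct.induction_on with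
      | zero => simp
      | add x y hx hy => simp only [map_add, TensorProduct.tmul_add, hx, hy]
      | tmul u v => simp [E_tmul]

/-- auxiliary map -/
noncomputable def FF : ((H ⊗[k] H) ⊗[k] (H ⊗[k] H)) ⊗[k] (H ⊗[k] H) →ₗ[k] H ⊗[k] H :=
  C.mu ∘ₗ TensorProduct.map LinearMap.id (TensorProduct.map C.antipode C.antipode ∘ₗ C.mu) ∘ₗ
    (TensorProduct.assoc k (H ⊗[k] H) (H ⊗[k] H) (H ⊗[k] H)).toLinearMap

theorem FF_tmul (r s t : H ⊗[k] H) : C.FF ((r ⊗ₜ[k] s) ⊗ₜ[k] t) =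
    C.mu (r ⊗ₜ[k] TensorProduct.map C.antipode C.antipode (C.mu (s ⊗ₜ[k] t))) := by
  simp [FF]

theorem FF_mid (X : (H ⊗[k] H) ⊗[k] (H ⊗[k] H)) (t : H ⊗[k] H) :
    C.FF (midMap k C.braid X ⊗ₜ[k] C.braid t) = C.GE C.E0 C.E0 (X ⊗ₜ[k] t) := by
  induction X using TensorProduct.induction_on with
  | zero => simp
  | add x y hx hy => simp only [map_add, TensorProduct.add_tmul, hx, hy]
  | tmul r s =>
    refine C.hind2 (P := fun r => C.FF (midMap k C.braid (r ⊗ₜ[k] s) ⊗ₜ[k] C.braid t) =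
      C.GE C.E0 C.E0 ((r ⊗ₜ[k] s) ⊗ₜ[k] t)) ?_ ?_ r
    · intro ga a ha gb b hb
      refine C.hind2 (P := fun s => C.FF (midMap k C.braid ((a ⊗ₜ[k] b) ⊗ₜ[k] s) ⊗ₜ[k] C.braid t) =
        C.GE C.E0 C.E0 (((a ⊗ₜ[k] b) ⊗ₜ[k] s) ⊗ₜ[k] t)) ?_ ?_ s
      · intro gc c hc gd d hd
        refine C.hind2 (P := fun t => C.FF (midMap k C.braid ((a ⊗ₜ[k] b) ⊗ₜ[k] (c ⊗ₜ[k] d)) ⊗ₜ[k]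
          C.braid t) = C.GE C.E0 C.E0 (((a ⊗ₜ[k] b) ⊗ₜ[k] (c ⊗ₜ[k] d)) ⊗ₜ[k] t)) ?_ ?_ t
        · intro gu u hu gv v hv
          have hbv := C.antipode_mem _ _ (C.mul_mem _ _ _ _ hb hv)
          have hdu := C.mul_mem _ _ _ _ hc (C.antipode_mem _ _ (C.mul_mem _ _ _ _ hd hu))
          rw [C.mid_hom hb hc, C.braid_apply _ _ _ _ hu hv, GE_tmul, E0_tmul,
            C.braid_apply _ _ _ _ hdu hv]
          simp only [← TensorProduct.smul_tmul', TensorProduct.tmul_smul, map_smul, FF_tmul,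
            C.mu_hom hd hv, TensorProduct.map_tmul, C.mu_hom hc hbv,
            TensorProduct.assoc_symm_tmul, E0_tmul, LinearMap.id_apply, smul_smul]
          congr 1
          simp only [C.φ_mul_left, C.φ_mul_right]
          linear_combination (C.φ gu gv * C.φ gd gv * C.φ gc gv) * C.φ_skew gb gc
        · intro x y hx hy; simp only [TensorProduct.tmul_add, map_add, hx, hy]
      · intro x y hx hy; simp only [TensorProduct.tmul_add, TensorProduct.add_tmul, map_add, hx, hy]
    · intro x y hx hy; simp only [TensorProduct.add_tmul, map_add, hx, hy]

theorem comul_E (b w : H) : C.comul (C.E (b ⊗ₜ[k] w)) =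
    C.GE C.E C.E (C.comul b ⊗ₜ[k] C.comul w) := by
  rw [← GE_E]
  change _ = C.GE C.E0 C.E0 (C.X4 b ⊗ₜ[k] C.comul w)
  rw [← C.FF_mid, C.mid_X4, C.cocomm_apply, E_tmul, X4, LinearMap.comp_apply]
  generalize C.comul b = t
  induction t using TensorProduct.induction_on with
  | zero => simp
  | add x y hx hy => simp only [map_add, TensorProduct.add_tmul, hx, hy]
  | tmul c d =>
    simp [E0_tmul, FF_tmul, C.comul_mul_apply, C.comul_antipode]

/-- formula for the coproduct of the adjoint action -/
theorem comul_adj (x y : H) : C.comul (C.adj (x ⊗ₜ[k] y)) =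
    (C.GE C.E C.adj ∘ₗ TensorProduct.map (C.lam ∘ₗ TensorProduct.mk k _ _ (C.comul x))
      (TensorProduct.map LinearMap.id C.antipode ∘ₗ C.comul)) (C.comul y) := by
  have h1 : C.comul (C.adj (x ⊗ₜ[k] y)) =
      (C.GE C.E C.E ∘ₗ TensorProduct.map (C.mu ∘ₗ TensorProduct.mk k _ _ (C.comul x))
        (TensorProduct.map C.antipode C.antipode)) (C.X4 y) := by
    rw [adj_eq_E, X4]
    simp only [LinearMap.comp_apply]
    generalize C.comul y = t
    induction t using TensorProduct.induction_on with
    | zero => simp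
    | add x y hx hy => simp only [map_add, hx, hy]
    | tmul c d => simp [mS_tmul, C.comul_E, C.comul_mul_apply, C.comul_antipode]
  have h2 : C.X4 y = (TensorProduct.assoc k H H (H ⊗[k] H)).symm
      (TensorProduct.map LinearMap.id ((TensorProduct.assoc k H H H).toLinearMap ∘ₗ
      TensorProduct.map C.comul LinearMap.id ∘ₗ C.comul) (C.comul y)) := by
    rw [← X4_assoc, LinearEquiv.symm_apply_apply]
  rw [h1, h2]
  generalize C.comul x = t
  refine C.hindL (P := fun z => (C.GE C.E C.E ∘ₗ TensorProduct.map (C.mu ∘ₗ TensorProduct.mk k _ _ t)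
        (TensorProduct.map C.antipode C.antipode)) ((TensorProduct.assoc k H H (H ⊗[k] H)).symm
      (TensorProduct.map LinearMap.id ((TensorProduct.assoc k H H H).toLinearMap ∘ₗ
      TensorProduct.map C.comul LinearMap.id ∘ₗ C.comul) z)) =
      (C.GE C.E C.adj ∘ₗ TensorProduct.map (C.lam ∘ₗ TensorProduct.mk k _ _ t)
      (TensorProduct.map LinearMap.id C.antipode ∘ₗ C.comul)) z) ?_ ?_ (C.comul y)
  · intro gp p hp r
    simp only [TensorProduct.map_tmul, LinearMap.comp_apply, LinearMap.id_apply,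
      LinearEquiv.coe_coe, TensorProduct.mk_apply]
    generalize C.comul r = z
    induction z using TensorProduct.induction_on with
    | zero => simp
    | add x y hx hy => simp only [map_add, TensorProduct.tmul_add, hx, hy]
    | tmul c d =>
      refine C.hind2 (P := fun t => C.GE C.E C.E (TensorProduct.map (C.mu ∘ₗ TensorProduct.mk k _ _ t)
        (TensorProduct.map C.antipode C.antipode) ((TensorProduct.assoc k H H (H ⊗[k] H)).symm
        (p ⊗ₜ[k] (TensorProduct.assoc k H H H) (TensorProduct.map C.comul LinearMap.id
          (c ⊗ₜ[k] d))))) = C.GE C.E C.adj (C.lam (t ⊗ₜ[k] p) ⊗ₜ[k]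
            TensorProduct.map LinearMap.id C.antipode (c ⊗ₜ[k] d))) ?_ ?_ t
      · intro ga a ha gb b hb
        simp only [TensorProduct.map_tmul, LinearMap.id_apply]
        rw [C.lam_hom hb hp, ← TensorProduct.smul_tmul', map_smul, GE_tmul, adj_eq_E]
        generalize C.comul c = s
        induction s using TensorProduct.induction_on with
        | zero => simp
        | add x y hx hy => simp only [map_add, TensorProduct.tmul_add, TensorProduct.add_tmul, hx, hy,
            smul_add]
        | tmul u v =>
          simp only [TensorProduct.assoc_tmul, TensorProduct.assoc_symm_tmul, TensorProduct.map_tmul,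
            LinearMap.comp_apply, TensorProduct.mk_apply]
          rw [C.mu_hom hb hp, ← TensorProduct.smul_tmul', map_smul, GE_tmul, mS_tmul]
      · intro x y hx hy
        simp only [map_add, LinearMap.comp_add, TensorProduct.map_add_left, LinearMap.add_apply,
          TensorProduct.add_tmul, hx, hy]
  · intro x y hx hy
    simp only [map_add, hx, hy]

theorem cu (x p : H) : TensorProduct.rid k H (TensorProduct.map LinearMap.id C.counit
    (C.lam (C.comul x ⊗ₜ[k] p))) = C.mul (x ⊗ₜ[k] p) := by
  have h := C.counit_right (C.mul (x ⊗ₜ[k] p))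
  rw [C.comul_mul_apply] at h
  rw [← h]
  symm
  refine C.counitR_apply ((TensorProduct.rid k H).toLinearMap ∘ₗ
    TensorProduct.map LinearMap.id C.counit ∘ₗ C.lam ∘ₗ TensorProduct.mk k _ _ (C.comul x)) p
    ((TensorProduct.rid k H).toLinearMap ∘ₗ
    TensorProduct.map LinearMap.id C.counit ∘ₗ C.mu ∘ₗ TensorProduct.mk k _ _ (C.comul x)) ?_
  intro a b
  generalize C.comul x = t
  simp only [LinearMap.comp_apply, TensorProduct.mk_apply, LinearEquiv.coe_coe]
  refine C.hind2 (P := fun t => TensorProduct.rid k H (TensorProduct.map LinearMap.id C.counit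
    (C.mu (t ⊗ₜ[k] (a ⊗ₜ[k] b)))) = C.counit b • TensorProduct.rid k H
      (TensorProduct.map LinearMap.id C.counit (C.lam (t ⊗ₜ[k] a)))) ?_ ?_ t
  · intro gc c hc gd d hd
    refine C.hind1 (P := fun a => TensorProduct.rid k H (TensorProduct.map LinearMap.id C.counit
      (C.mu ((c ⊗ₜ[k] d) ⊗ₜ[k] (a ⊗ₜ[k] b)))) = C.counit b • TensorProduct.rid k H
      (TensorProduct.map LinearMap.id C.counit (C.lam ((c ⊗ₜ[k] d) ⊗ₜ[k] a)))) ?_ ?_ a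
    · intro ga a ha
      rw [C.mu_hom hd ha, C.lam_hom hd ha]
      simp only [map_smul, TensorProduct.map_tmul, TensorProduct.rid_tmul, C.counit_mul, smul_smul,
        LinearMap.id_apply]
      congr 1; ring
    · intro x y hx hy
      simp only [TensorProduct.tmul_add, TensorProduct.add_tmul, map_add, hx, hy, smul_add]
  · intro x y hx hy
    simp only [TensorProduct.tmul_add, TensorProduct.add_tmul, map_add, hx, hy, smul_add]

theorem adj_mul_id (x y : H) : C.mul (TensorProduct.map C.adj LinearMap.id
    ((TensorProduct.assoc k H H H).symm (TensorProduct.map LinearMap.id C.braid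
      (TensorProduct.assoc k H H H (C.comul x ⊗ₜ[k] y))))) = C.mul (x ⊗ₜ[k] y) := by
  refine C.hind1 (P := fun y => C.mul (TensorProduct.map C.adj LinearMap.id
    ((TensorProduct.assoc k H H H).symm (TensorProduct.map LinearMap.id C.braid
      (TensorProduct.assoc k H H H (C.comul x ⊗ₜ[k] y))))) = C.mul (x ⊗ₜ[k] y)) ?_ ?_ y
  · intro h y hy
    have h1 : C.mul (TensorProduct.map C.adj LinearMap.id
      ((TensorProduct.assoc k H H H).symm (TensorProduct.map LinearMap.id C.braid
      (TensorProduct.assoc k H H H (C.comul x ⊗ₜ[k] y))))) =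
      (C.mul ∘ₗ TensorProduct.map LinearMap.id (C.mul ∘ₗ C.braid ∘ₗ (TensorProduct.mk k H H).flip y ∘ₗ
        C.mul ∘ₗ TensorProduct.map C.antipode LinearMap.id) ∘ₗ
          (TensorProduct.assoc k H H H).toLinearMap)
        (TensorProduct.map C.comul LinearMap.id (C.comul x)) := by
      refine C.hind2 (P := fun t => C.mul (TensorProduct.map C.adj LinearMap.id
        ((TensorProduct.assoc k H H H).symm (TensorProduct.map LinearMap.id C.braid
        (TensorProduct.assoc k H H H (t ⊗ₜ[k] y))))) =
        (C.mul ∘ₗ TensorProduct.map LinearMap.id (C.mul ∘ₗ C.braid ∘ₗ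
          (TensorProduct.mk k H H).flip y ∘ₗ
          C.mul ∘ₗ TensorProduct.map C.antipode LinearMap.id) ∘ₗ
          (TensorProduct.assoc k H H H).toLinearMap)
        (TensorProduct.map C.comul LinearMap.id t)) ?_ ?_ (C.comul x)
      · intro gp p hp gq q hq
        simp only [TensorProduct.assoc_tmul, TensorProduct.map_tmul, LinearMap.id_apply,
          C.braid_apply _ _ _ _ hq hy, TensorProduct.tmul_smul, map_smul,
          TensorProduct.assoc_symm_tmul, adj_tmul]
        refine C.hind2 (P := fun s => C.φ gq h • C.mul (C.adj0 (s ⊗ₜ[k] y) ⊗ₜ[k] q) =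
          (C.mul ∘ₗ TensorProduct.map LinearMap.id (C.mul ∘ₗ C.braid ∘ₗ
          (TensorProduct.mk k H H).flip y ∘ₗ
          C.mul ∘ₗ TensorProduct.map C.antipode LinearMap.id) ∘ₗ
          (TensorProduct.assoc k H H H).toLinearMap) (s ⊗ₜ[k] q)) ?_ ?_ (C.comul p)
        · intro ga a ha gb b hb
          have hbq := C.mul_mem _ _ _ _ (C.antipode_mem _ _ hb) hq
          simp only [LinearMap.comp_apply, LinearEquiv.coe_coe, TensorProduct.assoc_tmul,
            TensorProduct.map_tmul, LinearMap.id_apply, LinearMap.flip_apply, TensorProduct.mk_apply,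
            C.braid_apply _ _ _ _ hbq hy, C.adj0_hom hb hy, map_smul, ← TensorProduct.smul_tmul',
            TensorProduct.tmul_smul, smul_smul, C.mul_assoc']
          congr 1
          rw [C.φ_mul_left]; ring
        · intro x y hx hy; simp only [TensorProduct.add_tmul, map_add, hx, hy, smul_add]
      · intro x y hx hy; simp only [TensorProduct.add_tmul, map_add, hx, hy]
    rw [h1]
    have h2 := C.counitR_apply (C.mul ∘ₗ (TensorProduct.mk k H H).flip y) x
      ((C.mul ∘ₗ TensorProduct.map LinearMap.id (C.mul ∘ₗ C.braid ∘ₗ (TensorProduct.mk k H H).flip y ∘ₗ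
        C.mul ∘ₗ TensorProduct.map C.antipode LinearMap.id)) ∘ₗ
          (TensorProduct.map LinearMap.id C.comul)) ?_
    · simp only [LinearMap.comp_apply, LinearEquiv.coe_coe, C.coassoc_apply] at h2 ⊢
      simpa using h2
    · intro a b
      simp only [LinearMap.comp_apply, TensorProduct.map_tmul, LinearMap.id_apply, C.antipode_left,
        map_smul, LinearMap.flip_apply, TensorProduct.mk_apply,
        C.braid_apply _ _ _ _ C.one_mem hy, C.phi_one_left, one_smul, C.mul_one',
        TensorProduct.tmul_smul]
  · intro x y hx hy; simp only [TensorProduct.tmul_add, map_add, hx, hy]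

end Aux2

end ColorHopfAlg
namespace ColorHopfAlg

section Aux3

variable {k G}
variable {A B : Type*} [AddCommGroup A] [Module k A] [AddCommGroup B] [Module k B]
  {CA : ColorHopfAlg k G A} {CB : ColorHopfAlg k G B} {f : A →ₗ[k] B}

theorem hom_comul (hf : IsColorHom k G CA CB f) (x : A) :
    CB.comul (f x) = TensorProduct.map f f (CA.comul x) := by
  simpa using LinearMap.congr_fun hf.map_comul x

theorem hom_counit (hf : IsColorHom k G CA CB f) (x : A) : CB.counit (f x) = CA.counit x := by
  simpa using LinearMap.congr_fun hf.map_counit x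

theorem hom_mul (hf : IsColorHom k G CA CB f) (t : A ⊗[k] A) :
    f (CA.mul t) = CB.mul (TensorProduct.map f f t) := by
  induction t using TensorProduct.induction_on with
  | zero => simp
  | add x y hx hy => simp only [map_add, hx, hy]
  | tmul a b => simp [hf.map_mul]

theorem hom_antipode (hf : IsColorHom k G CA CB f) (x : A) :
    CB.antipode (f x) = f (CA.antipode x) := by
  refine CA.conv_unique CB.mul CB.one CB.mul_assoc' CB.one_mul' CB.mul_one'
    (CB.antipode ∘ₗ f) f (f ∘ₗ CA.antipode) ?_ ?_ x
  · intro x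
    have h := CB.antipode_left (f x)
    rw [hom_comul hf, hom_counit hf] at h
    rw [← h]
    generalize CA.comul x = t
    induction t using TensorProduct.induction_on with
    | zero => simp
    | add x y hx hy => simp only [map_add, hx, hy]
    | tmul a b => simp
  · intro x
    have h := congrArg f (CA.antipode_right x)
    rw [map_smul, hf.map_one, hom_mul hf] at h
    rw [← h]
    generalize CA.comul x = t
    induction t using TensorProduct.induction_on with
    | zero => simp
    | add x y hx hy => simp only [map_add, hx, hy]
    | tmul a b => simp

theorem hom_adj (hφ : CB.φ = CA.φ) (hf : IsColorHom k G CA CB f) (x y : A) :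
    f (CA.adj (x ⊗ₜ[k] y)) = CB.adj (f x ⊗ₜ[k] f y) := by
  rw [adj_tmul, adj_tmul, hom_comul hf]
  refine CA.hind2 (P := fun t => f (CA.adj0 (t ⊗ₜ[k] y)) =
    CB.adj0 (TensorProduct.map f f t ⊗ₜ[k] f y)) ?_ ?_ (CA.comul x)
  · intro ga a ha gb b hb
    refine CA.hind1 (P := fun y => f (CA.adj0 ((a ⊗ₜ[k] b) ⊗ₜ[k] y)) =
      CB.adj0 (TensorProduct.map f f (a ⊗ₜ[k] b) ⊗ₜ[k] f y)) ?_ ?_ y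
    · intro h y hy
      rw [TensorProduct.map_tmul, CA.adj0_hom hb hy,
        CB.adj0_hom (hf.map_grade _ _ hb) (hf.map_grade _ _ hy), map_smul, hf.map_mul, hf.map_mul,
        hom_antipode hf, hφ]
    · intro x y hx hy; simp only [TensorProduct.tmul_add, map_add, hx, hy]
  · intro x y hx hy; simp only [TensorProduct.add_tmul, map_add, hx, hy]

/-- the commutation hypothesis, transported to `A` -/
def CommHyp (CA : ColorHopfAlg k G A) (f : A →ₗ[k] B) (V W : Submodule k A) : Prop :=
  ∀ x ∈ V, ∀ y ∈ W, f (CA.adj (x ⊗ₜ[k] y)) = CA.counit x • f y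

theorem comm_lemma {V W : Submodule k A} (hV : CA.IsCHSub V)
    (hf : IsColorHom k G CA CB f) (hA : CommHyp CA f V W) {P h : G} {x y : A}
    (hxV : x ∈ V) (hxP : x ∈ CA.grade P) (hyW : y ∈ W) (hy : y ∈ CA.grade h) :
    f (CA.mul (x ⊗ₜ[k] y)) = CA.φ P h • f (CA.mul (y ⊗ₜ[k] x)) := by
  rw [← CA.adj_mul_id]
  have h1 : f (CA.mul (TensorProduct.map CA.adj LinearMap.id
      ((TensorProduct.assoc k A A A).symm (TensorProduct.map LinearMap.id CA.braid
      (TensorProduct.assoc k A A A (CA.comul x ⊗ₜ[k] y)))))) =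
      (f ∘ₗ CA.mul ∘ₗ CA.braid ∘ₗ (TensorProduct.mk k A A).flip y ∘ₗ
        (TensorProduct.lid k A).toLinearMap ∘ₗ TensorProduct.map CA.counit LinearMap.id)
        (CA.comul x) := by
    refine CA.hindVV hV (P := fun t => f (CA.mul (TensorProduct.map CA.adj LinearMap.id
      ((TensorProduct.assoc k A A A).symm (TensorProduct.map LinearMap.id CA.braid
      (TensorProduct.assoc k A A A (t ⊗ₜ[k] y)))))) =
      (f ∘ₗ CA.mul ∘ₗ CA.braid ∘ₗ (TensorProduct.mk k A A).flip y ∘ₗ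
        (TensorProduct.lid k A).toLinearMap ∘ₗ TensorProduct.map CA.counit LinearMap.id) t)
        ?_ ?_ x hxV
    · intro gp p hp hpV gq q hq hqV
      simp only [TensorProduct.assoc_tmul, TensorProduct.map_tmul, LinearMap.id_apply,
        CA.braid_apply _ _ _ _ hq hy, TensorProduct.tmul_smul, map_smul,
        TensorProduct.assoc_symm_tmul, LinearMap.comp_apply, LinearEquiv.coe_coe,
        TensorProduct.lid_tmul, LinearMap.flip_apply, TensorProduct.mk_apply, hf.map_mul,
        hA p hpV y hyW, ← TensorProduct.smul_tmul']
      rw [smul_comm]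
    · intro x y hx hy; simp only [TensorProduct.add_tmul, map_add, hx, hy]
  rw [h1]
  simp only [LinearMap.comp_apply, LinearEquiv.coe_coe, CA.counit_left, LinearMap.flip_apply,
    TensorProduct.mk_apply, CA.braid_apply _ _ _ _ hxP hy, map_smul]

/-- `e ↦ (1 ⊗ f) c(e ⊗ v)` -/
noncomputable def kap (CA : ColorHopfAlg k G A) (f : A →ₗ[k] B) (v : A) : A →ₗ[k] A ⊗[k] B :=
  TensorProduct.map LinearMap.id f ∘ₗ CA.braid ∘ₗ (TensorProduct.mk k A A).flip v

theorem kap_hom {g h : G} {e v : A} (he : e ∈ CA.grade g) (hv : v ∈ CA.grade h) :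
    kap CA f v e = CA.φ g h • (v ⊗ₜ[k] f e) := by
  simp [kap, CA.braid_apply _ _ _ _ he hv]

theorem kap_add (v w : A) : kap CA f (v + w) = kap CA f v + kap CA f w := by
  simp [kap, LinearMap.comp_add]

theorem star2 {V W : Submodule k A} (hV : CA.IsCHSub V) (hW : CA.IsCHSub W)
    (hf : IsColorHom k G CA CB f) (hA : CommHyp CA f V W) {x y : A}
    (hxV : x ∈ V) (hyW : y ∈ W) (w v : A) :
    TensorProduct.map LinearMap.id (kap CA f v) (CA.braid (CA.adj (x ⊗ₜ[k] y) ⊗ₜ[k] w)) =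
    CA.counit x • TensorProduct.map LinearMap.id (kap CA f v) (CA.braid (y ⊗ₜ[k] w)) := by
  refine CA.hind1 (P := fun v =>
    TensorProduct.map LinearMap.id (kap CA f v) (CA.braid (CA.adj (x ⊗ₜ[k] y) ⊗ₜ[k] w)) =
    CA.counit x • TensorProduct.map LinearMap.id (kap CA f v) (CA.braid (y ⊗ₜ[k] w))) ?_ ?_ v
  · intro gv v hv
    refine CA.hind1 (P := fun w =>
      TensorProduct.map LinearMap.id (kap CA f v) (CA.braid (CA.adj (x ⊗ₜ[k] y) ⊗ₜ[k] w)) =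
      CA.counit x • TensorProduct.map LinearMap.id (kap CA f v) (CA.braid (y ⊗ₜ[k] w))) ?_ ?_ w
    · intro gw w hw
      refine CA.hindV hW (P := fun y =>
        TensorProduct.map LinearMap.id (kap CA f v) (CA.braid (CA.adj (x ⊗ₜ[k] y) ⊗ₜ[k] w)) =
        CA.counit x • TensorProduct.map LinearMap.id (kap CA f v) (CA.braid (y ⊗ₜ[k] w))) ?_ ?_ y hyW
      · intro h y hy hyW
        rw [adj_tmul]
        have h1 : TensorProduct.map LinearMap.id (kap CA f v)
            (CA.braid (CA.adj0 (CA.comul x ⊗ₜ[k] y) ⊗ₜ[k] w)) =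
            TensorProduct.map LinearMap.id (kap CA f v) (CA.braid (CA.mul (CA.braid
              (CA.mul (TensorProduct.map LinearMap.id CA.antipode (CA.comul x)) ⊗ₜ[k] y)) ⊗ₜ[k] w)) := by
          refine CA.hindVV hV (P := fun t => TensorProduct.map LinearMap.id (kap CA f v)
            (CA.braid (CA.adj0 (t ⊗ₜ[k] y) ⊗ₜ[k] w)) =
            TensorProduct.map LinearMap.id (kap CA f v) (CA.braid (CA.mul (CA.braid
              (CA.mul (TensorProduct.map LinearMap.id CA.antipode t) ⊗ₜ[k] y)) ⊗ₜ[k] w)))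
            ?_ ?_ x hxV
          · intro gp p hp hpV gq q hq hqV
            have hSq := CA.antipode_mem _ _ hq
            have m1 := CA.mul_mem _ _ _ _ hp (CA.mul_mem _ _ _ _ hy hSq)
            have m2 := CA.mul_mem _ _ _ _ hp hSq
            have m3 := CA.mul_mem _ _ _ _ hy m2
            simp only [TensorProduct.map_tmul, LinearMap.id_apply]
            rw [CA.adj0_hom hq hy, CA.braid_apply _ _ _ _ m2 hy]
            simp only [map_smul, ← TensorProduct.smul_tmul', CA.braid_apply _ _ _ _ m1 hw,
              CA.braid_apply _ _ _ _ m3 hw, TensorProduct.map_tmul, LinearMap.id_apply,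
              kap_hom m1 hv, kap_hom m3 hv, TensorProduct.tmul_smul, smul_smul]
            rw [← CA.mul_assoc' p, hf.map_mul, comm_lemma hV hf hA hpV hp hyW hy,
              ← TensorProduct.smul_tmul', map_smul, ← hf.map_mul, CA.mul_assoc' y]
            simp only [TensorProduct.tmul_smul, smul_smul]
            congr 1
            simp only [CA.φ_mul_left]
            ring
          · intro x y hx hy; simp only [TensorProduct.add_tmul, map_add, hx, hy]
        rw [h1, CA.antipode_right, ← TensorProduct.smul_tmul', map_smul,
          CA.braid_apply _ _ _ _ CA.one_mem hy, CA.phi_one_left, one_smul, map_smul, CA.mul_one',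
          ← TensorProduct.smul_tmul', map_smul, map_smul]
      · intro x y hx hy
        simp only [TensorProduct.tmul_add, TensorProduct.add_tmul, map_add, hx, hy, smul_add]
    · intro x y hx hy
      simp only [TensorProduct.tmul_add, map_add, hx, hy, smul_add]
  · intro x y hx hy
    simp only [kap_add, TensorProduct.map_add_right, LinearMap.add_apply, hx, hy, smul_add]

theorem GE_star {V W : Submodule k A} (hV : CA.IsCHSub V) (hW : CA.IsCHSub W)
    (hf : IsColorHom k G CA CB f) (hA : CommHyp CA f V W) {a r : A}
    (haV : a ∈ V) (hrW : r ∈ W) (b w v : A) :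
    TensorProduct.map LinearMap.id (kap CA f v)
      (CA.GE CA.E CA.adj ((b ⊗ₜ[k] a) ⊗ₜ[k] (r ⊗ₜ[k] w))) =
    CA.counit a • TensorProduct.map (CA.E ∘ₗ TensorProduct.mk k A A b) (kap CA f v)
      (CA.braid (r ⊗ₜ[k] w)) := by
  have h1 : ∀ z : A ⊗[k] A, TensorProduct.map LinearMap.id (kap CA f v)
      (TensorProduct.map CA.E LinearMap.id ((TensorProduct.assoc k A A A).symm (b ⊗ₜ[k] z))) =
      TensorProduct.map (CA.E ∘ₗ TensorProduct.mk k A A b) LinearMap.id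
        (TensorProduct.map LinearMap.id (kap CA f v) z) := by
    intro z
    induction z using TensorProduct.induction_on with
    | zero => simp
    | add x y hx hy => simp only [map_add, TensorProduct.tmul_add, hx, hy]
    | tmul a b => simp
  rw [GE_tmul, h1, star2 hV hW hf hA haV hrW, map_smul, ← LinearMap.comp_apply,
    ← TensorProduct.map_comp, LinearMap.id_comp, LinearMap.comp_id]

theorem GE_star2 {V W : Submodule k A} (hV : CA.IsCHSub V) (hW : CA.IsCHSub W)
    (hf : IsColorHom k G CA CB f) (hA : CommHyp CA f V W) {x r : A}
    (hxV : x ∈ V) (hrW : r ∈ W) (p v : A) :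
    TensorProduct.map LinearMap.id (kap CA f v)
      (CA.GE CA.E CA.adj (CA.lam (CA.comul x ⊗ₜ[k] p) ⊗ₜ[k]
        TensorProduct.map LinearMap.id CA.antipode (CA.comul r))) =
    TensorProduct.map (CA.E ∘ₗ TensorProduct.mk k A A (CA.mul (x ⊗ₜ[k] p)) ∘ₗ CA.antipode)
      (kap CA f v) (CA.comul r) := by
  have h1 : TensorProduct.map LinearMap.id (kap CA f v)
      (CA.GE CA.E CA.adj (CA.lam (CA.comul x ⊗ₜ[k] p) ⊗ₜ[k]
        TensorProduct.map LinearMap.id CA.antipode (CA.comul r))) =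
      TensorProduct.map (CA.E ∘ₗ TensorProduct.mk k A A (TensorProduct.rid k A
        (TensorProduct.map LinearMap.id CA.counit (CA.lam (CA.comul x ⊗ₜ[k] p)))))
        (kap CA f v) (CA.braid (TensorProduct.map LinearMap.id CA.antipode (CA.comul r))) := by
    refine CA.hind1 (P := fun p => TensorProduct.map LinearMap.id (kap CA f v)
      (CA.GE CA.E CA.adj (CA.lam (CA.comul x ⊗ₜ[k] p) ⊗ₜ[k]
        TensorProduct.map LinearMap.id CA.antipode (CA.comul r))) =
      TensorProduct.map (CA.E ∘ₗ TensorProduct.mk k A A (TensorProduct.rid k A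
        (TensorProduct.map LinearMap.id CA.counit (CA.lam (CA.comul x ⊗ₜ[k] p)))))
        (kap CA f v) (CA.braid (TensorProduct.map LinearMap.id CA.antipode (CA.comul r)))) ?_ ?_ p
    · intro gp p hp
      refine CA.hindVV hV (P := fun t => TensorProduct.map LinearMap.id (kap CA f v)
        (CA.GE CA.E CA.adj (CA.lam (t ⊗ₜ[k] p) ⊗ₜ[k]
        TensorProduct.map LinearMap.id CA.antipode (CA.comul r))) =
        TensorProduct.map (CA.E ∘ₗ TensorProduct.mk k A A (TensorProduct.rid k A
        (TensorProduct.map LinearMap.id CA.counit (CA.lam (t ⊗ₜ[k] p)))))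
        (kap CA f v) (CA.braid (TensorProduct.map LinearMap.id CA.antipode (CA.comul r))))
        ?_ ?_ x hxV
      · intro ga a ha haV gb b hb hbV
        rw [CA.lam_hom hb hp]
        refine CA.hindVV hW (P := fun s => TensorProduct.map LinearMap.id (kap CA f v)
          (CA.GE CA.E CA.adj ((CA.φ gb gp • (CA.mul (a ⊗ₜ[k] p) ⊗ₜ[k] b)) ⊗ₜ[k]
          TensorProduct.map LinearMap.id CA.antipode s)) =
          TensorProduct.map (CA.E ∘ₗ TensorProduct.mk k A A (TensorProduct.rid k A
          (TensorProduct.map LinearMap.id CA.counit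
            (CA.φ gb gp • (CA.mul (a ⊗ₜ[k] p) ⊗ₜ[k] b)))))
          (kap CA f v) (CA.braid (TensorProduct.map LinearMap.id CA.antipode s)))
          ?_ ?_ r hrW
        · intro gc c hc hcW gd d hd hdW
          rw [TensorProduct.map_tmul, ← TensorProduct.smul_tmul', map_smul, map_smul,
            LinearMap.id_apply, GE_star hV hW hf hA hbV hcW]
          simp only [map_smul, TensorProduct.map_tmul, TensorProduct.rid_tmul, LinearMap.id_apply,
            LinearMap.comp_smul, TensorProduct.map_smul_left, LinearMap.smul_apply]
        · intro x y hx hy; simp only [TensorProduct.tmul_add, map_add, hx, hy]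
      · intro x y hx hy
        simp only [TensorProduct.add_tmul, map_add, LinearMap.comp_add, TensorProduct.map_add_left,
          LinearMap.add_apply, hx, hy]
    · intro x y hx hy
      simp only [TensorProduct.add_tmul, TensorProduct.tmul_add, map_add, LinearMap.comp_add,
        TensorProduct.map_add_left, LinearMap.add_apply, hx, hy]
  rw [h1, CA.cu, CA.braid_S, CA.cocomm_apply, ← LinearMap.comp_apply, ← TensorProduct.map_comp,
    LinearMap.comp_id, LinearMap.comp_assoc]

theorem comul_adj_kap {V W : Submodule k A} (hV : CA.IsCHSub V) (hW : CA.IsCHSub W)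
    (hf : IsColorHom k G CA CB f) (hA : CommHyp CA f V W) {x y : A}
    (hxV : x ∈ V) (hyW : y ∈ W) (v : A) :
    TensorProduct.map LinearMap.id (kap CA f v) (CA.comul (CA.adj (x ⊗ₜ[k] y))) =
      TensorProduct.map (CA.adj ∘ₗ TensorProduct.mk k A A x) (kap CA f v) (CA.comul y) := by
  rw [comul_adj]
  have h1 : TensorProduct.map LinearMap.id (kap CA f v)
      ((CA.GE CA.E CA.adj ∘ₗ TensorProduct.map (CA.lam ∘ₗ TensorProduct.mk k _ _ (CA.comul x))
      (TensorProduct.map LinearMap.id CA.antipode ∘ₗ CA.comul)) (CA.comul y)) =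
      (TensorProduct.map (CA.E ∘ₗ CA.mS x) (kap CA f v) ∘ₗ
        (TensorProduct.assoc k A A A).symm.toLinearMap)
        (TensorProduct.map LinearMap.id CA.comul (CA.comul y)) := by
    refine CA.hindVV hW (P := fun t => TensorProduct.map LinearMap.id (kap CA f v)
      ((CA.GE CA.E CA.adj ∘ₗ TensorProduct.map (CA.lam ∘ₗ TensorProduct.mk k _ _ (CA.comul x))
      (TensorProduct.map LinearMap.id CA.antipode ∘ₗ CA.comul)) t) =
      (TensorProduct.map (CA.E ∘ₗ CA.mS x) (kap CA f v) ∘ₗ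
        (TensorProduct.assoc k A A A).symm.toLinearMap)
        (TensorProduct.map LinearMap.id CA.comul t)) ?_ ?_ y hyW
    · intro gp p hp hpW gr r hr hrW
      simp only [LinearMap.comp_apply, TensorProduct.map_tmul, TensorProduct.mk_apply,
        LinearMap.id_apply, LinearEquiv.coe_coe]
      rw [GE_star2 hV hW hf hA hxV hrW]
      generalize CA.comul r = s
      induction s using TensorProduct.induction_on with
      | zero => simp
      | add x y hx hy => simp only [map_add, TensorProduct.tmul_add, hx, hy]
      | tmul a b => simp [mS_tmul]
    · intro x y hx hy; simp only [map_add, hx, hy]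
  rw [h1, LinearMap.comp_apply, LinearEquiv.coe_coe, ← CA.coassoc_symm, ← LinearMap.comp_apply,
    ← TensorProduct.map_comp, LinearMap.comp_id]
  congr 2
  ext y
  simp [adj_eq_E]

theorem comul_adj_mu {V W : Submodule k A} (hV : CA.IsCHSub V) (hW : CA.IsCHSub W)
    (hf : IsColorHom k G CA CB f) (hA : CommHyp CA f V W) {x y : A}
    (hxV : x ∈ V) (hyW : y ∈ W) (τ : A ⊗[k] A) :
    TensorProduct.map LinearMap.id f (CA.mu (CA.comul (CA.adj (x ⊗ₜ[k] y)) ⊗ₜ[k] τ)) =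
    TensorProduct.map LinearMap.id f (CA.mu (TensorProduct.map (CA.adj ∘ₗ TensorProduct.mk k A A x)
      LinearMap.id (CA.comul y) ⊗ₜ[k] τ)) := by
  refine CA.hind2 (P := fun τ =>
    TensorProduct.map LinearMap.id f (CA.mu (CA.comul (CA.adj (x ⊗ₜ[k] y)) ⊗ₜ[k] τ)) =
    TensorProduct.map LinearMap.id f (CA.mu (TensorProduct.map (CA.adj ∘ₗ TensorProduct.mk k A A x)
      LinearMap.id (CA.comul y) ⊗ₜ[k] τ))) ?_ ?_ τ
  · intro gv v hv gu u hu
    have h1 : ∀ s : A ⊗[k] A, TensorProduct.map LinearMap.id f (CA.mu (s ⊗ₜ[k] (v ⊗ₜ[k] u))) =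
        (TensorProduct.map CA.mul (CB.mul ∘ₗ (TensorProduct.mk k B B).flip (f u)) ∘ₗ
          (TensorProduct.assoc k A A B).symm.toLinearMap)
          (TensorProduct.map LinearMap.id (kap CA f v) s) := by
      intro s
      refine CA.hind2 (P := fun s =>
        TensorProduct.map LinearMap.id f (CA.mu (s ⊗ₜ[k] (v ⊗ₜ[k] u))) =
        (TensorProduct.map CA.mul (CB.mul ∘ₗ (TensorProduct.mk k B B).flip (f u)) ∘ₗ
          (TensorProduct.assoc k A A B).symm.toLinearMap)
          (TensorProduct.map LinearMap.id (kap CA f v) s)) ?_ ?_ s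
      · intro ga a ha gb b hb
        rw [CA.mu_hom hb hv, TensorProduct.map_tmul, kap_hom hb hv]
        simp [hf.map_mul]
      · intro x y hx hy; simp only [TensorProduct.add_tmul, map_add, hx, hy]
    rw [h1, h1, comul_adj_kap hV hW hf hA hxV hyW]
    congr 1
    generalize CA.comul y = t
    induction t using TensorProduct.induction_on with
    | zero => simp
    | add x y hx hy => simp only [map_add, hx, hy]
    | tmul a b => simp
  · intro x y hx hy; simp only [TensorProduct.tmul_add, map_add, hx, hy]

theorem mu_map_S (C : ColorHopfAlg k G A) (g : A →ₗ[k] A) (X : (A ⊗[k] A) ⊗[k] (A ⊗[k] A)) :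
    C.mu (TensorProduct.map (TensorProduct.map g LinearMap.id)
      (TensorProduct.map C.antipode C.antipode) X) =
    TensorProduct.map (C.mul ∘ₗ TensorProduct.map g C.antipode)
      (C.mul ∘ₗ TensorProduct.map LinearMap.id C.antipode) (midMap k C.braid X) := by
  induction X using TensorProduct.induction_on with
  | zero => simp
  | add x y hx hy => simp only [map_add, hx, hy]
  | tmul s t =>
    refine C.hind2 (P := fun s => C.mu (TensorProduct.map (TensorProduct.map g LinearMap.id)
      (TensorProduct.map C.antipode C.antipode) (s ⊗ₜ[k] t)) =
      TensorProduct.map (C.mul ∘ₗ TensorProduct.map g C.antipode)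
      (C.mul ∘ₗ TensorProduct.map LinearMap.id C.antipode) (midMap k C.braid (s ⊗ₜ[k] t))) ?_ ?_ s
    · intro g1 a ha g2 b hb
      refine C.hind2 (P := fun t => C.mu (TensorProduct.map (TensorProduct.map g LinearMap.id)
        (TensorProduct.map C.antipode C.antipode) ((a ⊗ₜ[k] b) ⊗ₜ[k] t)) =
        TensorProduct.map (C.mul ∘ₗ TensorProduct.map g C.antipode)
        (C.mul ∘ₗ TensorProduct.map LinearMap.id C.antipode)
          (midMap k C.braid ((a ⊗ₜ[k] b) ⊗ₜ[k] t))) ?_ ?_ t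
      · intro g3 c hc g4 d hd
        rw [C.mid_hom hb hc]
        simp only [TensorProduct.map_tmul, LinearMap.id_apply, map_smul, LinearMap.comp_apply]
        rw [C.mu_hom hb (C.antipode_mem _ _ hc)]
      · intro x y hx hy; simp only [TensorProduct.tmul_add, map_add, hx, hy]
    · intro x y hx hy; simp only [TensorProduct.add_tmul, map_add, hx, hy]

theorem commMap_tmul (C : ColorHopfAlg k G A) (x y : A) : C.commMap (x ⊗ₜ[k] y) =
    C.mul (TensorProduct.map (C.adj ∘ₗ TensorProduct.mk k A A x) C.antipode (C.comul y)) := by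
  simp only [commMap, LinearMap.comp_apply, TensorProduct.map_tmul, LinearMap.id_apply,
    LinearEquiv.coe_coe]
  generalize C.comul y = t
  induction t using TensorProduct.induction_on with
  | zero => simp
  | add x y hx hy => simp only [map_add, TensorProduct.tmul_add, hx, hy]
  | tmul a b => simp

theorem final {V W : Submodule k A} (hV : CA.IsCHSub V) (hW : CA.IsCHSub W)
    (hf : IsColorHom k G CA CB f) (hA : CommHyp CA f V W) {x y : A}
    (hxV : x ∈ V) (hyW : y ∈ W) :
    TensorProduct.map LinearMap.id f (CA.comul (CA.commMap (x ⊗ₜ[k] y))) =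
      CA.commMap (x ⊗ₜ[k] y) ⊗ₜ[k] CB.one := by
  have h1 : TensorProduct.map LinearMap.id f (CA.comul (CA.commMap (x ⊗ₜ[k] y))) =
      TensorProduct.map LinearMap.id f (CA.mu (TensorProduct.map (TensorProduct.map
        (CA.adj ∘ₗ TensorProduct.mk k A A x) LinearMap.id)
      (TensorProduct.map CA.antipode CA.antipode) (CA.X4 y))) := by
    rw [commMap_tmul, X4, LinearMap.comp_apply]
    refine CA.hindVV hW (P := fun t => TensorProduct.map LinearMap.id f (CA.comul
      (CA.mul (TensorProduct.map (CA.adj ∘ₗ TensorProduct.mk k A A x) CA.antipode t))) =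
      TensorProduct.map LinearMap.id f (CA.mu (TensorProduct.map (TensorProduct.map
        (CA.adj ∘ₗ TensorProduct.mk k A A x) LinearMap.id)
      (TensorProduct.map CA.antipode CA.antipode) (TensorProduct.map CA.comul CA.comul t))))
        ?_ ?_ y hyW
    · intro gp p hp hpW gq q hq hqW
      simp only [TensorProduct.map_tmul, CA.comul_mul_apply, CA.comul_antipode]
      exact comul_adj_mu hV hW hf hA hxV hpW _
    · intro x y hx hy; simp only [map_add, hx, hy]
  rw [h1, mu_map_S, CA.mid_X4, X4]
  refine CA.counitR_apply ((TensorProduct.mk k A B).flip CB.one ∘ₗ CA.commMap ∘ₗ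
    TensorProduct.mk k A A x) y (TensorProduct.map LinearMap.id f ∘ₗ
      TensorProduct.map (CA.mul ∘ₗ TensorProduct.map (CA.adj ∘ₗ TensorProduct.mk k A A x) CA.antipode)
      (CA.mul ∘ₗ TensorProduct.map LinearMap.id CA.antipode) ∘ₗ
        TensorProduct.map CA.comul CA.comul) ?_
  intro a b
  simp [CA.antipode_right, hf.map_one, commMap_tmul]

end Aux3

end ColorHopfAlg

section Statements

variable {A B : Type*} [AddCommGroup A] [Module k A] [AddCommGroup B] [Module k B]

/-- if `f : A → B` is a morphism of cocommutative color Hopf algebras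
such that `f(X)` and `f(Y)` commute in `B`, then each commutator `[x,y]` lies in the
Hopf kernel of `f`, i.e. `[x,y]₁ ⊗ f([x,y]₂) = [x,y] ⊗ 1`. -/
theorem commutator_in_hker (CA : ColorHopfAlg k G A) (CB : ColorHopfAlg k G B)
    (hφ : CB.φ = CA.φ) (f : A →ₗ[k] B) (hf : IsColorHom k G CA CB f)
    (V W : Submodule k A) (hV : CA.IsCHSub V) (hW : CA.IsCHSub W)
    (hcomm : ∀ u v : B, u ∈ V.map f → v ∈ W.map f →
      CB.adj (u ⊗ₜ[k] v) = CB.counit u • v) :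
    ∀ x ∈ V, ∀ y ∈ W,
      (TensorProduct.map LinearMap.id f) (CA.comul (CA.commMap (x ⊗ₜ[k] y))) =
        (CA.commMap (x ⊗ₜ[k] y)) ⊗ₜ[k] CB.one := by
  intro x hx y hy
  refine ColorHopfAlg.final hV hW hf ?_ hx hy
  intro a ha b hb
  rw [ColorHopfAlg.hom_adj hφ hf, hcomm _ _ (Submodule.mem_map_of_mem ha)
    (Submodule.mem_map_of_mem hb), ColorHopfAlg.hom_counit hf]

end Statements

end ColorHopfPaper
end
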